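/- Let h be a positive even integer and ϑ ≥ 0.7231, and assume Hypothesis D(ϑ, h). Put H = {0, h}, u_0 = (√34 − 2)/9 and a'_n = (Λ_R(n; H, 0) + (3u_0/log R) Λ_R(n; H, 1))^2. Then there exist a constant c_1 > 0 and ε > 0 such that with R = N^{(ϑ−ε)/2}, for all sufficiently large N, (1/N) Σ_{N ≤ n < 2N, n and n+h prime} a'_n · log(3N) ≥ c_1 · 𝔖_0(h) · (log R)^3. -/

import Mathlib

open Filter

/-- The Liouville function `λ(n) = (-1)^Ω(n)`. -/
noncomputable def lio (n : ℕ) : ℝ := (-1) ^ n.primeFactorsList.length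

/-- `θ(n) = log n` if `n` is prime, `0` otherwise. -/
noncomputable def theta (n : ℕ) : ℝ := if n.Prime then Real.log n else 0

/-- `max_a |∑_{n ≤ N, n ≡ a (q)} f(n)|`. -/
noncomputable def maxAbs (f : ℕ → ℝ) (q N : ℕ) : ℝ :=
  ⨆ a : ℕ, |∑ n ∈ Finset.Icc 1 N, if n % q = a % q then f n else 0|

/-- `f` has (zero-mean) distribution level `ϑ`. -/
def HasLevel (f : ℕ → ℝ) (ϑ : ℝ) : Prop :=
  ∀ ε > (0 : ℝ), ∀ A > (0 : ℝ), ∃ C > (0 : ℝ), ∀ N : ℕ, 2 ≤ N →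
    ∑ q ∈ Finset.Icc 1 ⌊(N : ℝ) ^ (ϑ - ε)⌋₊, maxAbs f q N ≤ C * N / Real.log N ^ A

/-- `max_{(a,q)=1} |∑_{p ≤ N, p ≡ a (q)} log p - N/φ(q)|`. -/
noncomputable def primeMaxAbs (q N : ℕ) : ℝ :=
  ⨆ a : ℕ, if Nat.Coprime a q then
    |(∑ p ∈ Finset.Icc 1 N, if p.Prime ∧ p % q = a % q then Real.log p else 0)
      - N / q.totient|
  else 0

/-- The primes have distribution level `ϑ` (Bombieri–Vinogradov/Elliott–Halberstam type). -/
def PrimesLevel (ϑ : ℝ) : Prop :=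
  ∀ ε > (0 : ℝ), ∀ A > (0 : ℝ), ∃ C > (0 : ℝ), ∀ N : ℕ, 2 ≤ N →
    ∑ q ∈ Finset.Icc 1 ⌊(N : ℝ) ^ (ϑ - ε)⌋₊, primeMaxAbs q N ≤ C * N / Real.log N ^ A

/-- Hypothesis D(ϑ, h): the primes and the four auxiliary Liouville-type sequences
all have distribution level `ϑ`. -/
def HypD (ϑ : ℝ) (h : ℕ) : Prop :=
  PrimesLevel ϑ ∧
  HasLevel lio ϑ ∧
  HasLevel (fun n => lio n * lio (n + h)) ϑ ∧
  HasLevel (fun n => theta n * lio (n + h)) ϑ ∧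
  HasLevel (fun n => if h < n then theta n * lio (n - h) else 0) ϑ

/-- The Goldston–Pintz–Yıldırım weight
`Λ_R(n; H, l) = (1/(k+l)!) ∑_{d ≤ R, d ∣ P_H(n)} μ(d) (log (R/d))^{k+l}`. -/
noncomputable def LambdaR (R : ℝ) (n : ℕ) (H : Finset ℕ) (l : ℕ) : ℝ :=
  (1 / (H.card + l).factorial) *
    ∑ d ∈ Finset.Icc 1 ⌊R⌋₊,
      if d ∣ ∏ hi ∈ H, (n + hi) then
        (ArithmeticFunction.moebius d : ℝ) * Real.log (R / d) ^ (H.card + l)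
      else 0

/-- `ν_m(H)`: the number of residue classes `n` mod `m` with `m ∣ P_H(n)`. -/
def nu (H : Finset ℕ) (m : ℕ) : ℕ :=
  ((Finset.range m).filter fun n => m ∣ ∏ hi ∈ H, (n + hi)).card

/-- The singular series `𝔖(H) = ∏_p (1 - ν_p(H)/p)(1 - 1/p)^{-k}`. -/
noncomputable def singSeries (H : Finset ℕ) : ℝ :=
  ∏' p : Nat.Primes, (1 - (nu H p : ℝ) / (p : ℕ)) * (1 - 1 / ((p : ℕ) : ℝ)) ^ (-(H.card : ℤ))

/-- `𝔖₀(h) = ∏_{p ∣ h} (1-1/p)⁻¹ ∏_{p ∤ h} (1 - 1/(p-1)²)`. -/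
noncomputable def singSeries0 (h : ℕ) : ℝ :=
  ∏' p : Nat.Primes, if (p : ℕ) ∣ h then (1 - 1 / ((p : ℕ) : ℝ))⁻¹
    else 1 - 1 / (((p : ℕ) : ℝ) - 1) ^ 2

open Topology

/-- The strongly multiplicative function `n ↦ ∏_{p ∣ n} c(p)`. -/
noncomputable def primeProd (c : ℕ → ℝ) (n : ℕ) : ℝ := ∏ p ∈ n.primeFactors, c p

@[simp] lemma primeProd_one (c : ℕ → ℝ) : primeProd c 1 = 1 := by simp [primeProd]

lemma primeProd_mul_fun (c c' : ℕ → ℝ) (n : ℕ) :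
    primeProd (fun p => c p * c' p) n = primeProd c n * primeProd c' n :=
  Finset.prod_mul_distrib

lemma primeProd_inv_fun (c : ℕ → ℝ) (n : ℕ) :
    primeProd (fun p => (c p)⁻¹) n = (primeProd c n)⁻¹ := by
  simp [primeProd]

lemma primeProd_prime (c : ℕ → ℝ) {p : ℕ} (hp : p.Prime) : primeProd c p = c p := by
  simp [primeProd, hp.primeFactors]

lemma primeProd_congr {c c' : ℕ → ℝ} {n : ℕ} (H : ∀ p, p.Prime → p ∣ n → c p = c' p) :
    primeProd c n = primeProd c' n :=
  Finset.prod_congr rfl fun p hp =>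
    H p (Nat.prime_of_mem_primeFactors hp) (Nat.dvd_of_mem_primeFactors hp)

lemma primeProd_nonneg {c : ℕ → ℝ} {n : ℕ} (H : ∀ p, p.Prime → p ∣ n → 0 ≤ c p) :
    0 ≤ primeProd c n :=
  Finset.prod_nonneg fun p hp =>
    H p (Nat.prime_of_mem_primeFactors hp) (Nat.dvd_of_mem_primeFactors hp)

lemma primeProd_le {c c' : ℕ → ℝ} {n : ℕ}
    (H : ∀ p, p.Prime → p ∣ n → 0 ≤ c p ∧ c p ≤ c' p) :
    primeProd c n ≤ primeProd c' n :=
  Finset.prod_le_prod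
    (fun p hp => (H p (Nat.prime_of_mem_primeFactors hp) (Nat.dvd_of_mem_primeFactors hp)).1)
    (fun p hp => (H p (Nat.prime_of_mem_primeFactors hp) (Nat.dvd_of_mem_primeFactors hp)).2)

lemma primeProd_mul (c : ℕ → ℝ) {m n : ℕ} (hmn : m.Coprime n) :
    primeProd c (m * n) = primeProd c m * primeProd c n := by
  rw [primeProd, hmn.primeFactors_mul, Finset.prod_union hmn.disjoint_primeFactors]; rfl

lemma primeProd_lcm_mul_gcd (c : ℕ → ℝ) {m n : ℕ} (hm : m ≠ 0) (hn : n ≠ 0) :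
    primeProd c (m.lcm n) * primeProd c (m.gcd n) = primeProd c m * primeProd c n := by
  simp only [primeProd]
  have : (m.lcm n).primeFactors = m.primeFactors ∪ n.primeFactors := by
    ext p
    simp only [Nat.mem_primeFactors, Finset.mem_union, ne_eq, hm, hn, not_false_eq_true, and_true,
      Nat.lcm_ne_zero hm hn]
    constructor
    · rintro ⟨hp, hd⟩
      have := (hp.dvd_mul).1 (hd.trans (Nat.lcm_dvd_mul m n))
      tauto
    · rintro (⟨hp, hd⟩ | ⟨hp, hd⟩)
      · exact ⟨hp, hd.trans (Nat.dvd_lcm_left m n)⟩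
      · exact ⟨hp, hd.trans (Nat.dvd_lcm_right m n)⟩
  rw [this, Nat.primeFactors_gcd hm hn, Finset.prod_union_inter]

lemma sum_divisors_primeProd (c : ℕ → ℝ) {n : ℕ} (hn : Squarefree n) :
    ∑ d ∈ n.divisors, primeProd c d = primeProd (fun p => 1 + c p) n := by
  have key := ArithmeticFunction.IsMultiplicative.prodPrimeFactors_one_add_of_squarefree
    (ArithmeticFunction.IsMultiplicative.prodPrimeFactors c) hn
  rw [primeProd]
  refine Eq.trans ?_ (key.symm.trans (Finset.prod_congr rfl fun p hp => ?_))
  · refine Finset.sum_congr rfl fun d hd => ?_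
    rw [ArithmeticFunction.prodPrimeFactors_apply (Nat.pos_of_mem_divisors hd).ne']; rfl
  · have hp' := Nat.prime_of_mem_primeFactors hp
    rw [ArithmeticFunction.prodPrimeFactors_apply hp'.ne_zero, hp'.primeFactors]
    simp

lemma primeProd_natCast {n : ℕ} (hn : Squarefree n) : primeProd (fun p => (p : ℝ)) n = n := by
  rw [primeProd, ← Nat.cast_prod, Nat.prod_primeFactors_of_squarefree hn]

lemma totient_eq_primeProd {n : ℕ} (hn : Squarefree n) :
    (n.totient : ℝ) = primeProd (fun p => (p : ℝ) - 1) n := by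
  have h1 := Nat.totient_mul_prod_primeFactors n
  rw [Nat.prod_primeFactors_of_squarefree hn, mul_comm] at h1
  rw [Nat.eq_of_mul_eq_mul_left (Nat.pos_of_ne_zero hn.ne_zero) h1, primeProd, Nat.cast_prod]
  refine Finset.prod_congr rfl fun p hp => ?_
  rw [Nat.cast_sub (Nat.prime_of_mem_primeFactors hp).one_lt.le]; simp

/-- Diagonalization of a quadratic form in `lcm d e`. -/
lemma sum_lcm_primeProd_eq {S : Finset ℕ} (hsq : ∀ d ∈ S, Squarefree d)
    (hdc : ∀ d ∈ S, ∀ e, e ∣ d → e ∈ S) {c : ℕ → ℝ} (w : ℕ → ℝ)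
    (hc : ∀ d ∈ S, ∀ p, p.Prime → p ∣ d → c p ≠ 0) :
    ∑ d ∈ S, ∑ e ∈ S, w d * w e * primeProd c (d.lcm e) =
      ∑ k ∈ S, primeProd (fun p => (c p)⁻¹ - 1) k *
        (∑ d ∈ S, if k ∣ d then w d * primeProd c d else 0) ^ 2 := by
  have h1 : ∀ d ∈ S, ∀ e ∈ S, w d * w e * primeProd c (d.lcm e) =
      ∑ k ∈ S, primeProd (fun p => (c p)⁻¹ - 1) k *
        ((if k ∣ d then w d * primeProd c d else 0) *
          (if k ∣ e then w e * primeProd c e else 0)) := by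
    intro d hd e he
    have hd0 := (hsq d hd).ne_zero
    have he0 := (hsq e he).ne_zero
    have hg : Squarefree (d.gcd e) := (hsq d hd).squarefree_of_dvd (Nat.gcd_dvd_left d e)
    have hgc : primeProd c (d.gcd e) ≠ 0 := by
      refine Finset.prod_ne_zero_iff.2 fun p hp => ?_
      exact hc d hd p (Nat.prime_of_mem_primeFactors hp)
        ((Nat.dvd_of_mem_primeFactors hp).trans (Nat.gcd_dvd_left d e))
    have h2 := sum_divisors_primeProd (fun p => (c p)⁻¹ - 1) hg
    have h3 : primeProd (fun p => 1 + ((c p)⁻¹ - 1)) (d.gcd e) = (primeProd c (d.gcd e))⁻¹ := by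
      rw [← primeProd_inv_fun]; congr 1; ext p; ring
    have h4 : (d.gcd e).divisors = S.filter fun k => k ∣ d ∧ k ∣ e := by
      ext k
      simp only [Nat.mem_divisors, Finset.mem_filter, Nat.dvd_gcd_iff]
      constructor
      · rintro ⟨h, -⟩; exact ⟨hdc d hd k h.1, h⟩
      · rintro ⟨-, h⟩; exact ⟨h, Nat.gcd_ne_zero_left hd0⟩
    have h5 := primeProd_lcm_mul_gcd c hd0 he0
    have h6 : primeProd c (d.lcm e) =
        primeProd c d * primeProd c e * ∑ k ∈ (d.gcd e).divisors,
          primeProd (fun p => (c p)⁻¹ - 1) k := by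
      rw [h2, h3, ← h5]; field_simp
    rw [h6, h4, Finset.sum_filter, Finset.mul_sum, Finset.mul_sum]
    refine Finset.sum_congr rfl fun k _ => ?_
    by_cases a : k ∣ d <;> by_cases b : k ∣ e <;> simp [a, b] ; ring
  rw [Finset.sum_congr rfl fun d hd => Finset.sum_congr rfl fun e he => h1 d hd e he]
  simp_rw [sq, Finset.sum_mul_sum, Finset.mul_sum]
  rw [Finset.sum_comm' (t' := S) (s' := fun _ => S) (by tauto)]
  rw [Finset.sum_comm]
  refine (Finset.sum_congr rfl fun d _ => ?_).trans Finset.sum_comm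
  rw [Finset.sum_comm]

lemma sum_primeProd_between {k m : ℕ} (a : ℕ → ℝ) (hm : Squarefree m) (hkm : k ∣ m) :
    ∑ d ∈ m.divisors.filter (fun d => k ∣ d), primeProd a d =
      primeProd a k * primeProd (fun p => 1 + a p) (m / k) := by
  obtain ⟨t, rfl⟩ := hkm
  have hk0 : k ≠ 0 := fun h => hm.ne_zero (by simp [h])
  have ht0 : t ≠ 0 := fun h => hm.ne_zero (by simp [h])
  rw [Nat.mul_div_cancel_left t (Nat.pos_of_ne_zero hk0)]
  have hco : k.Coprime t := Nat.coprime_of_squarefree_mul hm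
  rw [← sum_divisors_primeProd a (hm.squarefree_of_dvd (Dvd.intro_left k rfl)), Finset.mul_sum]
  symm
  refine Finset.sum_nbij (fun e => k * e) ?_ ?_ ?_ ?_
  · intro e he
    have := Nat.dvd_of_mem_divisors he
    simp only [Finset.mem_filter, Nat.mem_divisors]
    exact ⟨⟨Nat.mul_dvd_mul_left k this, hm.ne_zero⟩, Dvd.intro _ rfl⟩
  · intro a _ b _ hab
    exact Nat.eq_of_mul_eq_mul_left (Nat.pos_of_ne_zero hk0) hab
  · intro d hd
    simp only [Finset.coe_filter, Nat.mem_divisors, Set.mem_ofPred_eq] at hd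
    obtain ⟨⟨h1, -⟩, e, rfl⟩ := hd
    refine ⟨e, ?_, rfl⟩
    simp only [Finset.mem_coe, Nat.mem_divisors]
    exact ⟨Nat.dvd_of_mul_dvd_mul_left (Nat.pos_of_ne_zero hk0) h1, ht0⟩
  · intro e he
    exact (primeProd_mul a (hco.coprime_dvd_right (Nat.dvd_of_mem_divisors he))).symm

/-- The inner linear form for weights obtained by Möbius inversion. -/
lemma sum_weight_primeProd {S : Finset ℕ} (hsq : ∀ d ∈ S, Squarefree d)
    (hdc : ∀ d ∈ S, ∀ e, e ∣ d → e ∈ S) (b c z : ℕ → ℝ) (k : ℕ) :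
    ∑ d ∈ S, (if k ∣ d then
        (primeProd b d * ∑ m ∈ S, if d ∣ m then z m else 0) * primeProd c d else 0) =
      ∑ m ∈ S, if k ∣ m then
        primeProd (fun p => b p * c p) k * (z m * primeProd (fun p => 1 + b p * c p) (m / k))
      else 0 := by
  have h1 : ∀ d ∈ S, (if k ∣ d then
        (primeProd b d * ∑ m ∈ S, if d ∣ m then z m else 0) * primeProd c d else 0) =
      ∑ m ∈ S, if k ∣ d ∧ d ∣ m then z m * primeProd (fun p => b p * c p) d else 0 := by
    intro d _
    split_ifs with h
    · simp only [h, true_and]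
      rw [mul_right_comm, Finset.mul_sum]
      refine Finset.sum_congr rfl fun m _ => ?_
      rw [primeProd_mul_fun]
      split_ifs <;> ring
    · simp [h]
  rw [Finset.sum_congr rfl h1, Finset.sum_comm]
  refine Finset.sum_congr rfl fun m hm => ?_
  split_ifs with h
  · rw [mul_left_comm, ← sum_primeProd_between (fun p => b p * c p) (hsq m hm) h, Finset.mul_sum,
      ← Finset.sum_filter]
    refine Finset.sum_congr ?_ fun _ _ => rfl
    ext d
    simp only [Finset.mem_filter, Nat.mem_divisors]
    constructor
    · rintro ⟨_, h1, h2⟩; exact ⟨⟨h2, (hsq m hm).ne_zero⟩, h1⟩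
    · rintro ⟨⟨h2, _⟩, h1⟩; exact ⟨hdc m hm d h2, h1, h2⟩
  · refine Finset.sum_eq_zero fun d _ => if_neg fun h' => h (h'.1.trans h'.2)

lemma pow_succ_sub_le {a b : ℝ} (hb : 0 ≤ b) (hab : b ≤ a) (j : ℕ) :
    a ^ (j + 1) - b ^ (j + 1) ≤ (j + 1) * ((a - b) * a ^ j) := by
  have ha : 0 ≤ a := hb.trans hab
  induction j with
  | zero => simp
  | succ j ih =>
    have h1 : b ^ (j + 1) ≤ a ^ (j + 1) := pow_le_pow_left₀ hb hab _
    have h2 : a ^ (j + 1 + 1) - b ^ (j + 1 + 1) =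
        a * (a ^ (j + 1) - b ^ (j + 1)) + (a - b) * b ^ (j + 1) := by ring
    have h3 := mul_le_mul_of_nonneg_left ih ha
    have h4 := mul_le_mul_of_nonneg_left h1 (sub_nonneg.2 hab)
    rw [h2]; push_cast
    calc _ ≤ a * ((j + 1) * ((a - b) * a ^ j)) + (a - b) * a ^ (j + 1) := add_le_add h3 h4
      _ = _ := by ring

lemma le_pow_succ_sub {a b : ℝ} (hb : 0 ≤ b) (hab : b ≤ a) (j : ℕ) :
    (j + 1) * ((a - b) * b ^ j) ≤ a ^ (j + 1) - b ^ (j + 1) := by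
  have ha : 0 ≤ a := hb.trans hab
  induction j with
  | zero => simp
  | succ j ih =>
    have h1 : b ^ (j + 1) ≤ a ^ (j + 1) := pow_le_pow_left₀ hb hab _
    have h2 : a ^ (j + 1 + 1) - b ^ (j + 1 + 1) =
        b * (a ^ (j + 1) - b ^ (j + 1)) + (a - b) * a ^ (j + 1) := by ring
    have h3 := mul_le_mul_of_nonneg_left ih hb
    have h4 := mul_le_mul_of_nonneg_left h1 (sub_nonneg.2 hab)
    rw [h2]; push_cast
    calc _ = b * ((j + 1) * ((a - b) * b ^ j)) + (a - b) * b ^ (j + 1) := by ring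
      _ ≤ _ := add_le_add h3 h4

/-- `∑_{n ≤ y} log(y/n)^j / n`. -/
noncomputable def logSum (j : ℕ) (y : ℝ) : ℝ :=
  ∑ n ∈ Finset.Icc 1 ⌊y⌋₊, Real.log (y / n) ^ j / n

lemma logSum_nonneg (j : ℕ) (y : ℝ) : 0 ≤ logSum j y := by
  refine Finset.sum_nonneg fun n hn => ?_
  have h1 := Finset.mem_Icc.1 hn
  have hn0 : (0 : ℝ) < n := by exact_mod_cast h1.1
  have : 1 ≤ y / n := by
    rw [one_le_div hn0]
    exact (Nat.le_floor_iff' (by omega)).1 h1.2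
  have := Real.log_nonneg this
  positivity

lemma le_logSum (j : ℕ) {y : ℝ} (hy : 1 ≤ y) :
    Real.log y ^ (j + 1) / (j + 1) ≤ logSum j y := by
  have hy0 : 0 < y := by linarith
  have hdiff : ∀ k : ℕ, 1 ≤ k → ∀ z : ℝ, z ≤ k + 1 → k ≤ z →
      Real.log z - Real.log k ≤ 1 / k := by
    intro k hk z hz hkz
    have hk0 : (0 : ℝ) < k := by exact_mod_cast hk
    rw [← Real.log_div (by linarith) hk0.ne']
    have := Real.log_le_sub_one_of_pos (x := z / k) (div_pos (by linarith) hk0)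
    refine this.trans ?_
    rw [div_sub_one hk0.ne']
    gcongr; linarith
  have key : ∀ k : ℕ, 1 ≤ k → (k : ℝ) ≤ y →
      (Real.log y ^ (j + 1) - Real.log (y / k) ^ (j + 1)) / (j + 1) ≤
        ∑ n ∈ Finset.Ico 1 k, Real.log (y / n) ^ j / n := by
    intro k hk
    induction k, hk using Nat.le_induction with
    | base => intro _; simp
    | succ k hk ih =>
      intro hky
      push_cast at hky
      have hk0 : (0 : ℝ) < k := by exact_mod_cast hk
      rw [Finset.sum_Ico_succ_top hk]
      have h1 := ih (by linarith)
      have h2 := hdiff k hk (k + 1) le_rfl (by linarith)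
      have hb : 0 ≤ Real.log (y / (k + 1)) :=
        Real.log_nonneg ((one_le_div (by linarith)).2 hky)
      have hl : Real.log (y / k) - Real.log (y / (k + 1)) ≤ 1 / k := by
        rw [Real.log_div hy0.ne' hk0.ne', Real.log_div hy0.ne' (by linarith)]; linarith
      have hab : Real.log (y / (k + 1)) ≤ Real.log (y / k) := by
        apply Real.log_le_log (by positivity)
        gcongr; linarith
      have h3 := pow_succ_sub_le hb hab j
      have h4 : (Real.log (y / k) - Real.log (y / (k + 1))) * Real.log (y / k) ^ j ≤
          1 / k * Real.log (y / k) ^ j :=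
        mul_le_mul_of_nonneg_right hl (pow_nonneg (hb.trans hab) _)
      push_cast
      rw [div_le_iff₀ (by positivity)] at h1 ⊢
      have h5 : Real.log (y / k) ^ j / k = 1 / k * Real.log (y / k) ^ j := by ring
      rw [h5]
      nlinarith [Nat.cast_nonneg (α := ℝ) j]
  have hX : 1 ≤ ⌊y⌋₊ := (Nat.le_floor_iff (by linarith)).2 (by simpa using hy)
  have hX0 : (0 : ℝ) < ⌊y⌋₊ := by exact_mod_cast hX
  have hXy : (⌊y⌋₊ : ℝ) ≤ y := Nat.floor_le hy0.le
  have h1 := key _ hX hXy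
  rw [logSum, ← Finset.Ico_insert_right hX, Finset.sum_insert (by simp)]
  have h2 := hdiff _ hX y (Nat.lt_floor_add_one y).le hXy
  have hb : 0 ≤ Real.log (y / ⌊y⌋₊) := Real.log_nonneg ((one_le_div hX0).2 hXy)
  have hl : Real.log (y / ⌊y⌋₊) ≤ 1 / ⌊y⌋₊ := by
    rw [Real.log_div hy0.ne' hX0.ne']; linarith
  have h3 := pow_succ_sub_le le_rfl hb j
  have h4 := mul_le_mul_of_nonneg_right hl (pow_nonneg hb j)
  rw [div_le_iff₀ (by positivity)] at h1 ⊢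
  have h5 : Real.log (y / ⌊y⌋₊) ^ j / ⌊y⌋₊ = 1 / ⌊y⌋₊ * Real.log (y / ⌊y⌋₊) ^ j := by ring
  rw [h5]
  have h6 : (0 : ℝ) ^ (j + 1) = 0 := by simp
  rw [h6] at h3
  nlinarith [Nat.cast_nonneg (α := ℝ) j]

lemma logSum_le (j : ℕ) {y : ℝ} (hy : 1 ≤ y) :
    logSum j y ≤ Real.log y ^ (j + 1) / (j + 1) + Real.log y ^ j := by
  have hy0 : 0 < y := by linarith
  have key : ∀ k : ℕ, 1 ≤ k → (k : ℝ) ≤ y →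
      ∑ n ∈ Finset.Icc 1 k, Real.log (y / n) ^ j / n ≤
      (Real.log y ^ (j + 1) - Real.log (y / k) ^ (j + 1)) / (j + 1) + Real.log y ^ j := by
    intro k hk
    induction k, hk using Nat.le_induction with
    | base => intro _; simp
    | succ k hk ih =>
      intro hky
      push_cast at hky
      have hk0 : (0 : ℝ) < k := by exact_mod_cast hk
      rw [Finset.sum_Icc_succ_top (by omega)]
      have h1 := ih (by linarith)
      have hb : 0 ≤ Real.log (y / (k + 1)) :=
        Real.log_nonneg ((one_le_div (by linarith)).2 hky)
      have h2 : 1 / (k + 1 : ℝ) ≤ Real.log (y / k) - Real.log (y / (k + 1)) := by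
        rw [Real.log_div hy0.ne' hk0.ne', Real.log_div hy0.ne' (by linarith)]
        have h3 := Real.log_le_sub_one_of_pos (x := k / (k + 1 : ℝ)) (by positivity)
        rw [Real.log_div hk0.ne' (by linarith)] at h3
        have h4 : (k : ℝ) / (k + 1) - 1 = - (1 / (k + 1)) := by field_simp; ring
        linarith
      have hab : Real.log (y / (k + 1)) ≤ Real.log (y / k) := by
        apply Real.log_le_log (by positivity)
        gcongr; linarith
      have h3 := le_pow_succ_sub hb hab j
      have h4 := mul_le_mul_of_nonneg_right h2 (pow_nonneg hb j)
      push_cast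
      have h5 : Real.log (y / (k + 1)) ^ j / (k + 1) =
        1 / (k + 1) * Real.log (y / (k + 1)) ^ j := by ring
      rw [h5]
      have h6 : (Real.log (y / k) - Real.log (y / (k + 1))) * Real.log (y / (k + 1)) ^ j ≤
          (Real.log (y / k) ^ (j + 1) - Real.log (y / (k + 1)) ^ (j + 1)) / (j + 1) := by
        rw [le_div_iff₀ (by positivity)]; linarith
      have h7 : (Real.log y ^ (j + 1) - Real.log (y / (k + 1)) ^ (j + 1)) / (j + 1) =
        (Real.log y ^ (j + 1) - Real.log (y / k) ^ (j + 1)) / (j + 1) +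
        (Real.log (y / k) ^ (j + 1) - Real.log (y / (k + 1)) ^ (j + 1)) / (j + 1) := by ring
      linarith
  have hX : 1 ≤ ⌊y⌋₊ := (Nat.le_floor_iff (by linarith)).2 (by simpa using hy)
  have hX0 : (0 : ℝ) < ⌊y⌋₊ := by exact_mod_cast hX
  have hXy : (⌊y⌋₊ : ℝ) ≤ y := Nat.floor_le hy0.le
  have hb : 0 ≤ Real.log (y / ⌊y⌋₊) := Real.log_nonneg ((one_le_div hX0).2 hXy)
  refine (key _ hX hXy).trans ?_
  gcongr
  have := pow_nonneg hb (j + 1)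
  linarith


lemma sum_inv_le_of_primeFactors_subset {q : ℕ} (hq : q ≠ 0) (T : Finset ℕ)
    (hT : ∀ m ∈ T, m ≠ 0 ∧ ∀ p, p.Prime → p ∣ m → p ∣ q) :
    ∑ m ∈ T, (m : ℝ)⁻¹ ≤ q / q.totient := by
  let f : ℕ →* ℝ :=
    { toFun := fun n => (n : ℝ)⁻¹
      map_one' := by simp
      map_mul' := fun a b => by push_cast; rw [mul_inv] }
  have h1 := (EulerProduct.summable_and_hasSum_factoredNumbers_prod_filter_prime_geometric (f := f)
    (fun {p} hp => by
      simp only [f, MonoidHom.coe_mk, OneHom.coe_mk, norm_inv, Real.norm_natCast]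
      exact inv_lt_one_of_one_lt₀ (by exact_mod_cast hp.one_lt)) q.primeFactors).2
  have h2 : ∏ p ∈ q.primeFactors with p.Prime, (1 - f p)⁻¹ = (q : ℝ) / q.totient := by
    have h3 : q.primeFactors.filter Nat.Prime = q.primeFactors :=
      Finset.filter_true_of_mem fun p hp => Nat.prime_of_mem_primeFactors hp
    have h4 : (q.totient : ℝ) = q * ∏ p ∈ q.primeFactors, (1 - (p : ℝ)⁻¹) := by
      have := congrArg (fun x : ℚ => (x : ℝ)) (Nat.totient_eq_mul_prod_factors q)
      push_cast at this
      exact this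
    rw [h3, Finset.prod_inv_distrib, h4, div_mul_eq_div_div, div_self (by exact_mod_cast hq),
      one_div]
    rfl
  rw [h2] at h1
  replace h1 := (hasSum_subtype_iff_indicator (f := fun m : ℕ => f m)
    (s := Nat.factoredNumbers q.primeFactors)).1 h1
  refine le_trans (le_of_eq ?_) (sum_le_hasSum T (fun m _ => ?_) h1)
  · refine Finset.sum_congr rfl fun m hm => ?_
    rw [Set.indicator_of_mem]
    · rfl
    · refine ⟨(hT m hm).1, fun p hp => ?_⟩
      have hp' := Nat.prime_of_mem_primeFactorsList hp
      exact Nat.mem_primeFactors.2 ⟨hp', (hT m hm).2 p hp' (Nat.dvd_of_mem_primeFactorsList hp), hq⟩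
  · exact Set.indicator_nonneg (fun n _ => by simp [f]) m

lemma totient_div_mul_sum_le {q : ℕ} (hq : q ≠ 0) (X : ℕ) (Y : ℕ → ℝ)
    (h0 : ∀ n ∈ Finset.Icc 1 X, 0 ≤ Y n)
    (hY : ∀ m n, 1 ≤ m → m ≤ n → n ≤ X → Y n ≤ Y m) :
    (q.totient : ℝ) / q * ∑ n ∈ Finset.Icc 1 X, Y n / n ≤
      ∑ s ∈ Finset.Icc 1 X, if Squarefree s ∧ s.Coprime q then Y s / s.totient else 0 := by
  have hq0 : (0 : ℝ) < q := by exact_mod_cast Nat.pos_of_ne_zero hq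
  have hφ0 : (0 : ℝ) < q.totient := by exact_mod_cast Nat.totient_pos.2 (Nat.pos_of_ne_zero hq)
  let r : ℕ → ℕ := fun n => ∏ p ∈ n.primeFactors with ¬ p ∣ q, p
  have hr_dvd : ∀ n, r n ∣ n := fun n =>
    (Finset.prod_dvd_prod_of_subset _ _ _ (Finset.filter_subset _ _)).trans
      (Nat.prod_primeFactors_dvd n)
  have hr_cop : ∀ n, (r n).Coprime q := fun n =>
    Nat.Coprime.prod_left fun p hp => by
      have := Finset.mem_filter.1 hp
      exact (Nat.Prime.coprime_iff_not_dvd (Nat.prime_of_mem_primeFactors this.1)).2 this.2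
  have hr_sq : ∀ n, Squarefree (r n) := fun n => by
    by_cases hn : n = 0
    · subst hn; simp [r]
    have h1 : Squarefree (∏ p ∈ n.primeFactors, p) := by
      rw [← Nat.radical_eq_prod_primeFactors]; exact UniqueFactorizationMonoid.squarefree_radical
    exact h1.squarefree_of_dvd (Finset.prod_dvd_prod_of_subset _ _ _ (Finset.filter_subset _ _))
  have hmaps : ∀ n ∈ Finset.Icc 1 X,
      r n ∈ (Finset.Icc 1 X).filter fun s => Squarefree s ∧ s.Coprime q := by
    intro n hn
    have hn' := Finset.mem_Icc.1 hn
    refine Finset.mem_filter.2 ⟨Finset.mem_Icc.2 ⟨?_, ?_⟩, hr_sq n, hr_cop n⟩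
    · exact Nat.pos_of_ne_zero (hr_sq n).ne_zero
    · exact (Nat.le_of_dvd (by omega) (hr_dvd n)).trans hn'.2
  rw [← Finset.sum_filter, ← Finset.sum_fiberwise_of_maps_to hmaps, Finset.mul_sum]
  refine Finset.sum_le_sum fun s hs => ?_
  obtain ⟨hsI, hsq, hsc⟩ := Finset.mem_filter.1 hs
  have hsI' := Finset.mem_Icc.1 hsI
  have hs0 : (0 : ℝ) < s := by exact_mod_cast hsI'.1
  have hsφ : (0 : ℝ) < s.totient := by exact_mod_cast Nat.totient_pos.2 hsI'.1
  have h1 : ∑ n ∈ Finset.Icc 1 X with r n = s, Y n / n ≤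
      Y s / s * ∑ n ∈ Finset.Icc 1 X with r n = s, ((n / s : ℕ) : ℝ)⁻¹ := by
    rw [Finset.mul_sum]
    refine Finset.sum_le_sum fun n hn => ?_
    obtain ⟨hnI, hrn⟩ := Finset.mem_filter.1 hn
    have hnI' := Finset.mem_Icc.1 hnI
    have hd : s ∣ n := hrn ▸ hr_dvd n
    have hn0 : (0 : ℝ) < n := by exact_mod_cast hnI'.1
    rw [Nat.cast_div hd hs0.ne']
    have h2 := hY s n hsI'.1 (Nat.le_of_dvd (by omega) hd) hnI'.2
    have h3 : Y s / s * ((n : ℝ) / s)⁻¹ = Y s / n := by field_simp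
    rw [h3]; gcongr
  have h2 : ∑ n ∈ Finset.Icc 1 X with r n = s, ((n / s : ℕ) : ℝ)⁻¹ ≤
      ((s * q : ℕ) : ℝ) / (s * q).totient := by
    have hinj : Set.InjOn (fun n => n / s) ((Finset.Icc 1 X).filter fun n => r n = s) := by
      intro a ha b hb hab
      have ha' : s ∣ a := (Finset.mem_filter.1 ha).2 ▸ hr_dvd a
      have hb' : s ∣ b := (Finset.mem_filter.1 hb).2 ▸ hr_dvd b
      rw [← Nat.div_mul_cancel ha', ← Nat.div_mul_cancel hb']
      exact congrArg (· * s) hab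
    rw [← Finset.sum_image (f := fun m : ℕ => (m : ℝ)⁻¹) hinj]
    refine sum_inv_le_of_primeFactors_subset (mul_ne_zero (by omega) hq) _ fun m hm => ?_
    obtain ⟨n, hn, rfl⟩ := Finset.mem_image.1 hm
    obtain ⟨hnI, hrn⟩ := Finset.mem_filter.1 hn
    have hnI' := Finset.mem_Icc.1 hnI
    have hd : s ∣ n := hrn ▸ hr_dvd n
    have hdn : n / s ∣ n := Nat.div_dvd_of_dvd hd
    have hne : n / s ≠ 0 := fun h => by
      rw [h] at hdn; have := Nat.eq_zero_of_zero_dvd hdn; omega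
    refine ⟨hne, fun p hp hpd => ?_⟩
    by_cases hpq : p ∣ q
    · exact hpq.mul_left s
    · refine Dvd.dvd.mul_right ?_ q
      rw [← hrn]
      exact Finset.dvd_prod_of_mem _ (Finset.mem_filter.2
        ⟨Nat.mem_primeFactors.2 ⟨hp, hpd.trans hdn, by omega⟩, hpq⟩)
  have h3 : ((s * q : ℕ) : ℝ) / (s * q).totient = (s / s.totient) * (q / q.totient) := by
    rw [Nat.totient_mul hsc]; push_cast; field_simp
  rw [h3] at h2
  have hYs := h0 s hsI
  calc (q.totient : ℝ) / q * _ ≤ q.totient / q * (Y s / s * ((s / s.totient) * (q / q.totient))) := by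
        gcongr
        exact h1.trans (mul_le_mul_of_nonneg_left h2 (by positivity))
    _ = _ := by field_simp

/-- Squarefree numbers up to `R` coprime to `h`. -/
noncomputable def sieveSet (h : ℕ) (R : ℝ) : Finset ℕ :=
  (Finset.Icc 1 ⌊R⌋₊).filter fun d => Squarefree d ∧ d.Coprime h

/-- The smooth profile `1 + c log(R/m)/log R`. -/
noncomputable def profile (c R : ℝ) (m : ℕ) : ℝ := 1 + c * (Real.log (R / m) / Real.log R)

/-- Selberg-type sieve weights with profile `1 + c log(R/m)/log R`. -/
noncomputable def sieveWeight (h : ℕ) (c R : ℝ) (d : ℕ) : ℝ :=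
  primeProd (fun p => -((p : ℝ) / 2)) d * ∑ m ∈ sieveSet h R,
    if d ∣ m then primeProd (fun p => 2 / ((p : ℝ) - 2)) m * profile c R m else 0

lemma mem_sieveSet {h : ℕ} {R : ℝ} {d : ℕ} :
    d ∈ sieveSet h R ↔ (1 ≤ d ∧ d ≤ ⌊R⌋₊) ∧ Squarefree d ∧ d.Coprime h := by
  simp [sieveSet]

lemma sieveSet_squarefree {h : ℕ} {R : ℝ} : ∀ d ∈ sieveSet h R, Squarefree d :=
  fun _ hd => (mem_sieveSet.1 hd).2.1

lemma sieveSet_dvd_closed {h : ℕ} {R : ℝ} :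
    ∀ d ∈ sieveSet h R, ∀ e, e ∣ d → e ∈ sieveSet h R := by
  intro d hd e he
  obtain ⟨⟨h1, h2⟩, h3, h4⟩ := mem_sieveSet.1 hd
  exact mem_sieveSet.2 ⟨⟨Nat.pos_of_dvd_of_pos he h1, (Nat.le_of_dvd h1 he).trans h2⟩,
    h3.squarefree_of_dvd he, h4.coprime_dvd_left he⟩

lemma three_le_of_dvd_of_coprime {h : ℕ} (h2 : 2 ∣ h) {d p : ℕ}
    (hd : d.Coprime h) (hp : p.Prime) (hpd : p ∣ d) : (3 : ℝ) ≤ p := by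
  have h1 := hp.two_le
  have h3 : p ≠ 2 := by
    rintro rfl
    exact Nat.not_coprime_of_dvd_of_dvd (by norm_num) hpd h2 hd
  have : 3 ≤ p := by omega
  exact_mod_cast this

lemma primeProd_zero {n : ℕ} (hn : 1 < n) : primeProd (fun _ => 0) n = 0 :=
  Finset.prod_eq_zero (i := n.minFac)
    (Nat.mem_primeFactors.2 ⟨Nat.minFac_prime hn.ne', Nat.minFac_dvd n, by omega⟩) rfl

lemma sum_sieveWeight_uniform {h : ℕ} (h2 : 2 ∣ h) (c R : ℝ) :
    ∑ d ∈ sieveSet h R, ∑ e ∈ sieveSet h R, sieveWeight h c R d * sieveWeight h c R e *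
        primeProd (fun p => 2 / (p : ℝ)) (d.lcm e) =
      ∑ k ∈ sieveSet h R, primeProd (fun p => 2 / ((p : ℝ) - 2)) k * profile c R k ^ 2 := by
  have h3 : ∀ d ∈ sieveSet h R, ∀ p, p.Prime → p ∣ d → (3 : ℝ) ≤ p := fun d hd p hp hpd =>
    three_le_of_dvd_of_coprime h2 (mem_sieveSet.1 hd).2.2 hp hpd
  rw [sum_lcm_primeProd_eq sieveSet_squarefree sieveSet_dvd_closed]
  · refine Finset.sum_congr rfl fun k hk => ?_
    have hk1 := (mem_sieveSet.1 hk).1.1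
    have h4 := sum_weight_primeProd (S := sieveSet h R) sieveSet_squarefree sieveSet_dvd_closed
      (fun p => -((p : ℝ) / 2)) (fun p => 2 / (p : ℝ))
      (fun m => primeProd (fun p => 2 / ((p : ℝ) - 2)) m * profile c R m) k
    rw [show (∑ d ∈ sieveSet h R, if k ∣ d then sieveWeight h c R d *
      primeProd (fun p => 2 / (p : ℝ)) d else 0) = _ from h4, Finset.sum_eq_single k]
    · rw [if_pos dvd_rfl, Nat.div_self hk1, primeProd_one, mul_one, mul_pow, mul_pow, sq, sq,
        ← mul_assoc, ← mul_assoc, ← mul_assoc]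
      simp only [← primeProd_mul_fun]
      congr 1
      refine primeProd_congr fun p hp hpd => ?_
      have := h3 k hk p hp hpd
      have h6 : (p : ℝ) - 2 ≠ 0 := by linarith
      field_simp
    · intro m hm hmk
      split_ifs with hd
      · obtain ⟨t, rfl⟩ := hd
        have h5 : 1 < t := by
          rcases t with _ | _ | t
          · have := (mem_sieveSet.1 hm).1.1; simp at this
          · simp at hmk
          · omega
        rw [Nat.mul_div_cancel_left t hk1,
          primeProd_congr (c := fun p => 1 + -((p : ℝ) / 2) * (2 / (p : ℝ))) (n := t)
            (c' := fun _ => 0), primeProd_zero h5]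
        · ring
        · intro p hp hpd
          have := h3 _ hm p hp (hpd.mul_left k)
          field_simp; ring
      · rfl
    · exact fun h => absurd hk h
  · intro d hd p hp hpd
    have := h3 d hd p hp hpd
    positivity

lemma sum_sieveWeight_prime {h : ℕ} (h2 : 2 ∣ h) (c R : ℝ) :
    ∑ d ∈ sieveSet h R, ∑ e ∈ sieveSet h R, sieveWeight h c R d * sieveWeight h c R e *
        primeProd (fun p => 1 / ((p : ℝ) - 1)) (d.lcm e) =
      ∑ k ∈ sieveSet h R, primeProd (fun p => (p : ℝ) ^ 2 / (((p : ℝ) - 1) ^ 2 * ((p : ℝ) - 2))) k *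
        (∑ m ∈ sieveSet h R, if k ∣ m then profile c R m / (m / k).totient else 0) ^ 2 := by
  have h3 : ∀ d ∈ sieveSet h R, ∀ p, p.Prime → p ∣ d → (3 : ℝ) ≤ p := fun d hd p hp hpd =>
    three_le_of_dvd_of_coprime h2 (mem_sieveSet.1 hd).2.2 hp hpd
  rw [sum_lcm_primeProd_eq sieveSet_squarefree sieveSet_dvd_closed]
  · refine Finset.sum_congr rfl fun k hk => ?_
    have hk1 := (mem_sieveSet.1 hk).1.1
    have h4 := sum_weight_primeProd (S := sieveSet h R) sieveSet_squarefree sieveSet_dvd_closed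
      (fun p => -((p : ℝ) / 2)) (fun p => 1 / ((p : ℝ) - 1))
      (fun m => primeProd (fun p => 2 / ((p : ℝ) - 2)) m * profile c R m) k
    have h5 : (∑ m ∈ sieveSet h R, if k ∣ m then
        primeProd (fun p => -((p : ℝ) / 2) * (1 / ((p : ℝ) - 1))) k *
        ((primeProd (fun p => 2 / ((p : ℝ) - 2)) m * profile c R m) *
          primeProd (fun p => 1 + -((p : ℝ) / 2) * (1 / ((p : ℝ) - 1))) (m / k)) else 0) =
        primeProd (fun p => -((p : ℝ) / (((p : ℝ) - 1) * ((p : ℝ) - 2)))) k *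
        ∑ m ∈ sieveSet h R, if k ∣ m then profile c R m / (m / k).totient else 0 := by
      rw [Finset.mul_sum]
      refine Finset.sum_congr rfl fun m hm => ?_
      split_ifs with hd
      · obtain ⟨t, rfl⟩ := hd
        have hsq := sieveSet_squarefree _ hm
        rw [Nat.mul_div_cancel_left t hk1,
          primeProd_mul _ (Nat.coprime_of_squarefree_mul hsq),
          totient_eq_primeProd (hsq.squarefree_of_dvd (Dvd.intro_left k rfl)), div_eq_mul_inv,
          ← primeProd_inv_fun]
        have e1 : primeProd (fun p => -((p : ℝ) / (((p : ℝ) - 1) * ((p : ℝ) - 2)))) k =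
            primeProd (fun p => -((p : ℝ) / 2) * (1 / ((p : ℝ) - 1))) k *
            primeProd (fun p => 2 / ((p : ℝ) - 2)) k := by
          rw [← primeProd_mul_fun]
          refine primeProd_congr fun p hp hpd => ?_
          have := h3 k hk p hp hpd
          have h6 : (p : ℝ) - 2 ≠ 0 := by linarith
          have h7 : (p : ℝ) - 1 ≠ 0 := by linarith
          field_simp
        have e2 : primeProd (fun p => ((p : ℝ) - 1)⁻¹) t =
            primeProd (fun p => 2 / ((p : ℝ) - 2)) t *
            primeProd (fun p => 1 + -((p : ℝ) / 2) * (1 / ((p : ℝ) - 1))) t := by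
          rw [← primeProd_mul_fun]
          refine primeProd_congr fun p hp hpd => ?_
          have := h3 _ hm p hp (hpd.mul_left k)
          have h6 : (p : ℝ) - 2 ≠ 0 := by linarith
          have h7 : (p : ℝ) - 1 ≠ 0 := by linarith
          field_simp
          ring
        rw [e1, e2]; ring
      · simp
    rw [show (∑ d ∈ sieveSet h R, if k ∣ d then sieveWeight h c R d *
      primeProd (fun p => 1 / ((p : ℝ) - 1)) d else 0) = _ from h4.trans h5]
    rw [mul_pow, sq (primeProd _ k), ← mul_assoc, ← mul_assoc]
    simp only [← primeProd_mul_fun]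
    congr 1
    refine primeProd_congr fun p hp hpd => ?_
    have := h3 k hk p hp hpd
    have h6 : (p : ℝ) - 2 ≠ 0 := by linarith
    have h7 : (p : ℝ) - 1 ≠ 0 := by linarith
    field_simp
    ring
  · intro d hd p hp hpd
    have := h3 d hd p hp hpd
    have h7 : (p : ℝ) - 1 ≠ 0 := by linarith
    positivity

lemma le_sum_profile_div_totient {h : ℕ} (hh : h ≠ 0) {c R : ℝ} (hc : 0 ≤ c) (hR : 1 < R) {k : ℕ}
    (hk : k ∈ sieveSet h R) :
    (h.totient : ℝ) / h * primeProd (fun p => ((p : ℝ) - 1) / p) k *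
        (Real.log (R / k) + c * Real.log (R / k) ^ 2 / (2 * Real.log R)) ≤
      ∑ m ∈ sieveSet h R, if k ∣ m then profile c R m / (m / k).totient else 0 := by
  obtain ⟨⟨hk1, hkR⟩, hksq, hkh⟩ := mem_sieveSet.1 hk
  have hk0 : (0 : ℝ) < k := by exact_mod_cast hk1
  have hR0 : 0 < R := by linarith
  have hkR' : (k : ℝ) ≤ R := (Nat.le_floor_iff hR0.le).1 hkR
  have hL : 0 < Real.log R := Real.log_pos hR
  have hy : 1 ≤ R / k := (one_le_div hk0).2 hkR'
  have e1 : (∑ m ∈ sieveSet h R, if k ∣ m then profile c R m / (m / k).totient else 0) =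
      ∑ s ∈ Finset.Icc 1 ⌊R / k⌋₊, if Squarefree s ∧ s.Coprime (k * h) then
        profile c R (k * s) / s.totient else 0 := by
    rw [← Finset.sum_filter, ← Finset.sum_filter]
    symm
    refine Finset.sum_nbij (fun s => k * s) ?_ ?_ ?_ ?_
    · intro s hs
      obtain ⟨hsI, hsq, hsc⟩ := Finset.mem_filter.1 hs
      obtain ⟨hs1, hs2⟩ := Finset.mem_Icc.1 hsI
      refine Finset.mem_filter.2 ⟨mem_sieveSet.2 ⟨⟨Nat.mul_pos hk1 hs1, ?_⟩, ?_, ?_⟩,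
        Dvd.intro _ rfl⟩
      · rw [Nat.le_floor_iff (by positivity), le_div_iff₀ hk0] at hs2
        rw [Nat.le_floor_iff hR0.le]; push_cast; linarith
      · exact (Nat.squarefree_mul (Nat.Coprime.coprime_mul_right_right hsc).symm).2 ⟨hksq, hsq⟩
      · exact Nat.Coprime.mul_left hkh (Nat.Coprime.coprime_mul_left_right hsc)
    · intro a _ b _ hab
      exact Nat.eq_of_mul_eq_mul_left hk1 hab
    · intro m hm
      obtain ⟨hm1, s, rfl⟩ := Finset.mem_filter.1 hm
      obtain ⟨⟨h1, h2⟩, h3, h4⟩ := mem_sieveSet.1 hm1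
      refine ⟨s, Finset.mem_filter.2 ⟨Finset.mem_Icc.2 ⟨Nat.pos_of_mul_pos_left h1, ?_⟩,
        h3.squarefree_of_dvd (Dvd.intro_left k rfl),
        Nat.Coprime.mul_right (Nat.coprime_of_squarefree_mul h3).symm
          (Nat.Coprime.coprime_mul_left h4)⟩, rfl⟩
      rw [Nat.le_floor_iff hR0.le] at h2
      rw [Nat.le_floor_iff (by positivity), le_div_iff₀ hk0]
      push_cast at h2; linarith
    · intro s _
      rw [Nat.mul_div_cancel_left s hk1]
  have hlog : ∀ s : ℕ, 1 ≤ s → s ≤ ⌊R / k⌋₊ →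
      0 ≤ Real.log (R / ((k * s : ℕ) : ℝ)) := by
    intro s hs1 hs2
    have hs0 : (0 : ℝ) < s := by exact_mod_cast hs1
    rw [Nat.le_floor_iff (by positivity), le_div_iff₀ hk0] at hs2
    refine Real.log_nonneg ((one_le_div (by push_cast; positivity)).2 ?_)
    push_cast; linarith
  have h1 := totient_div_mul_sum_le (q := k * h) (mul_ne_zero (by omega) hh) ⌊R / k⌋₊
    (fun s => profile c R (k * s))
    (fun s hs => by
      have := hlog s (Finset.mem_Icc.1 hs).1 (Finset.mem_Icc.1 hs).2
      unfold profile; positivity)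
    (fun m n hm hmn hn => by
      have hm0 : (0 : ℝ) < m := by exact_mod_cast hm
      have hn0 : (0 : ℝ) < n := by exact_mod_cast hm.trans hmn
      have : Real.log (R / ((k * n : ℕ) : ℝ)) ≤ Real.log (R / ((k * m : ℕ) : ℝ)) := by
        apply Real.log_le_log (by push_cast; positivity)
        push_cast
        gcongr
      unfold profile
      gcongr)
  rw [e1]
  refine le_trans ?_ h1
  have e2 : ∑ n ∈ Finset.Icc 1 ⌊R / k⌋₊, profile c R (k * n) / n =
      logSum 0 (R / k) + c / Real.log R * logSum 1 (R / k) := by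
    simp only [logSum, Finset.mul_sum, ← Finset.sum_add_distrib, profile]
    refine Finset.sum_congr rfl fun n _ => ?_
    push_cast
    rw [div_mul_eq_div_div]; ring
  have e3 : (((k * h).totient : ℝ) / ((k * h : ℕ) : ℝ)) =
      (h.totient : ℝ) / h * primeProd (fun p => ((p : ℝ) - 1) / p) k := by
    have : primeProd (fun p => ((p : ℝ) - 1) / p) k = k.totient / k := by
      simp only [div_eq_mul_inv]
      rw [primeProd_mul_fun, primeProd_inv_fun, primeProd_natCast hksq, totient_eq_primeProd hksq]
    rw [this, Nat.totient_mul hkh]; push_cast; field_simp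
  rw [e2, e3]
  have hpp : 0 ≤ primeProd (fun p => ((p : ℝ) - 1) / p) k := primeProd_nonneg fun p hp _ => by
    have : (1 : ℝ) ≤ p := by exact_mod_cast hp.one_le
    exact div_nonneg (by linarith) (by linarith)
  have h3 := le_logSum 0 hy
  have h4 := le_logSum 1 hy
  gcongr ?_ * ?_
  have h5 := mul_le_mul_of_nonneg_left h4 (div_nonneg hc hL.le)
  refine le_trans (le_of_eq ?_) (add_le_add h3 h5)
  norm_num
  field_simp

lemma le_sum_sieveWeight_prime {h : ℕ} (h2 : 2 ∣ h) (hh : h ≠ 0) {c R : ℝ} (hc : 0 ≤ c)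
    (hR : 1 < R) :
    ((h.totient : ℝ) / h) ^ 2 * ∑ k ∈ sieveSet h R, primeProd (fun p => 1 / ((p : ℝ) - 2)) k *
        (Real.log (R / k) + c * Real.log (R / k) ^ 2 / (2 * Real.log R)) ^ 2 ≤
      ∑ d ∈ sieveSet h R, ∑ e ∈ sieveSet h R, sieveWeight h c R d * sieveWeight h c R e *
        primeProd (fun p => 1 / ((p : ℝ) - 1)) (d.lcm e) := by
  rw [sum_sieveWeight_prime h2, Finset.mul_sum]
  refine Finset.sum_le_sum fun k hk => ?_
  have h3 : ∀ p, p.Prime → p ∣ k → (3 : ℝ) ≤ p := fun p hp hpd =>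
    three_le_of_dvd_of_coprime h2 (mem_sieveSet.1 hk).2.2 hp hpd
  obtain ⟨⟨hk1, hkR⟩, hksq, hkh⟩ := mem_sieveSet.1 hk
  have hk0 : (0 : ℝ) < k := by exact_mod_cast hk1
  have hkR' : (k : ℝ) ≤ R := (Nat.le_floor_iff (by linarith)).1 hkR
  have hL : 0 < Real.log R := Real.log_pos hR
  have hy : 0 ≤ Real.log (R / k) := Real.log_nonneg ((one_le_div hk0).2 hkR')
  have h4 := le_sum_profile_div_totient hh hc hR hk
  have hpp : 0 ≤ primeProd (fun p => ((p : ℝ) - 1) / p) k := primeProd_nonneg fun p hp hpd => by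
    have := h3 p hp hpd
    exact div_nonneg (by linarith) (by linarith)
  have h5 := pow_le_pow_left₀ (by positivity) h4 2
  have h6 : 0 ≤ primeProd (fun p => (p : ℝ) ^ 2 / (((p : ℝ) - 1) ^ 2 * ((p : ℝ) - 2))) k :=
    primeProd_nonneg fun p hp hpd => by
      have := h3 p hp hpd
      exact div_nonneg (by positivity) (mul_nonneg (by positivity) (by linarith))
  refine le_trans (le_of_eq ?_) (mul_le_mul_of_nonneg_left h5 h6)
  have h7 : primeProd (fun p => 1 / ((p : ℝ) - 2)) k =
      primeProd (fun p => (p : ℝ) ^ 2 / (((p : ℝ) - 1) ^ 2 * ((p : ℝ) - 2))) k *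
      (primeProd (fun p => ((p : ℝ) - 1) / p) k * primeProd (fun p => ((p : ℝ) - 1) / p) k) := by
    simp only [← primeProd_mul_fun]
    refine primeProd_congr fun p hp hpd => ?_
    have := h3 p hp hpd
    have h6 : (p : ℝ) - 2 ≠ 0 := by linarith
    have h7 : (p : ℝ) - 1 ≠ 0 := by linarith
    field_simp
  rw [h7]; ring

lemma sum_convolution_floor (f g : ArithmeticFunction ℝ) (F : ℝ → ℝ) (x : ℝ) (hx : 0 ≤ x) :
    ∑ k ∈ Finset.Icc 1 ⌊x⌋₊, (f * g) k * F (x / k) =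
      ∑ d ∈ Finset.Icc 1 ⌊x⌋₊, f d * ∑ m ∈ Finset.Icc 1 ⌊x / d⌋₊, g m * F (x / d / m) := by
  simp only [ArithmeticFunction.mul_apply, Finset.sum_mul, Finset.mul_sum]
  rw [Finset.sum_sigma', Finset.sum_sigma']
  refine Finset.sum_bij' (fun a _ => ⟨a.2.1, a.2.2⟩) (fun b _ => ⟨b.1 * b.2, (b.1, b.2)⟩)
    ?_ ?_ ?_ ?_ ?_
  · rintro ⟨k, d, m⟩ ha
    simp only [Finset.mem_sigma, Finset.mem_Icc, Nat.mem_divisorsAntidiagonal] at ha ⊢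
    obtain ⟨⟨h1, h2⟩, rfl, h3⟩ := ha
    have hd : 0 < d := Nat.pos_of_ne_zero fun h => h3 (by simp [h])
    have hm : 0 < m := Nat.pos_of_ne_zero fun h => h3 (by simp [h])
    have hd' : (0 : ℝ) < d := by exact_mod_cast hd
    refine ⟨⟨hd, (Nat.le_mul_of_pos_right d hm).trans h2⟩, hm, ?_⟩
    rw [Nat.le_floor_iff hx] at h2
    rw [Nat.le_floor_iff (by positivity), le_div_iff₀ hd']
    push_cast at h2; linarith
  · rintro ⟨d, m⟩ hb
    simp only [Finset.mem_sigma, Finset.mem_Icc, Nat.mem_divisorsAntidiagonal] at hb ⊢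
    obtain ⟨⟨h1, h2⟩, h3, h4⟩ := hb
    have hd' : (0 : ℝ) < d := by exact_mod_cast h1
    rw [Nat.le_floor_iff (by positivity), le_div_iff₀ hd'] at h4
    refine ⟨⟨Nat.mul_pos h1 h3, ?_⟩, trivial, (Nat.mul_pos h1 h3).ne'⟩
    rw [Nat.le_floor_iff hx]; push_cast; linarith
  · rintro ⟨k, d, m⟩ ha
    simp only [Finset.mem_sigma, Finset.mem_Icc, Nat.mem_divisorsAntidiagonal] at ha
    obtain ⟨⟨h1, h2⟩, rfl, h3⟩ := ha
    rfl
  · rintro ⟨d, m⟩ _; rfl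
  · rintro ⟨k, d, m⟩ ha
    simp only [Finset.mem_sigma, Finset.mem_Icc, Nat.mem_divisorsAntidiagonal] at ha
    obtain ⟨⟨h1, h2⟩, rfl, h3⟩ := ha
    simp only
    push_cast
    rw [div_mul_eq_div_div, mul_assoc]

/-- A Tannery-type limit for sums `∑ γ(d) W(x/d)`. -/
lemma tendsto_sum_mul_div_log_pow {γ : ℕ → ℝ} (hγ : Summable fun n => ‖γ n‖) (hγ0 : γ 0 = 0)
    {W : ℝ → ℝ} {m : ℕ} {w C : ℝ} (hW0 : ∀ y, y < 1 → W y = 0)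
    (hWC : ∀ y, 1 ≤ y → |W y| ≤ C * (1 + Real.log y) ^ m)
    (hW : Tendsto (fun y => W y / Real.log y ^ m) atTop (𝓝 w)) :
    Tendsto (fun x : ℝ => (∑ d ∈ Finset.Icc 1 ⌊x⌋₊, γ d * W (x / d)) / Real.log x ^ m) atTop
      (𝓝 (w * ∑' n, γ n)) := by
  have hC : 0 ≤ C := by
    have := (abs_nonneg _).trans (hWC 1 le_rfl)
    simpa using this
  have h1 : Tendsto (fun x : ℝ => ∑' d, γ d * (W (x / d) / Real.log x ^ m)) atTop
      (𝓝 (∑' d, γ d * w)) := by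
    refine tendsto_tsum_of_dominated_convergence (bound := fun d => ‖γ d‖ * (C * 2 ^ m))
      (hγ.mul_right _) ?_ ?_
    · intro d
      rcases Nat.eq_zero_or_pos d with rfl | hd
      · simp [hγ0]
      refine Tendsto.const_mul _ ?_
      have hd0 : (0 : ℝ) < d := by exact_mod_cast hd
      have h2 : Tendsto (fun x : ℝ => x / d) atTop atTop := tendsto_id.atTop_div_const hd0
      have h3 := hW.comp h2
      have h4 : Tendsto (fun x : ℝ => (Real.log (x / d) / Real.log x) ^ m) atTop (𝓝 1) := by
        have h5 : Tendsto (fun x : ℝ => 1 - Real.log d / Real.log x) atTop (𝓝 (1 - 0)) :=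
          tendsto_const_nhds.sub (tendsto_const_nhds.div_atTop Real.tendsto_log_atTop)
        have h6 := h5.pow m
        rw [sub_zero, one_pow] at h6
        refine h6.congr' ?_
        filter_upwards [eventually_gt_atTop 1] with x hx
        rw [Real.log_div (by linarith) hd0.ne']
        have := Real.log_pos hx
        field_simp
      have h7 := h3.mul h4
      rw [mul_one] at h7
      refine h7.congr' ?_
      filter_upwards [eventually_gt_atTop 1, eventually_gt_atTop (d : ℝ)] with x hx hxd
      have := Real.log_pos hx
      have h8 : 0 < Real.log (x / d) := Real.log_pos ((one_lt_div hd0).2 hxd)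
      simp only [Function.comp]
      rw [div_pow]
      field_simp
    · filter_upwards [eventually_ge_atTop (Real.exp 1)] with x hx d
      have hx1 : 1 ≤ Real.log x := by
        rw [Real.le_log_iff_exp_le ((Real.exp_pos 1).trans_le hx)]; exact hx
      have hx0 : 0 < x := (Real.exp_pos 1).trans_le hx
      rw [norm_mul]
      refine mul_le_mul_of_nonneg_left ?_ (norm_nonneg _)
      rcases Nat.eq_zero_or_pos d with rfl | hd
      · simp [hW0 0 (by norm_num)]; positivity
      have hd0 : (0 : ℝ) < d := by exact_mod_cast hd
      by_cases hxd : x / d < 1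
      · rw [hW0 _ hxd]; simp; positivity
      push Not at hxd
      rw [norm_div, norm_pow, Real.norm_of_nonneg (by linarith : 0 ≤ Real.log x),
        div_le_iff₀ (by positivity), Real.norm_eq_abs, mul_assoc, ← mul_pow]
      refine (hWC _ hxd).trans ?_
      have h9 := Real.log_nonneg hxd
      have h10 : Real.log (x / d) ≤ Real.log x := by
        apply Real.log_le_log (by positivity)
        exact div_le_self hx0.le (by exact_mod_cast hd)
      gcongr
      linarith
  rw [tsum_mul_right, mul_comm] at h1
  refine h1.congr' ?_
  filter_upwards [eventually_gt_atTop 0] with x hx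
  rw [tsum_eq_sum (s := Finset.Icc 1 ⌊x⌋₊), Finset.sum_div]
  · exact Finset.sum_congr rfl fun d _ => by ring
  · intro d hd
    rcases Nat.eq_zero_or_pos d with rfl | hd1
    · simp [hγ0]
    have hd0 : (0 : ℝ) < d := by exact_mod_cast hd1
    rw [hW0, zero_div, mul_zero]
    rw [div_lt_one hd0]
    by_contra hcon
    push Not at hcon
    exact hd (Finset.mem_Icc.2 ⟨hd1, (Nat.le_floor_iff hx.le).2 hcon⟩)

/-- Absolute summability of a multiplicative function from bounds on prime powers. -/
lemma summable_of_multiplicative_prime_pow {f : ℕ → ℝ} (hf1 : f 1 = 1)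
    (hmul : ∀ {m n : ℕ}, m.Coprime n → f (m * n) = f m * f n) (C : ℝ) (hC : 0 ≤ C) (K : ℕ)
    (hK : ∀ p k : ℕ, p.Prime → K < k → f (p ^ k) = 0)
    (hb : ∀ p : ℕ, p.Prime → ∑ k ∈ Finset.Icc 1 K, |f (p ^ k)| ≤ C * (1 / (p : ℝ) ^ 2)) :
    Summable fun n => ‖f n‖ := by
  have hts : ∀ p : ℕ, p.Prime → Summable fun k : ℕ => ‖f (p ^ k)‖ := fun p hp =>
    summable_of_ne_finset_zero (s := Finset.range (K + 1)) fun k hk => by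
      rw [hK p k hp (by simpa using hk), norm_zero]
  have hle : ∀ p : ℕ, p.Prime → ∑' k : ℕ, ‖f (p ^ k)‖ ≤ Real.exp (C * (1 / (p : ℝ) ^ 2)) := by
    intro p hp
    rw [tsum_eq_sum (s := Finset.range (K + 1)) fun k hk => by
      rw [hK p k hp (by simpa using hk), norm_zero], Finset.range_eq_Ico,
      Finset.sum_eq_sum_Ico_succ_bot (by omega)]
    have h1 := hb p hp
    have h2 := Real.add_one_le_exp (C * (1 / (p : ℝ) ^ 2))
    have h3 : Finset.Ico (0 + 1) (K + 1) = Finset.Icc 1 K := by ext; simp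
    rw [h3]
    simp only [Real.norm_eq_abs, pow_zero, hf1, abs_one]
    linarith
  have hsq : Summable fun n : ℕ => C * (1 / (n : ℝ) ^ 2) :=
    (Real.summable_one_div_nat_pow.2 (by norm_num)).mul_left C
  have key := fun N => EulerProduct.summable_and_hasSum_smoothNumbers_prod_primesBelow_tsum
    (f := fun n => ‖f n‖) (by simp [hf1]) (fun {m n} h => by simp [hmul h])
    (fun {p} hp => by simpa using hts p hp) N
  refine summable_of_sum_range_le (c := ‖f 0‖ + Real.exp (∑' n : ℕ, C * (1 / (n : ℝ) ^ 2)))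
    (fun _ => norm_nonneg _) fun N => ?_
  have h1 := (hasSum_subtype_iff_indicator (f := fun n : ℕ => ‖f n‖)
    (s := Nat.smoothNumbers N)).1 (key N).2
  have h2 : ∑ n ∈ (Finset.range N).erase 0, ‖f n‖ ≤
      ∏ p ∈ N.primesBelow, ∑' k : ℕ, ‖f (p ^ k)‖ := by
    refine le_trans (le_of_eq ?_) (sum_le_hasSum ((Finset.range N).erase 0) (fun m _ => ?_) h1)
    · refine Finset.sum_congr rfl fun n hn => ?_
      rw [Set.indicator_of_mem]
      obtain ⟨hn0, hnN⟩ := Finset.mem_erase.1 hn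
      refine ⟨hn0, fun p hp => ?_⟩
      exact (Nat.le_of_mem_primeFactorsList hp).trans_lt (Finset.mem_range.1 hnN)
    · exact Set.indicator_nonneg (fun n _ => norm_nonneg _) m
  have h3 : ∏ p ∈ N.primesBelow, ∑' k : ℕ, ‖f (p ^ k)‖ ≤
      Real.exp (∑' n : ℕ, C * (1 / (n : ℝ) ^ 2)) := by
    refine (Finset.prod_le_prod (fun p _ => tsum_nonneg fun _ => norm_nonneg _)
      fun p hp => hle p (Nat.prime_of_mem_primesBelow hp)).trans ?_
    rw [← Real.exp_sum]
    exact Real.exp_le_exp.2 (hsq.sum_le_tsum _ fun n _ => by positivity)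
  have h4 : ∑ n ∈ Finset.range N, ‖f n‖ ≤ ‖f 0‖ + ∑ n ∈ (Finset.range N).erase 0, ‖f n‖ := by
    by_cases h0 : 0 ∈ Finset.range N
    · rw [Finset.add_sum_erase _ (fun n => ‖f n‖) h0]
    · rw [Finset.erase_eq_of_notMem h0]; linarith [norm_nonneg (f 0)]
  linarith

lemma mul_apply_prime_pow (f g : ArithmeticFunction ℝ) {p : ℕ} (hp : p.Prime) (k : ℕ) :
    (f * g) (p ^ k) = ∑ i ∈ Finset.range (k + 1), f (p ^ i) * g (p ^ (k - i)) := by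
  rw [ArithmeticFunction.mul_apply, Nat.sum_divisorsAntidiagonal (fun a b => f a * g b),
    Nat.divisors_prime_pow hp, Finset.sum_map]
  refine Finset.sum_congr rfl fun i hi => ?_
  have : i ≤ k := by simpa [Nat.lt_succ_iff] using hi
  simp [Nat.pow_div this hp.pos]

/-- `n ↦ μ(n)/n`. -/
noncomputable def moebiusDiv : ArithmeticFunction ℝ :=
  ⟨fun n => (ArithmeticFunction.moebius n : ℝ) / n, by simp⟩

/-- `n ↦ 1/n`. -/
noncomputable def natRecip : ArithmeticFunction ℝ := ⟨fun n => 1 / (n : ℝ), by simp⟩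

/-- `n ↦ ∏_{p ∣ n} t/(p-2)` on squarefree `n` coprime to `h`. -/
noncomputable def sieveFn (h : ℕ) (t : ℝ) : ArithmeticFunction ℝ :=
  ⟨fun n => if Squarefree n ∧ n.Coprime h then primeProd (fun p => t / ((p : ℝ) - 2)) n else 0,
    by simp⟩

lemma moebiusDiv_apply (n : ℕ) :
    moebiusDiv n = (ArithmeticFunction.moebius n : ℝ) / n := rfl

lemma natRecip_apply (n : ℕ) : natRecip n = 1 / (n : ℝ) := rfl

lemma sieveFn_apply (h : ℕ) (t : ℝ) (n : ℕ) : sieveFn h t n =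
    if Squarefree n ∧ n.Coprime h then primeProd (fun p => t / ((p : ℝ) - 2)) n else 0 := rfl

lemma moebiusDiv_mul_natRecip : moebiusDiv * natRecip = 1 := by
  ext n
  have h1 := congrArg (fun f : ArithmeticFunction ℝ => f n)
    (ArithmeticFunction.coe_moebius_mul_coe_zeta (R := ℝ))
  simp only [ArithmeticFunction.mul_apply] at h1 ⊢
  rcases Nat.eq_zero_or_pos n with rfl | hn
  · simp
  have h2 : ∑ x ∈ n.divisorsAntidiagonal, moebiusDiv x.1 * natRecip x.2 =
      1 / n * ∑ x ∈ n.divisorsAntidiagonal, ((ArithmeticFunction.moebius : ArithmeticFunction ℝ) x.1)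
        * ((ArithmeticFunction.zeta : ArithmeticFunction ℝ) x.2) := by
    rw [Finset.mul_sum]
    refine Finset.sum_congr rfl fun x hx => ?_
    obtain ⟨h3, h4⟩ := Nat.mem_divisorsAntidiagonal.1 hx
    have h5 : x.2 ≠ 0 := fun h => h4 (by rw [← h3, h, mul_zero])
    have h6 : x.1 ≠ 0 := fun h => h4 (by rw [← h3, h, zero_mul])
    rw [moebiusDiv_apply, natRecip_apply, ArithmeticFunction.intCoe_apply,
      ArithmeticFunction.natCoe_apply, ArithmeticFunction.zeta_apply, if_neg h5, ← h3]
    push_cast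
    field_simp
  rw [h2, h1, ArithmeticFunction.one_apply]
  split_ifs with h
  · simp [h]
  · simp

lemma isMultiplicative_moebiusDiv : moebiusDiv.IsMultiplicative := by
  refine ⟨by simp [moebiusDiv_apply], fun {m n} h => ?_⟩
  rw [moebiusDiv_apply, moebiusDiv_apply, moebiusDiv_apply,
    ArithmeticFunction.isMultiplicative_moebius.map_mul_of_coprime h]
  push_cast
  rw [mul_div_mul_comm]

lemma isMultiplicative_sieveFn (h : ℕ) (t : ℝ) : (sieveFn h t).IsMultiplicative := by
  refine ⟨by simp [sieveFn_apply], fun {m n} hmn => ?_⟩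
  simp only [sieveFn_apply, primeProd_mul _ hmn, Nat.squarefree_mul hmn,
    Nat.coprime_mul_iff_left]
  by_cases h1 : Squarefree m ∧ m.Coprime h <;> by_cases h2 : Squarefree n ∧ n.Coprime h
  · rw [if_pos h1, if_pos h2, if_pos ⟨⟨h1.1, h2.1⟩, h1.2, h2.2⟩]
  · rw [if_neg h2, if_neg (by tauto), mul_zero]
  · rw [if_neg h1, if_neg (by tauto), zero_mul]
  · rw [if_neg h1, if_neg (by tauto), zero_mul]

lemma moebiusDiv_prime {p : ℕ} (hp : p.Prime) : moebiusDiv p = -(1 / (p : ℝ)) := by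
  rw [moebiusDiv_apply, ArithmeticFunction.moebius_apply_prime hp]; push_cast; ring

lemma moebiusDiv_prime_pow {p k : ℕ} (hp : p.Prime) (hk : 1 < k) : moebiusDiv (p ^ k) = 0 := by
  rw [moebiusDiv_apply, ArithmeticFunction.moebius_apply_prime_pow hp (by omega),
    if_neg (by omega)]; simp

lemma sieveFn_prime_pow {p k : ℕ} (hp : p.Prime) (hk : 1 < k) (h : ℕ) (t : ℝ) :
    sieveFn h t (p ^ k) = 0 := by
  rw [sieveFn_apply, if_neg]
  rintro ⟨h1, -⟩
  rw [Nat.squarefree_pow_iff hp.ne_one (by omega)] at h1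
  omega

/-- Values on prime powers of a convolution of a function supported on `{1, p, …, p^K}` with
`moebiusDiv`. -/
lemma mul_moebiusDiv_prime_pow (f : ArithmeticFunction ℝ) {p : ℕ} (hp : p.Prime) (k : ℕ) :
    (f * moebiusDiv) (p ^ (k + 1)) = f (p ^ (k + 1)) - f (p ^ k) * (1 / (p : ℝ)) := by
  rw [mul_apply_prime_pow _ _ hp, Finset.sum_range_succ, Finset.sum_range_succ]
  rw [Finset.sum_eq_zero]
  · simp [moebiusDiv_prime hp, isMultiplicative_moebiusDiv.1]; ring
  · intro i hi
    rw [moebiusDiv_prime_pow hp (by have := Finset.mem_range.1 hi; omega), mul_zero]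

lemma sieveFn_prime {p : ℕ} (hp : p.Prime) (h : ℕ) (t : ℝ) :
    sieveFn h t p = if p ∣ h then 0 else t / ((p : ℝ) - 2) := by
  rw [sieveFn_apply, primeProd_prime _ hp]
  by_cases hd : p ∣ h
  · rw [if_pos hd, if_neg]
    rintro ⟨-, h1⟩
    exact (hp.coprime_iff_not_dvd.1 h1) hd
  · rw [if_neg hd, if_pos ⟨hp.squarefree, hp.coprime_iff_not_dvd.2 hd⟩]

lemma sum_sieveSet_eq (h : ℕ) (t x : ℝ) (F : ℝ → ℝ) :
    ∑ k ∈ sieveSet h x, primeProd (fun p => t / ((p : ℝ) - 2)) k * F (x / k) =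
      ∑ k ∈ Finset.Icc 1 ⌊x⌋₊, sieveFn h t k * F (x / k) := by
  rw [sieveSet, Finset.sum_filter]
  refine Finset.sum_congr rfl fun k _ => ?_
  rw [sieveFn_apply]; split_ifs <;> simp


lemma logSum_of_lt_one (j : ℕ) {y : ℝ} (hy : y < 1) : logSum j y = 0 := by
  rw [logSum, Nat.floor_eq_zero.2 hy]; rfl

lemma logSum_le_two_mul (j : ℕ) {y : ℝ} (hy : 1 ≤ y) :
    logSum j y ≤ 2 * (1 + Real.log y) ^ (j + 1) := by
  have h0 := Real.log_nonneg hy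
  refine (logSum_le j hy).trans ?_
  have h1 : Real.log y ^ (j + 1) / (j + 1) ≤ (1 + Real.log y) ^ (j + 1) :=
    (div_le_self (by positivity) (by linarith [Nat.cast_nonneg (α := ℝ) j])).trans
      (pow_le_pow_left₀ h0 (by linarith) _)
  have h2 : Real.log y ^ j ≤ (1 + Real.log y) ^ (j + 1) :=
    (pow_le_pow_left₀ h0 (by linarith) _).trans
      (pow_le_pow_right₀ (by linarith) (by omega))
  linarith

lemma tendsto_logSum (j : ℕ) :
    Tendsto (fun y => logSum j y / Real.log y ^ (j + 1)) atTop (𝓝 (1 / (j + 1))) := by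
  have h1 : Tendsto (fun y : ℝ => 1 / ((j : ℝ) + 1) + 1 / Real.log y) atTop
      (𝓝 (1 / ((j : ℝ) + 1) + 0)) :=
    tendsto_const_nhds.add (tendsto_const_nhds.div_atTop Real.tendsto_log_atTop)
  rw [add_zero] at h1
  refine tendsto_of_tendsto_of_tendsto_of_le_of_le' tendsto_const_nhds h1 ?_ ?_
  · filter_upwards [eventually_gt_atTop 1] with y hy
    have := Real.log_pos hy
    rw [le_div_iff₀ (by positivity)]
    refine le_trans (le_of_eq ?_) (le_logSum j hy.le)
    ring
  · filter_upwards [eventually_gt_atTop 1] with y hy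
    have := Real.log_pos hy
    rw [div_le_iff₀ (by positivity)]
    refine (logSum_le j hy.le).trans (le_of_eq ?_)
    field_simp
    ring

/-- `∑_{n ≤ y} (1/n) ∑_{m ≤ y/n} log(y/(nm))^j / m`. -/
noncomputable def logSumTwo (j : ℕ) (y : ℝ) : ℝ :=
  ∑ n ∈ Finset.Icc 1 ⌊y⌋₊, natRecip n * logSum j (y / n)

lemma one_le_div_of_mem {y : ℝ} {n : ℕ} (hn : n ∈ Finset.Icc 1 ⌊y⌋₊) : 1 ≤ y / n := by
  obtain ⟨h1, h2⟩ := Finset.mem_Icc.1 hn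
  have hn0 : (0 : ℝ) < n := by exact_mod_cast h1
  rw [one_le_div hn0]
  exact (Nat.le_floor_iff' (by omega)).1 h2

lemma le_logSumTwo (j : ℕ) (y : ℝ) : 1 / (j + 1) * logSum (j + 1) y ≤ logSumTwo j y := by
  rw [logSum, logSumTwo, Finset.mul_sum]
  refine Finset.sum_le_sum fun n hn => ?_
  have h1 := le_logSum j (one_le_div_of_mem hn)
  rw [natRecip_apply]
  have h2 := mul_le_mul_of_nonneg_left h1 (by positivity : (0 : ℝ) ≤ 1 / n)
  refine le_trans (le_of_eq ?_) h2
  ring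

lemma logSumTwo_le (j : ℕ) (y : ℝ) :
    logSumTwo j y ≤ 1 / (j + 1) * logSum (j + 1) y + logSum j y := by
  rw [logSumTwo, logSum, logSum, Finset.mul_sum, ← Finset.sum_add_distrib]
  refine Finset.sum_le_sum fun n hn => ?_
  have h1 := logSum_le j (one_le_div_of_mem hn)
  rw [natRecip_apply]
  have h2 := mul_le_mul_of_nonneg_left h1 (by positivity : (0 : ℝ) ≤ 1 / n)
  refine h2.trans (le_of_eq ?_)
  ring

lemma tendsto_logSumTwo (j : ℕ) :
    Tendsto (fun y => logSumTwo j y / Real.log y ^ (j + 2)) atTop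
      (𝓝 (1 / ((j + 1) * (j + 2)))) := by
  have h1 := (tendsto_logSum (j + 1)).const_mul (1 / ((j : ℝ) + 1))
  have h2 : Tendsto (fun y => logSum j y / Real.log y ^ (j + 1) * (1 / Real.log y)) atTop
      (𝓝 (1 / ((j : ℝ) + 1) * 0)) :=
    (tendsto_logSum j).mul (tendsto_const_nhds.div_atTop Real.tendsto_log_atTop)
  have h3 := h1.add h2
  have e : 1 / ((j : ℝ) + 1) * (1 / (((j + 1 : ℕ) : ℝ) + 1)) = 1 / (((j : ℝ) + 1) * (j + 2)) := by
    push_cast; field_simp; ring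
  rw [mul_zero, add_zero, e] at h3
  rw [e] at h1
  refine tendsto_of_tendsto_of_tendsto_of_le_of_le' h1 h3 ?_ ?_
  · filter_upwards [eventually_gt_atTop 1] with y hy
    have := Real.log_pos hy
    rw [← mul_div_assoc]
    gcongr
    exact le_logSumTwo j y
  · filter_upwards [eventually_gt_atTop 1] with y hy
    have := Real.log_pos hy
    rw [div_le_iff₀ (by positivity)]
    refine (logSumTwo_le j y).trans (le_of_eq ?_)
    field_simp
    ring

lemma abs_logSumTwo_le (j : ℕ) {y : ℝ} (hy : 1 ≤ y) :
    |logSumTwo j y| ≤ 4 * (1 + Real.log y) ^ (j + 2) := by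
  have h0 := Real.log_nonneg hy
  rw [abs_of_nonneg ((mul_nonneg (by positivity) (logSum_nonneg _ _)).trans (le_logSumTwo j y))]
  refine (logSumTwo_le j y).trans ?_
  have h1 := logSum_le_two_mul j hy
  have h2 := logSum_le_two_mul (j + 1) hy
  have h3 : (1 + Real.log y) ^ (j + 1) ≤ (1 + Real.log y) ^ (j + 2) :=
    pow_le_pow_right₀ (by linarith) (by omega)
  have h4 : 1 / ((j : ℝ) + 1) * logSum (j + 1) y ≤ logSum (j + 1) y := by
    refine mul_le_of_le_one_left (logSum_nonneg _ _) ?_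
    rw [div_le_one (by positivity)]; linarith [Nat.cast_nonneg (α := ℝ) j]
  linarith

/-- The convolution quotient of `sieveFn h 1` by `1/n`. -/
noncomputable def gammaOne (h : ℕ) : ArithmeticFunction ℝ := sieveFn h 1 * moebiusDiv

/-- The convolution quotient of `sieveFn h 2` by the convolution square of `1/n`. -/
noncomputable def gammaTwo (h : ℕ) : ArithmeticFunction ℝ :=
  sieveFn h 2 * moebiusDiv * moebiusDiv

lemma isMultiplicative_gammaOne (h : ℕ) : (gammaOne h).IsMultiplicative :=
  (isMultiplicative_sieveFn h 1).mul isMultiplicative_moebiusDiv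

lemma isMultiplicative_gammaTwo (h : ℕ) : (gammaTwo h).IsMultiplicative :=
  ((isMultiplicative_sieveFn h 2).mul isMultiplicative_moebiusDiv).mul isMultiplicative_moebiusDiv

lemma sieveFn_mul_moebiusDiv_values (h : ℕ) (t : ℝ) {p : ℕ} (hp : p.Prime) :
    (sieveFn h t * moebiusDiv) (p ^ 1) = sieveFn h t p - 1 / p ∧
    (sieveFn h t * moebiusDiv) (p ^ 2) = -(sieveFn h t p * (1 / p)) ∧
    ∀ k, 2 < k → (sieveFn h t * moebiusDiv) (p ^ k) = 0 := by
  refine ⟨?_, ?_, fun k hk => ?_⟩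
  · rw [mul_moebiusDiv_prime_pow _ hp 0, pow_zero, (isMultiplicative_sieveFn h t).1]; simp
  · rw [mul_moebiusDiv_prime_pow _ hp 1, sieveFn_prime_pow hp (by omega)]; simp
  · obtain ⟨k, rfl⟩ : ∃ l, k = l + 1 := ⟨k - 1, by omega⟩
    rw [mul_moebiusDiv_prime_pow _ hp k, sieveFn_prime_pow hp (by omega),
      sieveFn_prime_pow hp (by omega)]; simp

lemma gammaTwo_values (h : ℕ) {p : ℕ} (hp : p.Prime) :
    gammaTwo h (p ^ 1) = sieveFn h 2 p - 2 * (1 / p) ∧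
    gammaTwo h (p ^ 2) = -(2 * (sieveFn h 2 p * (1 / p))) + (1 / p) ^ 2 ∧
    gammaTwo h (p ^ 3) = sieveFn h 2 p * (1 / p) ^ 2 ∧
    ∀ k, 3 < k → gammaTwo h (p ^ k) = 0 := by
  obtain ⟨h1, h2, h3⟩ := sieveFn_mul_moebiusDiv_values h 2 hp
  have h0 : (sieveFn h 2 * moebiusDiv) (p ^ 0) = 1 :=
    ((isMultiplicative_sieveFn h 2).mul isMultiplicative_moebiusDiv).1
  unfold gammaTwo
  refine ⟨?_, ?_, ?_, fun k hk => ?_⟩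
  · rw [mul_moebiusDiv_prime_pow _ hp 0, h0, h1]; ring
  · rw [mul_moebiusDiv_prime_pow _ hp 1, h1, h2]; ring
  · rw [mul_moebiusDiv_prime_pow _ hp 2, h2, h3 _ (by omega)]; ring
  · obtain ⟨k, rfl⟩ : ∃ l, k = l + 1 := ⟨k - 1, by omega⟩
    rw [mul_moebiusDiv_prime_pow _ hp k, h3 _ (by omega), h3 _ (by omega)]; simp

lemma inv_sub_two_bounds {p : ℕ} (hp : (3 : ℝ) ≤ p) :
    0 < 1 / ((p : ℝ) - 2) ∧ 1 / ((p : ℝ) - 2) ≤ 3 * (1 / p) ∧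
    1 / ((p : ℝ) - 2) - 1 / p ≤ 6 * (1 / p) ^ 2 ∧ 0 ≤ 1 / ((p : ℝ) - 2) - 1 / p := by
  have h1 : (0 : ℝ) < p - 2 := by linarith
  have h0 : (0 : ℝ) < p := by linarith
  have e : 1 / ((p : ℝ) - 2) - 1 / p = 2 * (1 / ((p : ℝ) - 2)) * (1 / p) := by
    field_simp; ring
  have h2 : 1 / ((p : ℝ) - 2) ≤ 3 * (1 / p) := by
    rw [mul_one_div, div_le_div_iff₀ h1 h0]; linarith
  refine ⟨by positivity, h2, ?_, ?_⟩
  · rw [e]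
    nlinarith [mul_le_mul_of_nonneg_right h2 (by positivity : (0 : ℝ) ≤ 1 / p)]
  · rw [e]; positivity

lemma summable_gammaOne {h : ℕ} (h2 : 2 ∣ h) (hh : h ≠ 0) : Summable fun n => ‖gammaOne h n‖ := by
  refine summable_of_multiplicative_prime_pow (isMultiplicative_gammaOne h).1
    (isMultiplicative_gammaOne h).2 (9 + h) (by positivity) 2
    (fun p k hp hk => (sieveFn_mul_moebiusDiv_values h 1 hp).2.2 k hk) fun p hp => ?_
  obtain ⟨h3, h4, -⟩ := sieveFn_mul_moebiusDiv_values h 1 hp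
  have e : Finset.Icc 1 2 = ({1, 2} : Finset ℕ) := rfl
  rw [e, Finset.sum_pair (by norm_num), gammaOne, h3, h4, sieveFn_prime hp]
  have hp0 : (0 : ℝ) < p := by exact_mod_cast hp.pos
  rw [show 1 / (p : ℝ) ^ 2 = (1 / p) ^ 2 by ring]
  split_ifs with hd
  · have hle : (p : ℝ) ≤ h := by exact_mod_cast Nat.le_of_dvd (Nat.pos_of_ne_zero hh) hd
    rw [zero_sub, abs_neg, abs_of_pos (by positivity)]
    simp only [zero_mul, neg_zero, abs_zero, add_zero]
    have h5 : 1 / (p : ℝ) = p * (1 / p) ^ 2 := by field_simp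
    have h6 := mul_le_mul_of_nonneg_right hle (sq_nonneg (1 / (p : ℝ)))
    have h7 := sq_nonneg (1 / (p : ℝ))
    linarith
  · have hp3 := three_le_of_dvd_of_coprime h2 (hp.coprime_iff_not_dvd.2 hd) hp dvd_rfl
    obtain ⟨b1, b2, b3, b4⟩ := inv_sub_two_bounds hp3
    rw [abs_of_nonneg b4, abs_neg, abs_of_nonneg (by positivity)]
    have hu : (0 : ℝ) < 1 / p := by positivity
    have : 0 ≤ (h : ℝ) * (1 / p) ^ 2 := by positivity
    nlinarith [mul_le_mul_of_nonneg_right b2 hu.le]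

lemma summable_gammaTwo {h : ℕ} (h2 : 2 ∣ h) (hh : h ≠ 0) : Summable fun n => ‖gammaTwo h n‖ := by
  refine summable_of_multiplicative_prime_pow (isMultiplicative_gammaTwo h).1
    (isMultiplicative_gammaTwo h).2 (31 + 2 * h) (by positivity) 3
    (fun p k hp hk => (gammaTwo_values h hp).2.2.2 k hk) fun p hp => ?_
  obtain ⟨h3, h4, h5, -⟩ := gammaTwo_values h hp
  have e : Finset.Icc 1 3 = ({1, 2, 3} : Finset ℕ) := rfl
  rw [e, Finset.sum_insert (by norm_num), Finset.sum_pair (by norm_num), h3, h4, h5,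
    sieveFn_prime hp]
  have hp0 : (0 : ℝ) < p := by exact_mod_cast hp.pos
  have hu : (0 : ℝ) < 1 / p := by positivity
  have hu1 : 1 / (p : ℝ) ≤ 1 := by
    rw [div_le_one hp0]; exact_mod_cast hp.one_le
  rw [show 1 / (p : ℝ) ^ 2 = (1 / p) ^ 2 by ring]
  split_ifs with hd
  · have hle : (p : ℝ) ≤ h := by exact_mod_cast Nat.le_of_dvd (Nat.pos_of_ne_zero hh) hd
    have h6 : 1 / (p : ℝ) ≤ h * (1 / p) ^ 2 := by
      have h5 : 1 / (p : ℝ) = p * (1 / p) ^ 2 := by field_simp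
      have := mul_le_mul_of_nonneg_right hle (sq_nonneg (1 / (p : ℝ)))
      linarith
    rw [zero_sub, abs_neg, abs_of_pos (by positivity)]
    simp only [zero_mul, mul_zero, neg_zero, abs_zero, add_zero, zero_add]
    rw [abs_of_nonneg (by positivity)]
    nlinarith [sq_nonneg (1 / (p : ℝ))]
  · have hp3 := three_le_of_dvd_of_coprime h2 (hp.coprime_iff_not_dvd.2 hd) hp dvd_rfl
    obtain ⟨b1, b2, b3, b4⟩ := inv_sub_two_bounds hp3
    generalize 1 / (p : ℝ) = u at *
    rw [show (2 : ℝ) / ((p : ℝ) - 2) = 2 * (1 / ((p : ℝ) - 2)) by ring]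
    generalize 1 / ((p : ℝ) - 2) = a at *
    have h0 : 0 ≤ (h : ℝ) * u ^ 2 := by positivity
    have e1 : |2 * a - 2 * u| ≤ 12 * u ^ 2 := by
      rw [abs_of_nonneg (by linarith)]; linarith
    have e2 : |-(2 * (2 * a * u)) + u ^ 2| ≤ 13 * u ^ 2 := by
      rw [abs_le]; constructor <;> nlinarith [mul_le_mul_of_nonneg_right b2 hu.le, mul_pos b1 hu]
    have e3 : |2 * a * u ^ 2| ≤ 6 * u ^ 2 := by
      rw [abs_of_nonneg (by positivity)]
      have : a ≤ 3 := by linarith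
      nlinarith [mul_le_mul_of_nonneg_right this (sq_nonneg u)]
    linarith

lemma hasProd_gammaOne {h : ℕ} (h2 : 2 ∣ h) (hh : h ≠ 0) :
    HasProd (fun p : Nat.Primes => (1 + sieveFn h 1 p) * (1 - 1 / (p : ℕ)))
      (∑' n, gammaOne h n) := by
  refine ((isMultiplicative_gammaOne h).eulerProduct_hasProd (summable_gammaOne h2 hh)).congr_fun
    fun p => ?_
  obtain ⟨h3, h4, h5⟩ := sieveFn_mul_moebiusDiv_values h 1 p.2
  rw [← gammaOne] at h3 h4 h5
  rw [tsum_eq_sum (s := Finset.range 3) fun k hk => h5 k (by simp at hk; omega)]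
  simp only [Finset.sum_range_succ, Finset.sum_range_zero]
  rw [h3, h4, pow_zero, (isMultiplicative_gammaOne h).1]; ring

lemma hasProd_gammaTwo {h : ℕ} (h2 : 2 ∣ h) (hh : h ≠ 0) :
    HasProd (fun p : Nat.Primes => (1 + sieveFn h 2 p) * (1 - 1 / (p : ℕ)) ^ 2)
      (∑' n, gammaTwo h n) := by
  refine ((isMultiplicative_gammaTwo h).eulerProduct_hasProd (summable_gammaTwo h2 hh)).congr_fun
    fun p => ?_
  obtain ⟨h3, h4, h5, h6⟩ := gammaTwo_values h p.2
  rw [tsum_eq_sum (s := Finset.range 4) fun k hk => h6 k (by simp at hk; omega)]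
  simp only [Finset.sum_range_succ, Finset.sum_range_zero]
  rw [h3, h4, h5, pow_zero, (isMultiplicative_gammaTwo h).1]; ring

lemma tsum_gammaTwo_eq {h : ℕ} (h2 : 2 ∣ h) (hh : h ≠ 0) :
    ∑' n, gammaTwo h n = (∑' n, gammaOne h n) * ((h.totient : ℝ) / h) := by
  have h1 : HasProd (fun p : Nat.Primes => if (p : ℕ) ∣ h then 1 - 1 / ((p : ℕ) : ℝ) else 1)
      ((h.totient : ℝ) / h) := by
    have e : (h.totient : ℝ) / h = ∏ p ∈ (h.primeFactors).subtype Nat.Prime,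
        if (p : ℕ) ∣ h then 1 - 1 / ((p : ℕ) : ℝ) else 1 := by
      have h3 := congrArg (fun x : ℚ => (x : ℝ)) (Nat.totient_eq_mul_prod_factors h)
      push_cast at h3
      have hh0 : (h : ℝ) ≠ 0 := by exact_mod_cast hh
      rw [h3, mul_div_cancel_left₀ _ hh0,
        Finset.prod_subtype_of_mem (f := fun p : ℕ => if p ∣ h then 1 - 1 / (p : ℝ) else 1)
          (fun p hp => Nat.prime_of_mem_primeFactors hp)]
      refine Finset.prod_congr rfl fun p hp => ?_
      rw [if_pos (Nat.dvd_of_mem_primeFactors hp), one_div]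
    rw [e]
    refine hasProd_prod_of_ne_finset_one fun p hp => if_neg fun hd => hp ?_
    refine Finset.mem_subtype.2 ?_
    exact Nat.mem_primeFactors.2 ⟨p.2, hd, hh⟩
  refine (hasProd_gammaTwo h2 hh).unique (((hasProd_gammaOne h2 hh).mul h1).congr_fun fun p => ?_)
  have hp0 : (0 : ℝ) < (p : ℕ) := by exact_mod_cast p.2.pos
  rw [sieveFn_prime p.2, sieveFn_prime p.2]
  split_ifs with hd
  · ring
  · have hp3 := three_le_of_dvd_of_coprime h2 (p.2.coprime_iff_not_dvd.2 hd) p.2 dvd_rfl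
    have h6 : ((p : ℕ) : ℝ) - 2 ≠ 0 := by linarith
    field_simp
    ring

lemma gammaOne_mul_natRecip (h : ℕ) : gammaOne h * natRecip = sieveFn h 1 := by
  rw [gammaOne, mul_assoc, moebiusDiv_mul_natRecip, mul_one]

lemma gammaTwo_mul_natRecip (h : ℕ) : gammaTwo h * (natRecip * natRecip) = sieveFn h 2 := by
  rw [gammaTwo, ← mul_assoc, mul_assoc _ moebiusDiv natRecip, moebiusDiv_mul_natRecip, mul_one,
    mul_assoc, moebiusDiv_mul_natRecip, mul_one]

lemma sum_natRecip_log_pow (j : ℕ) (y : ℝ) :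
    ∑ m ∈ Finset.Icc 1 ⌊y⌋₊, natRecip m * Real.log (y / m) ^ j = logSum j y :=
  Finset.sum_congr rfl fun m _ => by rw [natRecip_apply]; ring

lemma tendsto_sum_sieveSet_one {h : ℕ} (h2 : 2 ∣ h) (hh : h ≠ 0) (j : ℕ) :
    Tendsto (fun x : ℝ => (∑ k ∈ sieveSet h x, primeProd (fun p => 1 / ((p : ℝ) - 2)) k *
      Real.log (x / k) ^ j) / Real.log x ^ (j + 1)) atTop
      (𝓝 (1 / (j + 1) * ∑' n, gammaOne h n)) := by
  refine (tendsto_sum_mul_div_log_pow (C := 2) (summable_gammaOne h2 hh) (gammaOne h).map_zero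
    (fun y hy => logSum_of_lt_one j hy) (fun y hy => ?_) (tendsto_logSum j)).congr' ?_
  · rw [abs_of_nonneg (logSum_nonneg _ _)]; exact logSum_le_two_mul j hy
  · filter_upwards [eventually_ge_atTop 0] with x hx
    rw [sum_sieveSet_eq h 1 x (fun y => Real.log y ^ j), ← gammaOne_mul_natRecip,
      sum_convolution_floor _ _ (fun y => Real.log y ^ j) x hx]
    simp only [sum_natRecip_log_pow]

lemma tendsto_sum_sieveSet_two {h : ℕ} (h2 : 2 ∣ h) (hh : h ≠ 0) (j : ℕ) :
    Tendsto (fun x : ℝ => (∑ k ∈ sieveSet h x, primeProd (fun p => 2 / ((p : ℝ) - 2)) k *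
      Real.log (x / k) ^ j) / Real.log x ^ (j + 2)) atTop
      (𝓝 (1 / ((j + 1) * (j + 2)) * ∑' n, gammaTwo h n)) := by
  refine (tendsto_sum_mul_div_log_pow (C := 4) (summable_gammaTwo h2 hh) (gammaTwo h).map_zero
    (W := logSumTwo j) (fun y hy => ?_) (fun y hy => abs_logSumTwo_le j hy)
    (tendsto_logSumTwo j)).congr' ?_
  · rw [logSumTwo, Nat.floor_eq_zero.2 hy]; rfl
  · filter_upwards [eventually_ge_atTop 0] with x hx
    rw [sum_sieveSet_eq h 2 x (fun y => Real.log y ^ j), ← gammaTwo_mul_natRecip,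
      sum_convolution_floor _ _ (fun y => Real.log y ^ j) x hx]
    congr 1
    refine Finset.sum_congr rfl fun d _ => ?_
    congr 1
    rw [sum_convolution_floor _ _ (fun y => Real.log y ^ j) _ (by positivity)]
    simp only [sum_natRecip_log_pow]
    rfl

lemma tsum_gammaOne_pos {h : ℕ} (h2 : 2 ∣ h) (hh : h ≠ 0) : 0 < ∑' n, gammaOne h n := by
  have hh0 : (0 : ℝ) < h := by exact_mod_cast Nat.pos_of_ne_zero hh
  have hφ0 : (0 : ℝ) < h.totient := by
    exact_mod_cast Nat.totient_pos.2 (Nat.pos_of_ne_zero hh)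
  have h1 := tendsto_sum_sieveSet_one h2 hh 0
  simp only [pow_zero, mul_one, Nat.cast_zero, zero_add, div_one, one_mul, pow_one] at h1
  refine (div_pos hφ0 hh0).trans_le (ge_of_tendsto h1 ?_)
  filter_upwards [eventually_gt_atTop 1] with x hx
  have hL := Real.log_pos hx
  rw [le_div_iff₀ hL]
  have h3 := totient_div_mul_sum_le hh ⌊x⌋₊ (fun _ => 1) (fun _ _ => zero_le_one)
    (fun _ _ _ _ _ => le_rfl)
  have h4 := le_logSum 0 hx.le
  simp only [logSum, pow_zero, zero_add, pow_one, Nat.cast_zero, div_one] at h4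
  refine (mul_le_mul_of_nonneg_left h4 (div_pos hφ0 hh0).le).trans (h3.trans ?_)
  rw [sieveSet, Finset.sum_filter]
  refine Finset.sum_le_sum fun s _ => ?_
  split_ifs with hs
  · rw [totient_eq_primeProd hs.1, one_div, ← primeProd_inv_fun]
    refine primeProd_le fun p hp hd => ?_
    have := three_le_of_dvd_of_coprime h2 hs.2 hp hd
    refine ⟨inv_nonneg.2 (by linarith), ?_⟩
    rw [one_div]
    exact inv_anti₀ (by linarith) (by linarith)
  · exact le_rfl

lemma exists_main_term_lower_bound {h : ℕ} (h2 : 2 ∣ h) (hh : h ≠ 0) :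
    ∃ δ > 0, ∀ᶠ R : ℝ in atTop, δ * Real.log R ^ 3 ≤
      (1 / (h.totient : ℝ)) * (∑ d ∈ sieveSet h R, ∑ e ∈ sieveSet h R,
        sieveWeight h (32 / 25) R d * sieveWeight h (32 / 25) R e *
          primeProd (fun p => 1 / ((p : ℝ) - 1)) (d.lcm e)) -
      (Real.log R / (36153 / 100000) + Real.log 3) / (4 * h) *
        (∑ d ∈ sieveSet h R, ∑ e ∈ sieveSet h R,
        sieveWeight h (32 / 25) R d * sieveWeight h (32 / 25) R e *
          primeProd (fun p => 2 / (p : ℝ)) (d.lcm e)) := by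
  have hh0 : (0 : ℝ) < h := by exact_mod_cast Nat.pos_of_ne_zero hh
  have hφ0 : (0 : ℝ) < h.totient := by
    exact_mod_cast Nat.totient_pos.2 (Nat.pos_of_ne_zero hh)
  set C := ∑' n, gammaOne h n with hCdef
  have hC : 0 < C := tsum_gammaOne_pos h2 hh
  have hC2 : ∑' n, gammaTwo h n = C * ((h.totient : ℝ) / h) := tsum_gammaTwo_eq h2 hh
  let A : ℕ → ℝ → ℝ := fun j x => (∑ k ∈ sieveSet h x,
    primeProd (fun p => 1 / ((p : ℝ) - 2)) k * Real.log (x / k) ^ j) / Real.log x ^ (j + 1)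
  let B : ℕ → ℝ → ℝ := fun j x => (∑ k ∈ sieveSet h x,
    primeProd (fun p => 2 / ((p : ℝ) - 2)) k * Real.log (x / k) ^ j) / Real.log x ^ (j + 2)
  have hA : ∀ j, Tendsto (A j) atTop (𝓝 (1 / (j + 1) * C)) := tendsto_sum_sieveSet_one h2 hh
  have hB : ∀ j, Tendsto (B j) atTop
      (𝓝 (1 / ((j + 1) * (j + 2)) * (C * ((h.totient : ℝ) / h)))) := fun j => by
    rw [← hC2]; exact tendsto_sum_sieveSet_two h2 hh j
  have hlim : Tendsto (fun R : ℝ => (1 / (h.totient : ℝ)) * (((h.totient : ℝ) / h) ^ 2 *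
      (A 2 R + 32 / 25 * A 3 R + (32 / 25) ^ 2 / 4 * A 4 R)) -
      (1 / (36153 / 100000) + Real.log 3 / Real.log R) / (4 * h) *
      (B 0 R + 2 * (32 / 25) * B 1 R + (32 / 25) ^ 2 * B 2 R)) atTop (𝓝 (
      (1 / (h.totient : ℝ)) * (((h.totient : ℝ) / h) ^ 2 *
      (1 / (((2 : ℕ) : ℝ) + 1) * C + 32 / 25 * (1 / (((3 : ℕ) : ℝ) + 1) * C) +
        (32 / 25) ^ 2 / 4 * (1 / (((4 : ℕ) : ℝ) + 1) * C))) -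
      (1 / (36153 / 100000) + 0) / (4 * h) *
      (1 / ((((0 : ℕ) : ℝ) + 1) * (((0 : ℕ) : ℝ) + 2)) * (C * ((h.totient : ℝ) / h)) +
        2 * (32 / 25) *
          (1 / ((((1 : ℕ) : ℝ) + 1) * (((1 : ℕ) : ℝ) + 2)) * (C * ((h.totient : ℝ) / h))) +
        (32 / 25) ^ 2 *
          (1 / ((((2 : ℕ) : ℝ) + 1) * (((2 : ℕ) : ℝ) + 2)) * (C * ((h.totient : ℝ) / h)))))) := by
    have hl : Tendsto (fun R : ℝ => Real.log 3 / Real.log R) atTop (𝓝 0) :=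
      tendsto_const_nhds.div_atTop Real.tendsto_log_atTop
    exact ((((hA 2).add ((hA 3).const_mul _)).add ((hA 4).const_mul _)).const_mul _
      |>.const_mul _).sub (((tendsto_const_nhds.add hl).div_const _).mul
        (((hB 0).add ((hB 1).const_mul _)).add ((hB 2).const_mul _)))
  set ℓ := (1 / (h.totient : ℝ)) * (((h.totient : ℝ) / h) ^ 2 *
      (1 / (((2 : ℕ) : ℝ) + 1) * C + 32 / 25 * (1 / (((3 : ℕ) : ℝ) + 1) * C) +
        (32 / 25) ^ 2 / 4 * (1 / (((4 : ℕ) : ℝ) + 1) * C))) -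
      (1 / (36153 / 100000) + 0) / (4 * h) *
      (1 / ((((0 : ℕ) : ℝ) + 1) * (((0 : ℕ) : ℝ) + 2)) * (C * ((h.totient : ℝ) / h)) +
        2 * (32 / 25) *
          (1 / ((((1 : ℕ) : ℝ) + 1) * (((1 : ℕ) : ℝ) + 2)) * (C * ((h.totient : ℝ) / h))) +
        (32 / 25) ^ 2 *
          (1 / ((((2 : ℕ) : ℝ) + 1) * (((2 : ℕ) : ℝ) + 2)) * (C * ((h.totient : ℝ) / h))))
    with hℓdef
  have hℓ : 0 < ℓ := by
    have : ℓ = C * (h.totient / h ^ 2) *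
        ((1 / 3 + 32 / 25 / 4 + (32 / 25) ^ 2 / 4 / 5) -
          1 / (36153 / 100000) / 4 * (1 / 2 + 2 * (32 / 25) / 6 + (32 / 25) ^ 2 / 12)) := by
      rw [hℓdef]; push_cast; field_simp; ring
    rw [this]
    have : (0 : ℝ) < (1 / 3 + 32 / 25 / 4 + (32 / 25) ^ 2 / 4 / 5) -
          1 / (36153 / 100000) / 4 * (1 / 2 + 2 * (32 / 25) / 6 + (32 / 25) ^ 2 / 12) := by norm_num
    positivity
  refine ⟨ℓ / 2, by positivity, ?_⟩
  filter_upwards [hlim.eventually (lt_mem_nhds (half_lt_self hℓ)), eventually_gt_atTop 1]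
    with R hR hR1
  have hL := Real.log_pos hR1
  have h5 := le_sum_sieveWeight_prime h2 hh (by norm_num : (0 : ℝ) ≤ 32 / 25) hR1
  have h6 := sum_sieveWeight_uniform h2 (32 / 25) R
  have e1 : ∑ k ∈ sieveSet h R, primeProd (fun p => 1 / ((p : ℝ) - 2)) k *
        (Real.log (R / k) + 32 / 25 * Real.log (R / k) ^ 2 / (2 * Real.log R)) ^ 2 =
      (A 2 R + 32 / 25 * A 3 R + (32 / 25) ^ 2 / 4 * A 4 R) * Real.log R ^ 3 := by
    simp only [A, Finset.sum_div, Finset.mul_sum, Finset.sum_mul, ← Finset.sum_add_distrib]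
    refine Finset.sum_congr rfl fun k _ => ?_
    field_simp
    ring
  have e2 : ∑ k ∈ sieveSet h R, primeProd (fun p => 2 / ((p : ℝ) - 2)) k *
        profile (32 / 25) R k ^ 2 =
      (B 0 R + 2 * (32 / 25) * B 1 R + (32 / 25) ^ 2 * B 2 R) * Real.log R ^ 2 := by
    simp only [B, profile, Finset.sum_div, Finset.mul_sum, Finset.sum_mul,
      ← Finset.sum_add_distrib]
    refine Finset.sum_congr rfl fun k _ => ?_
    field_simp
    ring
  rw [h6, e2]
  rw [e1] at h5
  have h7 := mul_le_mul_of_nonneg_left h5 (by positivity : (0 : ℝ) ≤ 1 / h.totient)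
  have h8 := mul_le_mul_of_nonneg_right hR.le (by positivity : (0 : ℝ) ≤ Real.log R ^ 3)
  refine h8.trans (le_trans (le_of_eq ?_) (sub_le_sub_right h7 _))
  field_simp

lemma exists_sieveWeight_one_sq_le {h : ℕ} (h2 : 2 ∣ h) (hh : h ≠ 0) (c : ℝ) :
    ∃ C > 0, ∀ᶠ R : ℝ in atTop, sieveWeight h c R 1 ^ 2 ≤ C * Real.log R ^ 4 := by
  have hlim := ((tendsto_sum_sieveSet_two h2 hh 0).add
    ((tendsto_sum_sieveSet_two h2 hh 1).const_mul c)).pow 2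
  obtain ⟨l, hl⟩ : ∃ l, Tendsto _ atTop (𝓝 l) := ⟨_, hlim⟩
  refine ⟨|l| + 1, by positivity, ?_⟩
  filter_upwards [hl.eventually (gt_mem_nhds (lt_of_le_of_lt (le_abs_self l) (lt_add_one _))),
    Real.tendsto_log_atTop.eventually_gt_atTop 0] with R hR hL
  set L := Real.log R with hLdef
  have key : sieveWeight h c R 1 = ((∑ k ∈ sieveSet h R, primeProd (fun p => 2 / ((p : ℝ) - 2)) k *
      Real.log (R / k) ^ 0) / L ^ (0 + 2) + c * ((∑ k ∈ sieveSet h R,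
      primeProd (fun p => 2 / ((p : ℝ) - 2)) k * Real.log (R / k) ^ 1) / L ^ (1 + 2))) * L ^ 2 := by
    have h1 : primeProd (fun p => -((p : ℝ) / 2)) 1 = 1 := by simp [primeProd]
    have e : ∀ k ∈ sieveSet h R, (if 1 ∣ k then primeProd (fun p => 2 / ((p : ℝ) - 2)) k *
        profile c R k else 0) = primeProd (fun p => 2 / ((p : ℝ) - 2)) k * Real.log (R / k) ^ 0 +
        c / L * (primeProd (fun p => 2 / ((p : ℝ) - 2)) k * Real.log (R / k) ^ 1) := fun k _ => by
      rw [if_pos (one_dvd k), profile]; ring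
    rw [sieveWeight, h1, one_mul, Finset.sum_congr rfl e, Finset.sum_add_distrib,
      ← Finset.mul_sum]
    field_simp
    ring
  rw [key, mul_pow, ← pow_mul]
  exact mul_le_mul_of_nonneg_right hR.le (by positivity)

lemma sum_squarefree_primeProd_const_div_le (K n : ℕ) :
    ∑ d ∈ (Finset.Icc 1 n).filter Squarefree, primeProd (fun _ => (K : ℝ)) d / d ≤
      (1 + Real.log n) ^ K := by
  have hlog : 0 ≤ Real.log n := Real.log_natCast_nonneg n
  induction K with
  | zero =>
    rw [pow_zero]
    have e : ∀ d ∈ (Finset.Icc 1 n).filter Squarefree,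
        primeProd (fun _ => ((0 : ℕ) : ℝ)) d / d ≤ if d = 1 then 1 else 0 := fun d hd => by
      have hd1 := (Finset.mem_Icc.1 (Finset.mem_filter.1 hd).1).1
      split_ifs with h
      · simp [h, primeProd]
      · rw [Nat.cast_zero, primeProd_zero (by omega), zero_div]
    refine (Finset.sum_le_sum e).trans ?_
    rw [Finset.sum_ite_eq']
    split_ifs <;> norm_num
  | succ K ih =>
    set S := (Finset.Icc 1 n).filter Squarefree with hS
    let f : ℕ → ℝ := primeProd (fun _ => (K : ℝ))
    have hf : ∀ m, 0 ≤ f m := fun m => primeProd_nonneg fun _ _ _ => Nat.cast_nonneg K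
    have e1 : ∀ d ∈ S, primeProd (fun _ => ((K + 1 : ℕ) : ℝ)) d / d =
        ∑ m ∈ d.divisors, (f m / m) * (1 / ((d / m : ℕ) : ℝ)) := fun d hd => by
      have hd0 := (Finset.mem_filter.1 hd).2.ne_zero
      have : primeProd (fun _ => ((K + 1 : ℕ) : ℝ)) d = ∑ m ∈ d.divisors, f m := by
        rw [sum_divisors_primeProd _ (Finset.mem_filter.1 hd).2]
        exact primeProd_congr fun _ _ _ => by push_cast; ring
      rw [this, Finset.sum_div]
      refine Finset.sum_congr rfl fun m hm => ?_
      have hmd := Nat.dvd_of_mem_divisors hm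
      have hm0 : (m : ℝ) ≠ 0 := by
        exact_mod_cast (Nat.pos_of_mem_divisors hm).ne'
      have hd0' : (d : ℝ) ≠ 0 := by exact_mod_cast hd0
      rw [Nat.cast_div hmd hm0]
      field_simp
    rw [Finset.sum_congr rfl e1, Finset.sum_sigma', pow_succ]
    have hharm : ∑ k ∈ Finset.Icc 1 n, 1 / (k : ℝ) ≤ 1 + Real.log n := by
      have := harmonic_le_one_add_log n
      rw [harmonic_eq_sum_Icc] at this
      simpa using this
    refine le_trans ?_ (mul_le_mul ih hharm (Finset.sum_nonneg fun _ _ => by positivity)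
      (by positivity))
    rw [Finset.sum_mul_sum, ← Finset.sum_product']
    let g : (Σ _ : ℕ, ℕ) → ℕ × ℕ := fun x => (x.2, x.1 / x.2)
    have hg : Set.InjOn g (S.sigma fun d => d.divisors : Finset (Σ _ : ℕ, ℕ)) := by
      rintro ⟨d, m⟩ hx ⟨d', m'⟩ hx' heq
      simp only [Finset.coe_sigma, Set.mem_sigma_iff, Finset.mem_coe, Nat.mem_divisors] at hx hx'
      simp only [g, Prod.mk.injEq] at heq
      obtain ⟨rfl, h2⟩ := heq
      obtain rfl : d = d' := by
        rw [← Nat.div_mul_cancel hx.2.1, h2, Nat.div_mul_cancel hx'.2.1]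
      rfl
    rw [← Finset.sum_image (f := fun p : ℕ × ℕ => f p.1 / p.1 * (1 / (p.2 : ℝ))) hg]
    refine Finset.sum_le_sum_of_subset_of_nonneg ?_ fun p _ _ => by
      have := hf p.1; positivity
    intro p hp
    obtain ⟨⟨d, m⟩, hx, rfl⟩ := Finset.mem_image.1 hp
    simp only [Finset.mem_sigma, Nat.mem_divisors, hS, Finset.mem_filter, Finset.mem_Icc] at hx
    have hm0 : 0 < m := Nat.pos_of_dvd_of_pos hx.2.1 (by omega)
    have hmd := Nat.le_of_dvd (by omega) hx.2.1
    simp only [g, Finset.mem_product, hS, Finset.mem_filter, Finset.mem_Icc]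
    exact ⟨⟨⟨hm0, by omega⟩, hx.1.2.squarefree_of_dvd hx.2.1⟩, Nat.div_pos hmd hm0,
      (Nat.div_le_self d m).trans hx.1.1.2⟩

lemma primeProd_const_le_of_dvd {K : ℝ} (hK : 1 ≤ K) {m n : ℕ} (hmn : m ∣ n) (hn : n ≠ 0) :
    primeProd (fun _ => K) m ≤ primeProd (fun _ => K) n := by
  simp only [primeProd, Finset.prod_const]
  exact pow_le_pow_right₀ hK (Finset.card_le_card (Nat.primeFactors_mono hmn hn))

lemma card_divisors_eq_primeProd {n : ℕ} (hn : Squarefree n) :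
    (n.divisors.card : ℝ) = primeProd (fun _ => 2) n := by
  have h := sum_divisors_primeProd (fun _ => 1) hn
  rw [primeProd_congr (c' := fun _ => 2) fun _ _ _ => by norm_num] at h
  rw [← h]
  simp [primeProd]

lemma lcm_mem_sieveSet {h : ℕ} {R : ℝ} (hR : 0 ≤ R) {d e : ℕ} (hd : d ∈ sieveSet h R)
    (he : e ∈ sieveSet h R) : d.lcm e ∈ sieveSet h (R ^ 2) := by
  obtain ⟨⟨hd1, hdR⟩, hds, hdh⟩ := mem_sieveSet.1 hd
  obtain ⟨⟨he1, heR⟩, hes, heh⟩ := mem_sieveSet.1 he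
  have hl0 : d.lcm e ≠ 0 := Nat.lcm_ne_zero (by omega) (by omega)
  refine mem_sieveSet.2 ⟨⟨Nat.pos_of_ne_zero hl0, Nat.le_floor ?_⟩, ?_, ?_⟩
  · have h1 : d.lcm e ≤ d * e := Nat.div_le_self _ _
    calc ((d.lcm e : ℕ) : ℝ) ≤ (d : ℝ) * e := by exact_mod_cast h1
      _ ≤ R * R := mul_le_mul ((Nat.le_floor_iff hR).1 hdR) ((Nat.le_floor_iff hR).1 heR)
        (Nat.cast_nonneg _) hR
      _ = R ^ 2 := by ring
  · rw [Nat.squarefree_iff_factorization_le_one hl0]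
    intro p
    rw [Nat.factorization_lcm (by omega) (by omega), Finsupp.sup_apply]
    exact sup_le (hds.natFactorization_le_one p) (hes.natFactorization_le_one p)
  · exact Nat.Coprime.coprime_dvd_left (Nat.lcm_dvd_mul d e) (Nat.Coprime.mul_left hdh heh)

lemma sum_sum_lcm_le {h : ℕ} {R : ℝ} (hR : 0 ≤ R) {f : ℕ → ℝ} (hf : ∀ n, 0 ≤ f n) :
    ∑ d ∈ sieveSet h R, ∑ e ∈ sieveSet h R, f (d.lcm e) ≤
      ∑ D ∈ sieveSet h (R ^ 2), primeProd (fun _ => 4) D * f D := by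
  rw [← Finset.sum_product', ← Finset.sum_fiberwise_of_maps_to (t := sieveSet h (R ^ 2))
    (g := fun x : ℕ × ℕ => x.1.lcm x.2) fun x hx =>
      lcm_mem_sieveSet hR (Finset.mem_product.1 hx).1 (Finset.mem_product.1 hx).2]
  refine Finset.sum_le_sum fun D hD => ?_
  have hDs := sieveSet_squarefree D hD
  rw [Finset.sum_congr rfl fun x hx => by rw [(Finset.mem_filter.1 hx).2], Finset.sum_const,
    nsmul_eq_mul]
  refine mul_le_mul_of_nonneg_right ?_ (hf D)
  have h4 : primeProd (fun _ => (4 : ℝ)) D = (D.divisors.card : ℝ) * D.divisors.card := by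
    rw [card_divisors_eq_primeProd hDs, ← primeProd_mul_fun]
    exact primeProd_congr fun _ _ _ => by norm_num
  rw [h4, ← Nat.cast_mul, ← Finset.card_product]
  refine Nat.cast_le.2 (Finset.card_le_card fun x hx => ?_)
  have hx2 := (Finset.mem_filter.1 hx).2
  rw [Finset.mem_product, Nat.mem_divisors, Nat.mem_divisors, ← hx2]
  have : x.1.lcm x.2 ≠ 0 := hx2 ▸ hDs.ne_zero
  exact ⟨⟨Nat.dvd_lcm_left _ _, this⟩, Nat.dvd_lcm_right _ _, this⟩

lemma abs_sieveWeight_le {h : ℕ} (h2 : 2 ∣ h) {c R : ℝ} (hc : 0 ≤ c) (hR : 1 < R) {d : ℕ}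
    (hd : d ∈ sieveSet h R) :
    |sieveWeight h c R d| ≤ (1 + c) * (1 + Real.log R) ^ 6 * primeProd (fun _ => 3) d := by
  obtain ⟨⟨hd1, hdR⟩, hds, hdh⟩ := mem_sieveSet.1 hd
  have hL : 0 < Real.log R := Real.log_pos hR
  have h3 := @three_le_of_dvd_of_coprime h h2
  have hprof : ∀ m ∈ sieveSet h R, 0 ≤ profile c R m ∧ profile c R m ≤ 1 + c := fun m hm => by
    obtain ⟨⟨hm1, hmR⟩, -, -⟩ := mem_sieveSet.1 hm
    have hm1' : (1 : ℝ) ≤ m := by exact_mod_cast hm1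
    have hmR' : (m : ℝ) ≤ R := (Nat.le_floor_iff (by linarith)).1 hmR
    have a : 0 ≤ Real.log (R / m) := Real.log_nonneg ((one_le_div (by linarith)).2 hmR')
    have b : Real.log (R / m) ≤ Real.log R :=
      Real.log_le_log (by positivity) (div_le_self (by linarith) hm1')
    have q : Real.log (R / m) / Real.log R ≤ 1 := (div_le_one hL).2 b
    refine ⟨by unfold profile; positivity, ?_⟩
    unfold profile
    nlinarith
  have hpos2 : ∀ m ∈ sieveSet h R, 0 ≤ primeProd (fun p => 2 / ((p : ℝ) - 2)) m := fun m hm =>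
    primeProd_nonneg fun p hp hpm => by
      have := h3 (mem_sieveSet.1 hm).2.2 hp hpm
      exact div_nonneg (by norm_num) (by linarith)
  have key : ∀ m ∈ (sieveSet h R).filter (d ∣ ·),
      primeProd (fun p => 2 / ((p : ℝ) - 2)) m * profile c R m ≤
      (1 + c) * primeProd (fun p => 2 / ((p : ℝ) - 2)) d *
        (primeProd (fun _ => ((6 : ℕ) : ℝ)) (m / d) / ((m / d : ℕ) : ℝ)) := fun m hm => by
    obtain ⟨hmS, k, rfl⟩ := Finset.mem_filter.1 hm
    have hsq := sieveSet_squarefree _ hmS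
    have hcop := Nat.coprime_of_squarefree_mul hsq
    have hks := hsq.squarefree_of_dvd (Dvd.intro_left d rfl)
    rw [Nat.mul_div_cancel_left _ hd1, primeProd_mul _ hcop]
    have hkh : k.Coprime h :=
      Nat.Coprime.coprime_dvd_left (Dvd.intro_left d rfl) (mem_sieveSet.1 hmS).2.2
    have hk : primeProd (fun p => 2 / ((p : ℝ) - 2)) k ≤
        primeProd (fun _ => ((6 : ℕ) : ℝ)) k / (k : ℝ) := by
      rw [← primeProd_natCast hks, div_eq_mul_inv, ← primeProd_inv_fun, ← primeProd_mul_fun]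
      refine primeProd_le fun p hp hpk => ?_
      have := h3 hkh hp hpk
      refine ⟨div_nonneg (by norm_num) (by linarith), ?_⟩
      rw [← div_eq_mul_inv, div_le_div_iff₀ (by linarith) (by linarith)]
      push_cast
      linarith
    have hd0 : 0 ≤ primeProd (fun p => 2 / ((p : ℝ) - 2)) d := hpos2 d hd
    have hk0 : 0 ≤ primeProd (fun p => 2 / ((p : ℝ) - 2)) k := hpos2 k
      (sieveSet_dvd_closed _ hmS k (Dvd.intro_left d rfl))
    calc _ ≤ primeProd (fun p => 2 / ((p : ℝ) - 2)) d * primeProd (fun p => 2 / ((p : ℝ) - 2)) k *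
        (1 + c) := mul_le_mul_of_nonneg_left (hprof _ hmS).2 (by positivity)
      _ ≤ primeProd (fun p => 2 / ((p : ℝ) - 2)) d *
        (primeProd (fun _ => ((6 : ℕ) : ℝ)) k / (k : ℝ)) * (1 + c) := by gcongr
      _ = _ := by ring
  have hsum : ∑ m ∈ (sieveSet h R).filter (d ∣ ·),
      primeProd (fun _ => ((6 : ℕ) : ℝ)) (m / d) / ((m / d : ℕ) : ℝ) ≤ (1 + Real.log R) ^ 6 := by
    have hinj : Set.InjOn (· / d) ((sieveSet h R).filter (d ∣ ·) : Finset ℕ) := by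
      intro a ha b hb hab
      have ha' := (Finset.mem_filter.1 (Finset.mem_coe.1 ha)).2
      have hb' := (Finset.mem_filter.1 (Finset.mem_coe.1 hb)).2
      rw [← Nat.div_mul_cancel ha', ← Nat.div_mul_cancel hb']
      exact congrArg (· * d) hab
    rw [← Finset.sum_image (f := fun k : ℕ => primeProd (fun _ => ((6 : ℕ) : ℝ)) k / (k : ℝ)) hinj]
    have hfl : Real.log ⌊R⌋₊ ≤ Real.log R :=
      Real.log_le_log (by exact_mod_cast hd1.trans hdR) (Nat.floor_le (by linarith))
    have hfl0 : 0 ≤ Real.log ⌊R⌋₊ := Real.log_natCast_nonneg _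
    refine le_trans (Finset.sum_le_sum_of_subset_of_nonneg ?_ fun k _ _ => ?_)
      ((sum_squarefree_primeProd_const_div_le 6 ⌊R⌋₊).trans
        (pow_le_pow_left₀ (by linarith) (by linarith) 6))
    · intro k hk
      obtain ⟨m, hm, rfl⟩ := Finset.mem_image.1 hk
      obtain ⟨hmS, hdm⟩ := Finset.mem_filter.1 hm
      have := mem_sieveSet.1 (sieveSet_dvd_closed m hmS (m / d) (Nat.div_dvd_of_dvd hdm))
      exact Finset.mem_filter.2 ⟨Finset.mem_Icc.2 this.1, this.2.1⟩
    · exact div_nonneg (primeProd_nonneg fun _ _ _ => Nat.cast_nonneg _) (Nat.cast_nonneg _)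
  have habs : |primeProd (fun p => -((p : ℝ) / 2)) d| = primeProd (fun p => (p : ℝ) / 2) d := by
    simp only [primeProd, Finset.abs_prod, abs_neg]
    exact Finset.prod_congr rfl fun p _ => abs_of_nonneg (by positivity)
  have hd0 : 0 ≤ primeProd (fun p => 2 / ((p : ℝ) - 2)) d := hpos2 d hd
  have hp0 : 0 ≤ primeProd (fun p => (p : ℝ) / 2) d := primeProd_nonneg fun p _ _ => by positivity
  rw [sieveWeight, abs_mul, habs, ← Finset.sum_filter, abs_of_nonneg (Finset.sum_nonneg fun m hm =>
    mul_nonneg (hpos2 m (Finset.mem_filter.1 hm).1) (hprof m (Finset.mem_filter.1 hm).1).1)]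
  calc _ ≤ primeProd (fun p => (p : ℝ) / 2) d * ((1 + c) * primeProd (fun p => 2 / ((p : ℝ) - 2)) d
        * (1 + Real.log R) ^ 6) := by
        refine mul_le_mul_of_nonneg_left ((Finset.sum_le_sum key).trans ?_) hp0
        rw [← Finset.mul_sum]
        exact mul_le_mul_of_nonneg_left hsum (by positivity)
    _ = (1 + c) * (1 + Real.log R) ^ 6 *
        primeProd (fun p => (p : ℝ) / 2 * (2 / ((p : ℝ) - 2))) d := by
        rw [primeProd_mul_fun]; ring
    _ ≤ _ := by
        refine mul_le_mul_of_nonneg_left (primeProd_le fun p hp hpd => ?_) (by positivity)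
        have := h3 hdh hp hpd
        refine ⟨mul_nonneg (by positivity) (div_nonneg (by norm_num) (by linarith)), ?_⟩
        rw [div_mul_div_comm, div_le_iff₀ (by nlinarith)]
        nlinarith

lemma abs_card_Ico_filter_mod_sub_le {a b : ℕ} (hab : a ≤ b) {q : ℕ} (hq : 0 < q) (v : ℕ) :
    |(((Finset.Ico a b).filter fun n => n % q = v % q).card : ℝ) - ((b : ℝ) - a) / q| ≤ 1 := by
  have hcard := Nat.Ico_filter_modEq_card a b hq v
  have hq' : (0 : ℚ) < q := by exact_mod_cast hq
  have hab' : (a : ℚ) ≤ b := by exact_mod_cast hab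
  set x : ℚ := ((b : ℚ) - v) / q
  set y : ℚ := ((a : ℚ) - v) / q
  have hyx : y ≤ x := by simp only [x, y]; gcongr
  rw [max_eq_left (sub_nonneg.2 (Int.ceil_mono hyx))] at hcard
  have h1 := Int.le_ceil x
  have h2 := Int.ceil_lt_add_one x
  have h3 := Int.le_ceil y
  have h4 := Int.ceil_lt_add_one y
  have e : (((Finset.Ico a b).filter fun n => n % q = v % q).card : ℚ) = ⌈x⌉ - ⌈y⌉ := by
    exact_mod_cast hcard
  have e2 : ((b : ℚ) - a) / q = x - y := by simp only [x, y]; ring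
  have key : |(((Finset.Ico a b).filter fun n => n % q = v % q).card : ℚ) - ((b : ℚ) - a) / q| ≤
      1 := by
    rw [e, e2, abs_le]
    constructor <;> linarith
  have key' := (Rat.cast_le (K := ℝ)).2 key
  push_cast at key'
  exact key'

lemma card_Icc_filter_mod_le {q : ℕ} (hq : 0 < q) (M v : ℕ) :
    (((Finset.Icc 1 M).filter fun n => n % q = v % q).card : ℝ) ≤ M / q + 1 := by
  have := abs_le.1 (abs_card_Ico_filter_mod_sub_le (Nat.le_add_left 1 M) hq v)
  rw [← Finset.Ico_add_one_right_eq_Icc]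
  push_cast at this
  simp only [add_sub_cancel_right] at this
  linarith [this.2]

lemma abs_sum_mod_le_maxAbs (f : ℕ → ℝ) (q M a : ℕ) :
    |∑ n ∈ Finset.Icc 1 M, if n % q = a % q then f n else 0| ≤ maxAbs f q M := by
  refine le_ciSup (f := fun a : ℕ => |∑ n ∈ Finset.Icc 1 M, if n % q = a % q then f n else 0|)
    ⟨∑ n ∈ Finset.Icc 1 M, |f n|, ?_⟩ a
  rintro _ ⟨b, rfl⟩
  refine (Finset.abs_sum_le_sum_abs _ _).trans (Finset.sum_le_sum fun n _ => ?_)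
  split_ifs <;> simp

lemma maxAbs_nonneg (f : ℕ → ℝ) (q M : ℕ) : 0 ≤ maxAbs f q M :=
  Real.iSup_nonneg fun _ => abs_nonneg _

lemma maxAbs_le {f : ℕ → ℝ} {b : ℝ} (hb : 0 ≤ b) {q : ℕ} (hq : 0 < q) {M : ℕ}
    (hf : ∀ n ∈ Finset.Icc 1 M, |f n| ≤ b) : maxAbs f q M ≤ b * (M / q + 1) := by
  refine ciSup_le fun a => ?_
  calc _ ≤ ∑ n ∈ Finset.Icc 1 M, |if n % q = a % q then f n else 0| :=
        Finset.abs_sum_le_sum_abs _ _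
    _ ≤ ∑ n ∈ Finset.Icc 1 M, if n % q = a % q then b else 0 := by
        refine Finset.sum_le_sum fun n hn => ?_
        split_ifs
        · exact hf n hn
        · simp
    _ = b * ((Finset.Icc 1 M).filter fun n => n % q = a % q).card := by
        rw [← Finset.sum_filter, Finset.sum_const, nsmul_eq_mul, mul_comm]
    _ ≤ _ := mul_le_mul_of_nonneg_left (card_Icc_filter_mod_le hq M a) hb

lemma sum_prime_mod_le {q : ℕ} (hq : 0 < q) {M : ℕ} (a : ℕ) :
    0 ≤ (∑ p ∈ Finset.Icc 1 M, if p.Prime ∧ p % q = a % q then Real.log p else 0) ∧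
    (∑ p ∈ Finset.Icc 1 M, if p.Prime ∧ p % q = a % q then Real.log p else 0) ≤
      Real.log M * (M / q + 1) := by
  refine ⟨Finset.sum_nonneg fun n _ => ?_, ?_⟩
  · split_ifs
    · exact Real.log_natCast_nonneg n
    · exact le_rfl
  · calc _ ≤ ∑ n ∈ Finset.Icc 1 M, if n % q = a % q then Real.log M else 0 := by
          refine Finset.sum_le_sum fun n hn => ?_
          have hn' := Finset.mem_Icc.1 hn
          have hl : Real.log n ≤ Real.log M := Real.log_le_log
            (by exact_mod_cast hn'.1) (by exact_mod_cast hn'.2)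
          have hM := Real.log_natCast_nonneg M
          split_ifs with h1 h2 h2
          · exact hl
          · exact absurd h1.2 h2
          · exact hM
          · exact le_rfl
      _ = Real.log M * ((Finset.Icc 1 M).filter fun n => n % q = a % q).card := by
        rw [← Finset.sum_filter, Finset.sum_const, nsmul_eq_mul, mul_comm]
      _ ≤ _ := mul_le_mul_of_nonneg_left (card_Icc_filter_mod_le hq M a)
        (Real.log_natCast_nonneg M)

lemma primeMaxAbs_term_le {q : ℕ} (hq : 0 < q) (M a : ℕ) :
    (if Nat.Coprime a q then
      |(∑ p ∈ Finset.Icc 1 M, if p.Prime ∧ p % q = a % q then Real.log p else 0)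
        - M / q.totient| else 0) ≤ Real.log M * (M / q + 1) + M / q.totient := by
  obtain ⟨h1, h2⟩ := sum_prime_mod_le hq (M := M) a
  have h3 : (0 : ℝ) ≤ M / q.totient := by positivity
  split_ifs
  · rw [abs_le]
    constructor <;> linarith
  · linarith

lemma abs_sum_prime_mod_sub_le_primeMaxAbs {q : ℕ} (hq : 0 < q) (M : ℕ) {a : ℕ}
    (ha : a.Coprime q) :
    |(∑ p ∈ Finset.Icc 1 M, if p.Prime ∧ p % q = a % q then Real.log p else 0)
      - M / q.totient| ≤ primeMaxAbs q M := by
  have := le_ciSup (f := fun a : ℕ => if Nat.Coprime a q then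
      |(∑ p ∈ Finset.Icc 1 M, if p.Prime ∧ p % q = a % q then Real.log p else 0)
        - M / q.totient| else 0) ⟨Real.log M * (M / q + 1) + M / q.totient, by
          rintro _ ⟨b, rfl⟩; exact primeMaxAbs_term_le hq M b⟩ a
  rwa [if_pos ha] at this

lemma primeMaxAbs_nonneg (q M : ℕ) : 0 ≤ primeMaxAbs q M :=
  Real.iSup_nonneg fun _ => by split_ifs <;> positivity

lemma primeMaxAbs_le {q : ℕ} (hq : 0 < q) (M : ℕ) :
    primeMaxAbs q M ≤ Real.log M * (M / q + 1) + M / q.totient :=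
  ciSup_le fun a => primeMaxAbs_term_le hq M a

lemma sum_Ico_mod_shift_eq (f : ℕ → ℝ) {N : ℕ} (hN : 0 < N) (q s a : ℕ) :
    (∑ n ∈ Finset.Ico N (2 * N), if n % q = a % q then f (n + s) else 0) =
      (∑ n ∈ Finset.Icc 1 (2 * N + s - 1), if n % q = (a + s) % q then f n else 0) -
      ∑ n ∈ Finset.Icc 1 (N + s - 1), if n % q = (a + s) % q then f n else 0 := by
  rw [eq_sub_iff_add_eq', ← Finset.Ico_add_one_right_eq_Icc, ← Finset.Ico_add_one_right_eq_Icc,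
    show N + s - 1 + 1 = N + s by omega, show 2 * N + s - 1 + 1 = 2 * N + s by omega,
    ← Finset.sum_Ico_consecutive _ (show 1 ≤ N + s by omega)
      (show N + s ≤ 2 * N + s by omega), ← Finset.sum_Ico_add' _ N (2 * N) s]
  congr 1
  refine Finset.sum_congr rfl fun n _ => if_congr ?_ rfl rfl
  exact ⟨fun h => Nat.ModEq.add_right s h, fun h => Nat.ModEq.add_right_cancel' s h⟩

lemma abs_sum_Ico_mod_shift_le (f : ℕ → ℝ) {N : ℕ} (hN : 0 < N) (q s a : ℕ) :
    |∑ n ∈ Finset.Ico N (2 * N), if n % q = a % q then f (n + s) else 0| ≤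
      maxAbs f q (2 * N + s - 1) + maxAbs f q (N + s - 1) := by
  rw [sum_Ico_mod_shift_eq f hN]
  exact (abs_sub _ _).trans (add_le_add (abs_sum_mod_le_maxAbs f q _ _)
    (abs_sum_mod_le_maxAbs f q _ _))

lemma abs_sum_Ico_theta_mod_shift_le {N : ℕ} (hN : 0 < N) {q : ℕ} (hq : 0 < q) {s a : ℕ}
    (ha : (a + s).Coprime q) :
    |(∑ n ∈ Finset.Ico N (2 * N), if n % q = a % q then theta (n + s) else 0) - N / q.totient| ≤
      primeMaxAbs q (2 * N + s - 1) + primeMaxAbs q (N + s - 1) := by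
  have e : ∀ M : ℕ, (∑ n ∈ Finset.Icc 1 M, if n % q = (a + s) % q then theta n else 0) =
      ∑ p ∈ Finset.Icc 1 M, if p.Prime ∧ p % q = (a + s) % q then Real.log p else 0 := fun M =>
    Finset.sum_congr rfl fun n _ => by
      unfold theta
      split_ifs <;> simp_all
  have h1 := abs_le.1 (abs_sum_prime_mod_sub_le_primeMaxAbs hq (2 * N + s - 1) ha)
  have h2 := abs_le.1 (abs_sum_prime_mod_sub_le_primeMaxAbs hq (N + s - 1) ha)
  rw [sum_Ico_mod_shift_eq theta hN, e, e]
  have e3 : (N : ℝ) / q.totient = ((2 * N + s - 1 : ℕ) : ℝ) / q.totient -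
      ((N + s - 1 : ℕ) : ℝ) / q.totient := by
    rw [Nat.cast_sub (by omega), Nat.cast_sub (by omega)]
    push_cast
    ring
  rw [e3, abs_le]
  constructor <;> linarith

lemma exists_class {h D₁ D₂ : ℕ} (hD₂ : 0 < D₂) (h12 : D₁.Coprime D₂)
    (h1 : D₁.Coprime h) (h2 : D₂.Coprime h) :
    ∃ a : ℕ, ∀ n : ℕ, n % (h * (D₁ * D₂)) = a % (h * (D₁ * D₂)) ↔
      n % h = 1 % h ∧ D₁ ∣ n ∧ D₂ ∣ n + h := by
  obtain ⟨b, hb1, hb2⟩ := Nat.chineseRemainder h12 0 ((D₂ - 1) * h)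
  obtain ⟨a, ha1, ha2⟩ := Nat.chineseRemainder (Nat.Coprime.mul_left h1 h2).symm 1 b
  refine ⟨a, fun n => ?_⟩
  have hz : (D₂ - 1) * h + h ≡ 0 [MOD D₂] := by
    have : (D₂ - 1) * h + h = D₂ * h := by
      obtain ⟨k, rfl⟩ := Nat.exists_eq_succ_of_ne_zero hD₂.ne'
      simp [Nat.succ_mul]
    rw [this]
    exact (Nat.modEq_zero_iff_dvd.2 (Dvd.intro h rfl))
  change n ≡ a [MOD h * (D₁ * D₂)] ↔ n ≡ 1 [MOD h] ∧ _
  rw [← Nat.modEq_and_modEq_iff_modEq_mul (Nat.Coprime.mul_left h1 h2).symm,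
    ← Nat.modEq_and_modEq_iff_modEq_mul h12]
  refine and_congr ⟨fun e => e.trans ha1, fun e => e.trans ha1.symm⟩ (and_congr ?_ ?_)
  · have : a ≡ 0 [MOD D₁] := (ha2.of_mul_right D₂).trans hb1
    rw [← Nat.modEq_zero_iff_dvd]
    exact ⟨fun e => e.trans this, fun e => e.trans this.symm⟩
  · have : a + h ≡ 0 [MOD D₂] := (((ha2.of_mul_left D₁).trans hb2).add_right h).trans hz
    rw [← Nat.modEq_zero_iff_dvd]
    exact ⟨fun e => (e.add_right h).trans this,
      fun e => Nat.ModEq.add_right_cancel' h (e.trans this.symm)⟩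

lemma coprime_of_mod_eq_one_of_dvd_add {h D a : ℕ} (ha : a % h = 1 % h)
    (hD : D ∣ a + h) : a.Coprime (h * D) := by
  have h1 : a.Coprime h := by
    rw [Nat.coprime_iff_gcd_eq_one, Nat.ModEq.gcd_eq (show a ≡ 1 [MOD h] from ha),
      Nat.gcd_one_left]
  refine Nat.Coprime.mul_right h1 (Nat.Coprime.coprime_dvd_right hD ?_)
  rwa [Nat.coprime_self_add_right]

lemma coprime_add_of_mod_eq_one_of_dvd {h D a : ℕ} (hDh : D.Coprime h) (ha : a % h = 1 % h)
    (hD : D ∣ a) : (a + h).Coprime (h * D) := by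
  have h1 : a.Coprime h := by
    rw [Nat.coprime_iff_gcd_eq_one, Nat.ModEq.gcd_eq (show a ≡ 1 [MOD h] from ha),
      Nat.gcd_one_left]
  refine Nat.Coprime.mul_right (by rwa [Nat.coprime_add_self_left]) ?_
  obtain ⟨k, rfl⟩ := hD
  rw [Nat.coprime_mul_left_add_left]
  exact hDh.symm

lemma dvd_mul_add_iff_gcd {h D n : ℕ} (hDs : Squarefree D) (hDh : D.Coprime h) {D₁ : ℕ}
    (hD₁ : D₁ ∣ D) : (D₁ ∣ n ∧ D / D₁ ∣ n + h) ↔ (D₁ = D.gcd n ∧ D ∣ n * (n + h)) := by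
  have hD0 : 0 < D := Nat.pos_of_ne_zero hDs.ne_zero
  constructor
  · rintro ⟨h1, h2⟩
    refine ⟨Nat.dvd_antisymm (Nat.dvd_gcd hD₁ h1) ?_, ?_⟩
    · have hc : (D.gcd n).Coprime (D / D₁) := by
        have hg : (D.gcd n).gcd (D / D₁) ∣ h := by
          have a1 : (D.gcd n).gcd (D / D₁) ∣ n := (Nat.gcd_dvd_left _ _).trans (Nat.gcd_dvd_right _ _)
          exact (Nat.dvd_add_right a1).1 ((Nat.gcd_dvd_right _ _).trans h2)
        have hg2 : (D.gcd n).gcd (D / D₁) ∣ D := (Nat.gcd_dvd_left _ _).trans (Nat.gcd_dvd_left _ _)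
        exact Nat.eq_one_of_dvd_coprimes hDh hg2 hg
      refine hc.dvd_of_dvd_mul_right ?_
      rw [Nat.mul_div_cancel' hD₁]
      exact Nat.gcd_dvd_left _ _
    · rw [← Nat.mul_div_cancel' hD₁]
      exact mul_dvd_mul h1 h2
  · rintro ⟨rfl, h2⟩
    refine ⟨Nat.gcd_dvd_right _ _, ?_⟩
    have hg0 : 0 < D.gcd n := Nat.gcd_pos_of_pos_left _ hD0
    have hc := Nat.coprime_div_gcd_div_gcd (m := D) (n := n) hg0
    refine hc.dvd_of_dvd_mul_left ?_
    rw [← Nat.mul_dvd_mul_iff_left hg0, Nat.mul_div_cancel' hD₁, ← mul_assoc,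
      Nat.mul_div_cancel' (Nat.gcd_dvd_right _ _)]
    exact h2

lemma exists_classes {h D : ℕ} (hDs : Squarefree D) (hDh : D.Coprime h) :
    ∃ a : ℕ → ℕ, ∀ D₁ ∈ D.divisors, ∀ n : ℕ, n % (h * D) = a D₁ % (h * D) ↔
      n % h = 1 % h ∧ D₁ ∣ n ∧ D / D₁ ∣ n + h := by
  have : ∀ D₁ : ℕ, ∃ a : ℕ, D₁ ∈ D.divisors → ∀ n : ℕ, n % (h * D) = a % (h * D) ↔
      n % h = 1 % h ∧ D₁ ∣ n ∧ D / D₁ ∣ n + h := fun D₁ => by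
    by_cases hD₁ : D₁ ∈ D.divisors
    · have hd := Nat.dvd_of_mem_divisors hD₁
      have hD0 : 0 < D := Nat.pos_of_ne_zero hDs.ne_zero
      have hm := Nat.mul_div_cancel' hd
      obtain ⟨a, ha⟩ := exists_class (h := h)
        (Nat.div_pos (Nat.le_of_dvd hD0 hd) (Nat.pos_of_dvd_of_pos hd hD0))
        (Nat.coprime_of_squarefree_mul (hm.symm ▸ hDs)) (hDh.coprime_dvd_left hd)
        (hDh.coprime_dvd_left (Nat.div_dvd_of_dvd hd))
      rw [hm] at ha
      exact ⟨a, fun _ => ha⟩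
    · exact ⟨0, fun h => absurd h hD₁⟩
  choose a ha using this
  exact ⟨a, fun D₁ hD₁ => ha D₁ hD₁⟩

lemma sum_dvd_eq_sum_classes {h D : ℕ} (hDs : Squarefree D) (hDh : D.Coprime h) {a : ℕ → ℕ}
    (ha : ∀ D₁ ∈ D.divisors, ∀ n : ℕ, n % (h * D) = a D₁ % (h * D) ↔
      n % h = 1 % h ∧ D₁ ∣ n ∧ D / D₁ ∣ n + h) (S : Finset ℕ) (g : ℕ → ℝ) :
    (∑ n ∈ S, if n % h = 1 % h ∧ D ∣ n * (n + h) then g n else 0) =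
      ∑ D₁ ∈ D.divisors, ∑ n ∈ S, if n % (h * D) = a D₁ % (h * D) then g n else 0 := by
  rw [Finset.sum_comm]
  refine Finset.sum_congr rfl fun n _ => ?_
  have e : ∀ D₁ ∈ D.divisors, (if n % (h * D) = a D₁ % (h * D) then g n else 0) =
      if D₁ = D.gcd n then (if n % h = 1 % h ∧ D ∣ n * (n + h) then g n else 0) else 0 :=
    fun D₁ hD₁ => by
      have := ha D₁ hD₁ n
      rw [dvd_mul_add_iff_gcd hDs hDh (Nat.dvd_of_mem_divisors hD₁)] at this
      simp only [this]
      split_ifs <;> tauto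
  rw [Finset.sum_congr rfl e, Finset.sum_ite_eq',
    if_pos (Nat.mem_divisors.2 ⟨Nat.gcd_dvd_left D n, hDs.ne_zero⟩)]

/-- The combined discrepancy in residue classes modulo `q` of all the sequences in `HypD`. -/
noncomputable def levelError (h q M : ℕ) : ℝ :=
  primeMaxAbs q M + maxAbs lio q M + maxAbs (fun n => lio n * lio (n + h)) q M +
    maxAbs (fun n => theta n * lio (n + h)) q M +
    maxAbs (fun n => if h < n then theta n * lio (n - h) else 0) q M

/-- The discrepancies relevant for `[N, 2N)` and `[N + h, 2N + h)`. -/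
noncomputable def dyadicError (h q N : ℕ) : ℝ :=
  levelError h q (2 * N - 1) + levelError h q (N - 1) +
    levelError h q (2 * N + h - 1) + levelError h q (N + h - 1)

/-- A lower bound sieve for the indicator of `n`, `n + h` both prime. -/
noncomputable def twinDetector (h N n : ℕ) : ℝ :=
  theta n * (1 - lio (n + h)) / 2 + theta (n + h) * (1 - lio n) / 2 -
    Real.log (3 * N) * ((1 - lio n) * (1 - lio (n + h))) / 4

lemma levelError_nonneg (h q M : ℕ) : 0 ≤ levelError h q M := by
  have := primeMaxAbs_nonneg q M
  have := fun f => maxAbs_nonneg f q M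
  unfold levelError
  linarith [this lio, this (fun n => lio n * lio (n + h)), this (fun n => theta n * lio (n + h)),
    this (fun n => if h < n then theta n * lio (n - h) else 0)]

lemma dyadicError_nonneg (h q N : ℕ) : 0 ≤ dyadicError h q N := by
  unfold dyadicError
  linarith [levelError_nonneg h q (2 * N - 1), levelError_nonneg h q (N - 1),
    levelError_nonneg h q (2 * N + h - 1), levelError_nonneg h q (N + h - 1)]

lemma component_le_levelError (h q M : ℕ) :
    primeMaxAbs q M ≤ levelError h q M ∧ maxAbs lio q M ≤ levelError h q M ∧
    maxAbs (fun n => lio n * lio (n + h)) q M ≤ levelError h q M ∧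
    maxAbs (fun n => theta n * lio (n + h)) q M ≤ levelError h q M ∧
    maxAbs (fun n => if h < n then theta n * lio (n - h) else 0) q M ≤ levelError h q M := by
  have := primeMaxAbs_nonneg q M
  have h1 := fun f => maxAbs_nonneg f q M
  have a1 := h1 lio
  have a2 := h1 (fun n => lio n * lio (n + h))
  have a3 := h1 (fun n => theta n * lio (n + h))
  have a4 := h1 (fun n => if h < n then theta n * lio (n - h) else 0)
  unfold levelError
  refine ⟨?_, ?_, ?_, ?_, ?_⟩ <;> linarith

lemma abs_sum_class_le_dyadicError {f : ℕ → ℝ} {h q : ℕ}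
    (hf : ∀ M, maxAbs f q M ≤ levelError h q M) {N : ℕ} (hN : 0 < N) {s : ℕ}
    (hs : s = 0 ∨ s = h) (a : ℕ) :
    |∑ n ∈ Finset.Ico N (2 * N), if n % q = a % q then f (n + s) else 0| ≤
      dyadicError h q N := by
  refine (abs_sum_Ico_mod_shift_le f hN q s a).trans ?_
  unfold dyadicError
  have l := levelError_nonneg h q
  rcases hs with rfl | rfl
  · simp only [add_zero]
    linarith [hf (2 * N - 1), hf (N - 1), l (2 * N + h - 1), l (N + h - 1)]
  · linarith [hf (2 * N + s - 1), hf (N + s - 1), l (2 * N - 1), l (N - 1)]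

lemma abs_sum_theta_class_sub_le_dyadicError {h q : ℕ} (hq : 0 < q) {N : ℕ} (hN : 0 < N) {s : ℕ}
    (hs : s = 0 ∨ s = h) {a : ℕ} (ha : (a + s).Coprime q) :
    |(∑ n ∈ Finset.Ico N (2 * N), if n % q = a % q then theta (n + s) else 0) - N / q.totient| ≤
      dyadicError h q N := by
  refine (abs_sum_Ico_theta_mod_shift_le hN hq ha).trans ?_
  have hf := fun M => (component_le_levelError h q M).1
  unfold dyadicError
  have l := levelError_nonneg h q
  rcases hs with rfl | rfl
  · simp only [add_zero]
    linarith [hf (2 * N - 1), hf (N - 1), l (2 * N + h - 1), l (N + h - 1)]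
  · linarith [hf (2 * N + s - 1), hf (N + s - 1), l (2 * N - 1), l (N - 1)]

lemma abs_sum_dvd_le {f : ℕ → ℝ} {h D : ℕ} (hDs : Squarefree D) (hDh : D.Coprime h)
    (hf : ∀ M, maxAbs f (h * D) M ≤ levelError h (h * D) M) {N : ℕ} (hN : 0 < N) {s : ℕ}
    (hs : s = 0 ∨ s = h) :
    |∑ n ∈ Finset.Ico N (2 * N), if n % h = 1 % h ∧ D ∣ n * (n + h) then f (n + s) else 0| ≤
      primeProd (fun _ => 2) D * dyadicError h (h * D) N := by
  obtain ⟨a, ha⟩ := exists_classes hDs hDh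
  rw [sum_dvd_eq_sum_classes hDs hDh ha, ← card_divisors_eq_primeProd hDs, ← nsmul_eq_mul]
  exact (Finset.abs_sum_le_sum_abs _ _).trans (Finset.sum_le_card_nsmul _ _ _ fun D₁ _ =>
    abs_sum_class_le_dyadicError hf hN hs _)

lemma abs_card_dvd_sub_le {h D : ℕ} (hh : 0 < h) (hDs : Squarefree D) (hDh : D.Coprime h) (N : ℕ) :
    |(∑ n ∈ Finset.Ico N (2 * N), if n % h = 1 % h ∧ D ∣ n * (n + h) then (1 : ℝ) else 0) -
      primeProd (fun _ => 2) D * (N / (h * D : ℕ))| ≤ primeProd (fun _ => 2) D := by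
  obtain ⟨a, ha⟩ := exists_classes hDs hDh
  have hq : 0 < h * D := Nat.mul_pos hh (Nat.pos_of_ne_zero hDs.ne_zero)
  rw [sum_dvd_eq_sum_classes hDs hDh ha, ← card_divisors_eq_primeProd hDs, ← nsmul_eq_mul,
    ← Finset.sum_const, ← Finset.sum_sub_distrib]
  refine (Finset.abs_sum_le_sum_abs _ _).trans ((Finset.sum_le_card_nsmul _ _ 1 fun D₁ _ => ?_).trans
    (by simp))
  have := abs_card_Ico_filter_mod_sub_le (show N ≤ 2 * N by omega) hq (a D₁)
  rw [← Finset.sum_filter, Finset.sum_const, nsmul_eq_mul, mul_one]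
  rwa [show ((2 * N : ℕ) : ℝ) - N = N by push_cast; ring] at this

lemma prime_dvd_mul_add_iff {D N n : ℕ} (h : ℕ) (hD0 : 0 < D) (hDN : D < N) (hn : N ≤ n)
    (hp : n.Prime) : D ∣ n * (n + h) ↔ D ∣ n + h := by
  have hc : D.Coprime n :=
    (Nat.Coprime.symm ((Nat.Prime.coprime_iff_not_dvd hp).2 fun hd =>
      absurd (Nat.le_of_dvd hD0 hd) (by omega)))
  exact ⟨fun hd => hc.dvd_of_dvd_mul_left hd, fun hd => Dvd.dvd.mul_left hd n⟩

lemma prime_add_dvd_mul_add_iff {D N n : ℕ} (h : ℕ) (hD0 : 0 < D) (hDN : D < N) (hn : N ≤ n)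
    (hp : (n + h).Prime) : D ∣ n * (n + h) ↔ D ∣ n := by
  have hc : D.Coprime (n + h) :=
    (Nat.Coprime.symm ((Nat.Prime.coprime_iff_not_dvd hp).2 fun hd =>
      absurd (Nat.le_of_dvd hD0 hd) (by omega)))
  exact ⟨fun hd => hc.dvd_of_dvd_mul_right hd, fun hd => Dvd.dvd.mul_right hd (n + h)⟩

section SieveSum

variable {h D N : ℕ}

lemma exists_class_theta (hDs : Squarefree D) (hDh : D.Coprime h) (hDN : D < N) :
    ∃ a : ℕ, a.Coprime (h * D) ∧ ∀ g : ℕ → ℝ,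
      (∑ n ∈ Finset.Ico N (2 * N),
        if n % h = 1 % h ∧ D ∣ n * (n + h) then theta n * g n else 0) =
      ∑ n ∈ Finset.Ico N (2 * N), if n % (h * D) = a % (h * D) then theta n * g n else 0 := by
  have hD0 : 0 < D := Nat.pos_of_ne_zero hDs.ne_zero
  obtain ⟨a, ha⟩ := exists_class (D₁ := 1) hD0 (Nat.coprime_one_left D)
    (Nat.coprime_one_left h) hDh
  simp only [one_mul, one_dvd, true_and] at ha
  obtain ⟨ha1, ha2⟩ := (ha a).1 rfl
  refine ⟨a, coprime_of_mod_eq_one_of_dvd_add ha1 (h := h) (D := D) ha2, fun g => ?_⟩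
  refine Finset.sum_congr rfl fun n hn => ?_
  by_cases hp : n.Prime
  · exact if_congr (by rw [ha, prime_dvd_mul_add_iff h hD0 hDN (Finset.mem_Ico.1 hn).1 hp]) rfl rfl
  · simp [theta, hp]

lemma exists_class_theta_add (hDs : Squarefree D) (hDh : D.Coprime h) (hDN : D < N) :
    ∃ a : ℕ, (a + h).Coprime (h * D) ∧ ∀ g : ℕ → ℝ,
      (∑ n ∈ Finset.Ico N (2 * N),
        if n % h = 1 % h ∧ D ∣ n * (n + h) then theta (n + h) * g n else 0) =
      ∑ n ∈ Finset.Ico N (2 * N), if n % (h * D) = a % (h * D) then theta (n + h) * g n else 0 := by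
  have hD0 : 0 < D := Nat.pos_of_ne_zero hDs.ne_zero
  obtain ⟨a, ha⟩ := exists_class (D₂ := 1) one_pos (Nat.coprime_one_right D) hDh
    (Nat.coprime_one_left h)
  simp only [mul_one, one_dvd, and_true] at ha
  obtain ⟨ha1, ha2⟩ := (ha a).1 rfl
  refine ⟨a, coprime_add_of_mod_eq_one_of_dvd hDh ha1 ha2, fun g => ?_⟩
  refine Finset.sum_congr rfl fun n hn => ?_
  by_cases hp : (n + h).Prime
  · exact if_congr (by rw [ha, prime_add_dvd_mul_add_iff h hD0 hDN (Finset.mem_Ico.1 hn).1 hp])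
      rfl rfl
  · simp [theta, hp]

lemma abs_sum_twinDetector_sub_le (hh : 0 < h) (hDs : Squarefree D) (hDh : D.Coprime h)
    (hDN : D < N) :
    |(∑ n ∈ Finset.Ico N (2 * N),
        if n % h = 1 % h ∧ D ∣ n * (n + h) then twinDetector h N n else 0) -
      (N / (h * D).totient - Real.log (3 * N) / 4 *
        (primeProd (fun _ => 2) D * (N / (h * D : ℕ))))| ≤
      primeProd (fun _ => 2) D * ((2 + Real.log (3 * N)) * (1 + dyadicError h (h * D) N)) := by
  have hN : 0 < N := by omega
  have hq : 0 < h * D := Nat.mul_pos hh (Nat.pos_of_ne_zero hDs.ne_zero)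
  set W := primeProd (fun _ => (2 : ℝ)) D with hW
  set E := dyadicError h (h * D) N with hE
  set l := Real.log (3 * N) with hl
  have hW1 : 1 ≤ W := by
    rw [hW, ← card_divisors_eq_primeProd hDs]
    exact_mod_cast Finset.card_pos.2 ⟨1, Nat.one_mem_divisors.2 hDs.ne_zero⟩
  have hE0 : 0 ≤ E := dyadicError_nonneg _ _ _
  have hl0 : 0 ≤ l := by
    have : (1 : ℝ) ≤ N := by exact_mod_cast hN
    exact Real.log_nonneg (by linarith)
  let P : ℕ → Prop := fun n => n % h = 1 % h ∧ D ∣ n * (n + h)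
  let S : (ℕ → ℝ) → ℝ := fun g => ∑ n ∈ Finset.Ico N (2 * N),
    if n % h = 1 % h ∧ D ∣ n * (n + h) then g n else 0
  have hdec : S (twinDetector h N) =
      S (fun n => theta n * 1) / 2 - S (fun n => theta n * lio (n + h)) / 2 +
      (S (fun n => theta (n + h) * 1) / 2 - S (fun n => theta (n + h) * lio n) / 2) -
      l / 4 * (S (fun _ => 1) - S (fun n => lio (n + 0)) - S (fun n => lio (n + h)) +
        S (fun n => lio n * lio (n + h))) := by
    simp only [S, Finset.sum_div, ← Finset.sum_sub_distrib, ← Finset.sum_add_distrib,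
      Finset.mul_sum]
    refine Finset.sum_congr rfl fun n _ => ?_
    split_ifs
    · unfold twinDetector; rw [add_zero]; ring
    · ring
  obtain ⟨c1, c2, c3, c4, c5⟩ : _ ∧ _ ∧ _ ∧ _ ∧ _ := ⟨fun M => (component_le_levelError h (h * D) M).1,
    fun M => (component_le_levelError h (h * D) M).2.1,
    fun M => (component_le_levelError h (h * D) M).2.2.1,
    fun M => (component_le_levelError h (h * D) M).2.2.2.1,
    fun M => (component_le_levelError h (h * D) M).2.2.2.2⟩
  obtain ⟨a, ha, hSa⟩ := exists_class_theta hDs hDh hDN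
  obtain ⟨b, hb, hSb⟩ := exists_class_theta_add hDs hDh hDN
  have t1 : |S (fun n => theta n * 1) - N / (h * D).totient| ≤ E := by
    have := abs_sum_theta_class_sub_le_dyadicError (h := h) hq hN (Or.inl rfl) (s := 0) ha
    simp only [S]; rw [hSa (fun _ => 1)]; simp only [mul_one]
    exact this
  have t2 : |S (fun n => theta n * lio (n + h))| ≤ E := by
    simp only [S, hSa (fun n => lio (n + h))]
    exact abs_sum_class_le_dyadicError c4 hN (s := 0) (Or.inl rfl) a
  have t3 : |S (fun n => theta (n + h) * 1) - N / (h * D).totient| ≤ E := by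
    have := abs_sum_theta_class_sub_le_dyadicError (h := h) hq hN (Or.inr rfl) (s := h) hb
    simp only [S]; rw [hSb (fun _ => 1)]; simp only [mul_one]
    exact this
  have t4 : |S (fun n => theta (n + h) * lio n)| ≤ E := by
    simp only [S, hSb lio]
    refine le_of_eq_of_le (congrArg _ (Finset.sum_congr rfl fun n hn => ?_))
      (abs_sum_class_le_dyadicError c5 hN (s := h) (Or.inr rfl) b)
    have hn0 : 0 < n := hN.trans_le (Finset.mem_Ico.1 hn).1
    simp only [if_pos (show h < n + h by omega), Nat.add_sub_cancel]
  have t5 := abs_card_dvd_sub_le hh hDs hDh N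
  have t6 : |S (fun n => lio (n + 0))| ≤ W * E := abs_sum_dvd_le hDs hDh c2 hN (Or.inl rfl)
  have t7 : |S (fun n => lio (n + h))| ≤ W * E := abs_sum_dvd_le hDs hDh c2 hN (Or.inr rfl)
  have t8 : |S (fun n => lio n * lio (n + h))| ≤ W * E :=
    abs_sum_dvd_le hDs hDh c3 hN (s := 0) (Or.inl rfl)
  change |S (fun _ => 1) - _| ≤ W at t5
  change |S (twinDetector h N) - _| ≤ _
  have hEW : E ≤ W * E := le_mul_of_one_le_left hE0 hW1
  rw [hdec]
  set V := W * (N / (h * D : ℕ))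
  have u1 : |(S (fun _ => 1) - V) - S (fun n => lio (n + 0)) - S (fun n => lio (n + h)) +
      S (fun n => lio n * lio (n + h))| ≤ W + 3 * (W * E) := by
    rw [abs_le] at t5 t6 t7 t8 ⊢
    constructor <;> linarith
  have u2 : |l / 4 * ((S (fun _ => 1) - V) - S (fun n => lio (n + 0)) - S (fun n => lio (n + h)) +
      S (fun n => lio n * lio (n + h)))| ≤ l / 4 * (W + 3 * (W * E)) := by
    rw [abs_mul, abs_of_nonneg (by positivity : 0 ≤ l / 4)]
    exact mul_le_mul_of_nonneg_left u1 (by positivity)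
  have hlW : 0 ≤ l * W := by positivity
  have hlWE : 0 ≤ l * (W * E) := by positivity
  rw [abs_le] at t1 t2 t3 t4 u2 ⊢
  constructor <;> nlinarith

end SieveSum

lemma abs_lio (n : ℕ) : |lio n| = 1 := by simp [lio, abs_pow]

lemma theta_nonneg (n : ℕ) : 0 ≤ theta n := by
  unfold theta
  split_ifs
  · exact Real.log_natCast_nonneg n
  · exact le_rfl

lemma theta_le_log {n M : ℕ} (hn : 1 ≤ n) (hM : n ≤ M) : theta n ≤ Real.log M := by
  have h1 : Real.log n ≤ Real.log M :=
    Real.log_le_log (by exact_mod_cast hn) (by exact_mod_cast hM)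
  unfold theta
  split_ifs
  · exact h1
  · exact Real.log_natCast_nonneg M

lemma inv_totient_le {D : ℕ} (hD : Squarefree D) :
    (1 : ℝ) / D.totient ≤ primeProd (fun _ => 2) D / D := by
  have hD0 : (0 : ℝ) < D := by exact_mod_cast Nat.pos_of_ne_zero hD.ne_zero
  have hφ0 : (0 : ℝ) < D.totient := by
    exact_mod_cast Nat.totient_pos.2 (Nat.pos_of_ne_zero hD.ne_zero)
  rw [div_le_div_iff₀ hφ0 hD0, one_mul, totient_eq_primeProd hD, ← primeProd_mul_fun,
    ← primeProd_natCast hD]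
  refine primeProd_le fun p hp _ => ⟨Nat.cast_nonneg p, ?_⟩
  have : (2 : ℝ) ≤ p := by exact_mod_cast hp.two_le
  linarith

lemma levelError_le {h D M : ℕ} (hh : 0 < h) (hD : Squarefree D) (hM : 1 ≤ Real.log M)
    (hDM : h * D ≤ M) :
    levelError h (h * D) M ≤ 11 * Real.log M * M * (primeProd (fun _ => 2) D / D) := by
  have hD0 : 0 < D := Nat.pos_of_ne_zero hD.ne_zero
  have hq : 0 < h * D := Nat.mul_pos hh hD0
  have hD0' : (0 : ℝ) < D := by exact_mod_cast hD0
  have hq' : (0 : ℝ) < (h * D : ℕ) := by exact_mod_cast hq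
  have hM0 : (0 : ℝ) ≤ M := Nat.cast_nonneg M
  set L := Real.log M
  have a1 := primeMaxAbs_le hq M
  have a2 := maxAbs_le (f := lio) (b := 1) zero_le_one hq (M := M) fun n _ => (abs_lio n).le
  have a3 := maxAbs_le (f := fun n => lio n * lio (n + h)) (b := 1) zero_le_one hq (M := M)
    fun n _ => by rw [abs_mul, abs_lio, abs_lio, one_mul]
  have a4 := maxAbs_le (f := fun n => theta n * lio (n + h)) (b := L) (by linarith) hq (M := M)
    fun n hn => by
      rw [abs_mul, abs_lio, mul_one, abs_of_nonneg (theta_nonneg n)]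
      exact theta_le_log (Finset.mem_Icc.1 hn).1 (Finset.mem_Icc.1 hn).2
  have a5 := maxAbs_le (f := fun n => if h < n then theta n * lio (n - h) else 0) (b := L)
    (by linarith) hq (M := M) fun n hn => by
      split_ifs
      · rw [abs_mul, abs_lio, mul_one, abs_of_nonneg (theta_nonneg n)]
        exact theta_le_log (Finset.mem_Icc.1 hn).1 (Finset.mem_Icc.1 hn).2
      · rw [abs_zero]; linarith
  have hx : (M : ℝ) / (h * D : ℕ) + 1 ≤ 2 * (M / D) := by
    have h1 : (1 : ℝ) ≤ M / (h * D : ℕ) := by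
      rw [one_le_div hq']; exact_mod_cast hDM
    have h2 : (M : ℝ) / (h * D : ℕ) ≤ M / D :=
      div_le_div_of_nonneg_left hM0 hD0' (by exact_mod_cast Nat.le_mul_of_pos_left D hh)
    linarith
  have hφ : (M : ℝ) / (h * D).totient ≤ M * (primeProd (fun _ => 2) D / D) := by
    have h1 : D.totient ≤ (h * D).totient :=
      Nat.le_of_dvd (Nat.totient_pos.2 hq) (Nat.totient_dvd_of_dvd (Dvd.intro_left h rfl))
    have h2 : (0 : ℝ) < D.totient := by exact_mod_cast Nat.totient_pos.2 hD0
    calc (M : ℝ) / (h * D).totient ≤ M / D.totient :=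
          div_le_div_of_nonneg_left hM0 h2 (by exact_mod_cast h1)
      _ = M * (1 / D.totient) := by ring
      _ ≤ _ := mul_le_mul_of_nonneg_left (inv_totient_le hD) hM0
  have hW : (1 : ℝ) ≤ primeProd (fun _ => 2) D := by
    simp only [primeProd, Finset.prod_const]
    exact one_le_pow₀ one_le_two
  set y : ℝ := M / D
  have hy : 0 ≤ y := by positivity
  have e : (M : ℝ) * (primeProd (fun _ => 2) D / D) = primeProd (fun _ => 2) D * y := by
    simp only [y]; ring
  have hLy := mul_le_mul_of_nonneg_left hx (by linarith : 0 ≤ L)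
  have hyW : y ≤ primeProd (fun _ => 2) D * y := le_mul_of_one_le_left hy hW
  have hz : 0 ≤ primeProd (fun _ => 2) D * y := hy.trans hyW
  have s1 : L * y ≤ L * (primeProd (fun _ => 2) D * y) :=
    mul_le_mul_of_nonneg_left hyW (by linarith)
  have s2 : primeProd (fun _ => 2) D * y ≤ L * (primeProd (fun _ => 2) D * y) :=
    le_mul_of_one_le_left hz hM
  have e2 : 11 * L * M * (primeProd (fun _ => 2) D / D) =
      11 * (L * (primeProd (fun _ => 2) D * y)) := by
    rw [← e]; ring
  rw [e] at hφ
  rw [e2]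
  unfold levelError
  nlinarith

lemma exists_sum_levelError_le {ϑ θ' : ℝ} {h : ℕ} (hD : HypD ϑ h) (hθ : θ' < ϑ) {A : ℕ}
    (hA : 0 < A) : ∃ C > 0, ∀ M : ℕ, 2 ≤ M →
      ∑ q ∈ Finset.Icc 1 ⌊(M : ℝ) ^ θ'⌋₊, levelError h q M ≤ C * M / Real.log M ^ A := by
  obtain ⟨h1, h2, h3, h4, h5⟩ := hD
  have hA' : (0 : ℝ) < A := by exact_mod_cast hA
  obtain ⟨C1, p1, H1⟩ := h1 (ϑ - θ') (by linarith) A hA'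
  obtain ⟨C2, p2, H2⟩ := h2 (ϑ - θ') (by linarith) A hA'
  obtain ⟨C3, p3, H3⟩ := h3 (ϑ - θ') (by linarith) A hA'
  obtain ⟨C4, p4, H4⟩ := h4 (ϑ - θ') (by linarith) A hA'
  obtain ⟨C5, p5, H5⟩ := h5 (ϑ - θ') (by linarith) A hA'
  refine ⟨C1 + C2 + C3 + C4 + C5, by positivity, fun M hM => ?_⟩
  have b1 := H1 M hM
  have b2 := H2 M hM
  have b3 := H3 M hM
  have b4 := H4 M hM
  have b5 := H5 M hM
  rw [sub_sub_cancel, Real.rpow_natCast] at b1 b2 b3 b4 b5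
  simp only [levelError, Finset.sum_add_distrib]
  refine (add_le_add (add_le_add (add_le_add (add_le_add b1 b2) b3) b4) b5).trans_eq ?_
  ring

lemma exists_sum_primeProd_mul_levelError_le {ϑ θ' : ℝ} {h : ℕ} (hh : 0 < h) (hD : HypD ϑ h)
    (hθ : θ' < ϑ) (hθ1 : θ' ≤ 1) (K B : ℕ) : ∃ C > 0, ∀ M : ℕ, 1 ≤ Real.log M → ∀ X : ℕ,
      ((h * X : ℕ) : ℝ) ≤ (M : ℝ) ^ θ' →
      ∑ D ∈ (Finset.Icc 1 X).filter Squarefree,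
        primeProd (fun _ => (K : ℝ)) D * levelError h (h * D) M ≤ C * M / Real.log M ^ B := by
  set G := 2 * K ^ 2 with hG
  set J := G + 1 + B with hJ
  obtain ⟨C0, hC0, H⟩ := exists_sum_levelError_le hD hθ (A := J + B) (by omega)
  refine ⟨C0 + 11 * 2 ^ G, by positivity, fun M hM X hX => ?_⟩
  set L := Real.log M with hL
  have hL0 : 0 < L := by linarith
  have hM1 : 1 ≤ M := by
    rcases Nat.eq_zero_or_pos M with h0 | h0
    · rw [hL, h0] at hM; norm_num at hM
    · exact h0
  have hM2 : 2 ≤ M := by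
    rcases Nat.lt_or_ge M 2 with h0 | h0
    · obtain rfl : M = 1 := by omega
      rw [hL] at hM; norm_num at hM
    · exact h0
  have hM1' : (1 : ℝ) ≤ M := by exact_mod_cast hM1
  have hXM : h * X ≤ M := by
    have : ((h * X : ℕ) : ℝ) ≤ (M : ℝ) := hX.trans (Real.rpow_le_self_of_one_le hM1' hθ1)
    exact_mod_cast this
  have hXM' : X ≤ M := (Nat.le_mul_of_pos_left X hh).trans hXM
  set S := (Finset.Icc 1 X).filter Squarefree with hS
  have hSX : ∀ D ∈ S, 1 ≤ D ∧ D ≤ X ∧ Squarefree D := fun D hD => by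
    obtain ⟨h1, h2⟩ := Finset.mem_filter.1 hD
    exact ⟨(Finset.mem_Icc.1 h1).1, (Finset.mem_Icc.1 h1).2, h2⟩
  set P := L ^ J with hP
  have hP0 : 0 < P := by positivity
  have s1 : ∑ D ∈ S, levelError h (h * D) M ≤ C0 * M / L ^ (J + B) := by
    refine le_trans ?_ (H M hM2)
    have hinj : Set.InjOn (fun D => h * D) (S : Set ℕ) := fun a _ b _ hab =>
      Nat.eq_of_mul_eq_mul_left hh hab
    rw [← Finset.sum_image (f := fun q => levelError h q M) hinj]
    refine Finset.sum_le_sum_of_subset_of_nonneg ?_ fun q _ _ => levelError_nonneg h q M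
    intro q hq
    obtain ⟨D, hD, rfl⟩ := Finset.mem_image.1 hq
    obtain ⟨d1, d2, -⟩ := hSX D hD
    refine Finset.mem_Icc.2 ⟨Nat.mul_pos hh d1, Nat.le_floor (le_trans ?_ hX)⟩
    exact_mod_cast Nat.mul_le_mul_left h d2
  have s2 : ∑ D ∈ S, primeProd (fun _ => ((G : ℕ) : ℝ)) D / D ≤ 2 ^ G * L ^ G := by
    refine (sum_squarefree_primeProd_const_div_le G X).trans ?_
    rw [← mul_pow]
    have hX0 := Real.log_natCast_nonneg X
    have : Real.log X ≤ L := by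
      rcases Nat.eq_zero_or_pos X with h0 | h0
      · rw [h0]; simpa using hL0.le
      · exact Real.log_le_log (by exact_mod_cast h0) (by exact_mod_cast hXM')
    exact pow_le_pow_left₀ (by linarith) (by linarith) G
  have key : ∀ D ∈ S, primeProd (fun _ => (K : ℝ)) D * levelError h (h * D) M ≤
      P * levelError h (h * D) M +
        11 * L * M / P * (primeProd (fun _ => ((G : ℕ) : ℝ)) D / D) := fun D hD => by
    obtain ⟨d1, d2, d3⟩ := hSX D hD
    have hE0 := levelError_nonneg h (h * D) M
    have hE := levelError_le hh d3 hM ((Nat.mul_le_mul_left h d2).trans hXM)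
    set k := primeProd (fun _ => (K : ℝ)) D
    have hk : primeProd (fun _ => ((G : ℕ) : ℝ)) D = k ^ 2 * primeProd (fun _ => 2) D := by
      rw [pow_two, ← primeProd_mul_fun, ← primeProd_mul_fun]
      exact primeProd_congr fun _ _ _ => by rw [hG]; push_cast; ring
    have h1 : k ≤ P + k ^ 2 / P := by
      rw [← sub_le_iff_le_add', le_div_iff₀ hP0]
      nlinarith [sq_nonneg (k - P), sq_nonneg k, sq_nonneg P]
    calc k * levelError h (h * D) M ≤ (P + k ^ 2 / P) * levelError h (h * D) M :=
          mul_le_mul_of_nonneg_right h1 hE0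
      _ = P * levelError h (h * D) M + k ^ 2 / P * levelError h (h * D) M := by ring
      _ ≤ P * levelError h (h * D) M + k ^ 2 / P *
          (11 * L * M * (primeProd (fun _ => 2) D / D)) := by gcongr
      _ = _ := by rw [hk]; ring
  refine (Finset.sum_le_sum key).trans ?_
  rw [Finset.sum_add_distrib, ← Finset.mul_sum, ← Finset.mul_sum]
  calc _ ≤ P * (C0 * M / L ^ (J + B)) + 11 * L * M / P * (2 ^ G * L ^ G) := by gcongr
    _ = (C0 + 11 * 2 ^ G) * M / L ^ B := by
      rw [hP, hJ, pow_add, pow_add L (G + 1 + B) B, pow_add L (G + 1), pow_succ]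
      field_simp

lemma lio_prime {p : ℕ} (hp : p.Prime) : lio p = -1 := by
  simp [lio, Nat.primeFactorsList_prime hp]

lemma lio_eq_one_or (n : ℕ) : lio n = 1 ∨ lio n = -1 := neg_one_pow_eq_or ℝ _

lemma twinDetector_le {h N n : ℕ} (hh : h ≤ N) (h1 : N ≤ n) (h2 : n < 2 * N) :
    twinDetector h N n ≤ if n.Prime ∧ (n + h).Prime then Real.log (3 * N) else 0 := by
  have ht : ∀ m, 1 ≤ m → m ≤ 3 * N → theta m ≤ Real.log (3 * N) := fun m hm1 hm2 => by
    have := theta_le_log hm1 hm2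
    push_cast at this
    exact this
  have hn := ht n (by omega) (by omega)
  have hnh := ht (n + h) (by omega) (by omega)
  have hn0 := theta_nonneg n
  have hz : ∀ m, ¬ m.Prime → theta m = 0 := fun m hm => if_neg hm
  have hone : ∀ m, lio m = 1 → ¬ m.Prime := fun m hm hp => by
    rw [lio_prime hp] at hm; norm_num at hm
  unfold twinDetector
  rcases lio_eq_one_or n with e1 | e1 <;> rcases lio_eq_one_or (n + h) with e2 | e2
  · rw [if_neg fun hp => hone n e1 hp.1, e1, e2]
    norm_num
  · rw [if_neg fun hp => hone n e1 hp.1, e1, e2, hz n (hone n e1)]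
    norm_num
  · rw [if_neg fun hp => hone _ e2 hp.2, e1, e2, hz _ (hone _ e2)]
    norm_num
  · rw [e1, e2]
    by_cases p1 : n.Prime <;> by_cases p2 : (n + h).Prime
    · rw [if_pos ⟨p1, p2⟩]; linarith
    · rw [if_neg fun hp => p2 hp.2, hz _ p2]; linarith
    · rw [if_neg fun hp => p1 hp.1, hz _ p1]; linarith
    · rw [if_neg fun hp => p1 hp.1, hz _ p1, hz _ p2]; linarith

lemma eq_one_of_dvd_prime_mul_prime {d n m : ℕ} (hd0 : 0 < d) (hdn : d < n) (hdm : d < m)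
    (hn : n.Prime) (hm : m.Prime) (hd : d ∣ n * m) : d = 1 := by
  have c1 : d.Coprime n := Nat.Coprime.symm ((Nat.Prime.coprime_iff_not_dvd hn).2 fun h =>
    absurd (Nat.le_of_dvd hd0 h) (by omega))
  exact ((Nat.dvd_prime hm).1 (c1.dvd_of_dvd_mul_left hd)).resolve_right hdm.ne

/-- The sieve sum of the twin detector against the squared divisor sum of weights `w`. -/
noncomputable def sieveSum (h N : ℕ) (S : Finset ℕ) (w : ℕ → ℝ) : ℝ :=
  ∑ n ∈ Finset.Ico N (2 * N), if n % h = 1 % h then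
    twinDetector h N n * (∑ d ∈ S, if d ∣ n * (n + h) then w d else 0) ^ 2 else 0

lemma sieveSum_le {h N : ℕ} (hN : 0 < N) (hh : h ≤ N) {S : Finset ℕ} (h1 : 1 ∈ S)
    (hS : ∀ d ∈ S, 0 < d ∧ d < N) (w : ℕ → ℝ) :
    sieveSum h N S w ≤
      (((Finset.Ico N (2 * N)).filter fun n => n.Prime ∧ (n + h).Prime).card : ℝ) *
        Real.log (3 * N) * w 1 ^ 2 := by
  have hl : 0 ≤ Real.log (3 * N) := by
    have : (1 : ℝ) ≤ N := by exact_mod_cast hN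
    exact Real.log_nonneg (by linarith)
  rw [mul_assoc, ← nsmul_eq_mul, ← Finset.sum_const, Finset.sum_filter]
  refine Finset.sum_le_sum fun n hn => ?_
  obtain ⟨n1, n2⟩ := Finset.mem_Ico.1 hn
  have ht := twinDetector_le hh n1 n2
  have hR : (0 : ℝ) ≤ if n.Prime ∧ (n + h).Prime then Real.log (3 * N) * w 1 ^ 2 else 0 := by
    split_ifs <;> positivity
  by_cases hc : n % h = 1 % h
  swap
  · rw [if_neg hc]; exact hR
  rw [if_pos hc]
  refine (mul_le_mul_of_nonneg_right ht (sq_nonneg _)).trans (le_of_eq ?_)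
  by_cases hp : n.Prime ∧ (n + h).Prime
  · rw [if_pos hp, if_pos hp]
    congr 2
    have e : ∀ d ∈ S, (if d ∣ n * (n + h) then w d else 0) = if d = 1 then w d else 0 :=
      fun d hd => by
        obtain ⟨d0, dN⟩ := hS d hd
        refine if_congr ⟨fun hdn => ?_, fun hd1 => hd1 ▸ one_dvd _⟩ rfl rfl
        exact eq_one_of_dvd_prime_mul_prime d0 (by omega) (by omega) hp.1 hp.2 hdn
    rw [Finset.sum_congr rfl e, Finset.sum_ite_eq', if_pos h1]
  · rw [if_neg hp, if_neg hp, zero_mul]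

lemma sieveSum_eq (h N : ℕ) (S : Finset ℕ) (w : ℕ → ℝ) :
    sieveSum h N S w = ∑ d ∈ S, ∑ e ∈ S, w d * w e * ∑ n ∈ Finset.Ico N (2 * N),
      if n % h = 1 % h ∧ d.lcm e ∣ n * (n + h) then twinDetector h N n else 0 := by
  have e1 : ∀ d ∈ S, (∑ e ∈ S, w d * w e * ∑ n ∈ Finset.Ico N (2 * N),
      if n % h = 1 % h ∧ d.lcm e ∣ n * (n + h) then twinDetector h N n else 0) =
      ∑ n ∈ Finset.Ico N (2 * N), ∑ e ∈ S, w d * w e *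
      if n % h = 1 % h ∧ d.lcm e ∣ n * (n + h) then twinDetector h N n else 0 := fun d _ => by
    rw [Finset.sum_comm]
    exact Finset.sum_congr rfl fun e _ => Finset.mul_sum _ _ _
  rw [Finset.sum_congr rfl e1, Finset.sum_comm, sieveSum]
  refine Finset.sum_congr rfl fun n _ => ?_
  split_ifs with hc
  · rw [pow_two, Finset.sum_mul_sum, Finset.mul_sum]
    refine Finset.sum_congr rfl fun d _ => ?_
    rw [Finset.mul_sum]
    refine Finset.sum_congr rfl fun e _ => ?_
    simp only [Nat.lcm_dvd_iff]
    split_ifs <;> first | (exfalso; tauto) | ring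
  · symm
    refine Finset.sum_eq_zero fun d _ => Finset.sum_eq_zero fun e _ => ?_
    rw [if_neg fun hx => hc hx.1, mul_zero]

lemma le_sieveSum {h N : ℕ} (h2 : 2 ∣ h) (hh : 0 < h) {c R : ℝ} (hc : 0 ≤ c) (hR : 1 < R)
    (hRN : R ^ 2 < N) :
    N * ((1 / (h.totient : ℝ)) * (∑ d ∈ sieveSet h R, ∑ e ∈ sieveSet h R,
        sieveWeight h c R d * sieveWeight h c R e *
          primeProd (fun p => 1 / ((p : ℝ) - 1)) (d.lcm e)) -
      Real.log (3 * N) / (4 * h) * (∑ d ∈ sieveSet h R, ∑ e ∈ sieveSet h R,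
        sieveWeight h c R d * sieveWeight h c R e *
          primeProd (fun p => 2 / (p : ℝ)) (d.lcm e))) -
      ((1 + c) * (1 + Real.log R) ^ 6) ^ 2 * (2 + Real.log (3 * N)) *
        (∑ D ∈ sieveSet h (R ^ 2), primeProd (fun _ => ((72 : ℕ) : ℝ)) D *
          (1 + dyadicError h (h * D) N)) ≤
      sieveSum h N (sieveSet h R) (sieveWeight h c R) := by
  have hR0 : 0 ≤ R := by linarith
  set w := sieveWeight h c R
  set S := sieveSet h R
  set l := Real.log (3 * N) with hl
  have hl0 : 0 ≤ l := by
    have : (1 : ℝ) ≤ N := by nlinarith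
    exact Real.log_nonneg (by linarith)
  have hLR : 0 ≤ Real.log R := Real.log_nonneg hR.le
  set W := (1 + c) * (1 + Real.log R) ^ 6 with hW
  have hW0 : 0 ≤ W := by positivity
  let f : ℕ → ℝ := fun D => primeProd (fun _ => 18) D * (1 + dyadicError h (h * D) N)
  have hf : ∀ D, 0 ≤ f D := fun D => mul_nonneg (primeProd_nonneg fun _ _ _ => by norm_num)
    (by linarith [dyadicError_nonneg h (h * D) N])
  have key : ∀ d ∈ S, ∀ e ∈ S,
      N * ((1 / (h.totient : ℝ)) * (w d * w e * primeProd (fun p => 1 / ((p : ℝ) - 1)) (d.lcm e)) -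
        l / (4 * h) * (w d * w e * primeProd (fun p => 2 / (p : ℝ)) (d.lcm e))) -
        W ^ 2 * (2 + l) * f (d.lcm e) ≤
      w d * w e * ∑ n ∈ Finset.Ico N (2 * N),
        if n % h = 1 % h ∧ d.lcm e ∣ n * (n + h) then twinDetector h N n else 0 :=
    fun d hd e he => by
    have hmem := lcm_mem_sieveSet hR0 hd he
    set D := d.lcm e with hDdef
    obtain ⟨⟨hD1, hDR⟩, hDs, hDh⟩ := mem_sieveSet.1 hmem
    have hD0 : D ≠ 0 := by omega
    have hDN : D < N := by
      have : (D : ℝ) < N := ((Nat.le_floor_iff (by positivity)).1 hDR).trans_lt hRN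
      exact_mod_cast this
    have hb := abs_sum_twinDetector_sub_le hh hDs hDh hDN
    set A := ∑ n ∈ Finset.Ico N (2 * N),
        if n % h = 1 % h ∧ D ∣ n * (n + h) then twinDetector h N n else 0
    have m1 : (N : ℝ) / (h * D).totient =
        N * ((1 / (h.totient : ℝ)) * primeProd (fun p => 1 / ((p : ℝ) - 1)) D) := by
      simp only [one_div]
      rw [Nat.totient_mul hDh.symm, Nat.cast_mul, totient_eq_primeProd hDs, primeProd_inv_fun,
        div_eq_mul_inv, mul_inv]
    have m2 : l / 4 * (primeProd (fun _ => 2) D * (N / (h * D : ℕ))) =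
        N * (l / (4 * h) * primeProd (fun p => 2 / (p : ℝ)) D) := by
      simp only [div_eq_mul_inv]
      rw [primeProd_mul_fun, primeProd_inv_fun, primeProd_natCast hDs, Nat.cast_mul, mul_inv,
        mul_inv]
      ring
    rw [m1, m2] at hb
    set E := dyadicError h (h * D) N
    have hE : 0 ≤ E := dyadicError_nonneg _ _ _
    have hwd := abs_sieveWeight_le h2 hc hR hd
    have hwe := abs_sieveWeight_le h2 hc hR he
    have p3 : ∀ m, 0 ≤ primeProd (fun _ => (3 : ℝ)) m := fun m =>
      primeProd_nonneg fun _ _ _ => by norm_num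
    have hww : |w d * w e| ≤ W ^ 2 * (primeProd (fun _ => 3) D * primeProd (fun _ => 3) D) := by
      rw [abs_mul]
      calc |w d| * |w e| ≤ (W * primeProd (fun _ => 3) d) * (W * primeProd (fun _ => 3) e) :=
            mul_le_mul hwd hwe (abs_nonneg _) (mul_nonneg hW0 (p3 d))
        _ ≤ (W * primeProd (fun _ => 3) D) * (W * primeProd (fun _ => 3) D) := by
            have a1 := primeProd_const_le_of_dvd (K := 3) (by norm_num) (Nat.dvd_lcm_left d e) hD0
            have a2 := primeProd_const_le_of_dvd (K := 3) (by norm_num) (Nat.dvd_lcm_right d e) hD0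
            exact mul_le_mul (mul_le_mul_of_nonneg_left a1 hW0)
              (mul_le_mul_of_nonneg_left a2 hW0) (mul_nonneg hW0 (p3 e)) (mul_nonneg hW0 (p3 D))
        _ = _ := by ring
    have h18 : f D = primeProd (fun _ => 3) D * primeProd (fun _ => 3) D *
        (primeProd (fun _ => 2) D * (1 + E)) := by
      simp only [f]
      rw [primeProd_congr (c := fun _ => (18 : ℝ)) (c' := fun _ => 3 * 3 * 2)
        fun _ _ _ => by norm_num, primeProd_mul_fun, primeProd_mul_fun]
      ring
    have p2 : 0 ≤ primeProd (fun _ => (2 : ℝ)) D := primeProd_nonneg fun _ _ _ => by norm_num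
    have hfin : |w d * w e| * |A - (N * (1 / (h.totient : ℝ) *
        primeProd (fun p => 1 / ((p : ℝ) - 1)) D) -
        N * (l / (4 * h) * primeProd (fun p => 2 / (p : ℝ)) D))| ≤ W ^ 2 * (2 + l) * f D := by
      refine (mul_le_mul hww hb (abs_nonneg _) (mul_nonneg (sq_nonneg W)
        (mul_nonneg (p3 D) (p3 D)))).trans_eq ?_
      rw [h18]; ring
    rw [← abs_mul] at hfin
    have := (abs_le.1 hfin).1
    linarith
  have hsum := Finset.sum_le_sum fun d hd => Finset.sum_le_sum fun e he => key d hd e he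
  rw [← sieveSum_eq] at hsum
  refine le_trans ?_ hsum
  simp only [Finset.sum_sub_distrib, ← Finset.mul_sum]
  have h72 : ∑ d ∈ S, ∑ e ∈ S, f (d.lcm e) ≤ ∑ D ∈ sieveSet h (R ^ 2),
      primeProd (fun _ => ((72 : ℕ) : ℝ)) D * (1 + dyadicError h (h * D) N) := by
    refine (sum_sum_lcm_le hR0 hf).trans_eq (Finset.sum_congr rfl fun D _ => ?_)
    simp only [f]
    rw [← mul_assoc, ← primeProd_mul_fun]
    congr 1
    exact primeProd_congr fun _ _ _ => by norm_num
  exact sub_le_sub_left (mul_le_mul_of_nonneg_left h72 (by positivity)) _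

lemma sum_sieveSet_primeProd_const_le {h : ℕ} {x : ℝ} (hx : 1 ≤ x) (K : ℕ) :
    ∑ D ∈ sieveSet h x, primeProd (fun _ => (K : ℝ)) D ≤ x * (1 + Real.log x) ^ K := by
  have hk : ∀ D, 0 ≤ primeProd (fun _ => (K : ℝ)) D := fun D =>
    primeProd_nonneg fun _ _ _ => Nat.cast_nonneg K
  have hfl : Real.log ⌊x⌋₊ ≤ Real.log x :=
    Real.log_le_log (by exact_mod_cast Nat.floor_pos.2 hx) (Nat.floor_le (by linarith))
  have hfl0 : 0 ≤ Real.log ⌊x⌋₊ := Real.log_natCast_nonneg _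
  calc _ ≤ ∑ D ∈ sieveSet h x, x * (primeProd (fun _ => (K : ℝ)) D / D) := by
        refine Finset.sum_le_sum fun D hD => ?_
        obtain ⟨⟨h1, h2⟩, -, -⟩ := mem_sieveSet.1 hD
        have hD0 : (0 : ℝ) < D := by exact_mod_cast h1
        have hDx : (D : ℝ) ≤ x := (Nat.le_floor_iff (by linarith)).1 h2
        rw [mul_div_assoc', le_div_iff₀ hD0, mul_comm]
        exact mul_le_mul_of_nonneg_right hDx (hk D)
    _ ≤ x * ∑ D ∈ (Finset.Icc 1 ⌊x⌋₊).filter Squarefree, primeProd (fun _ => (K : ℝ)) D / D := by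
        rw [← Finset.mul_sum]
        refine mul_le_mul_of_nonneg_left (Finset.sum_le_sum_of_subset_of_nonneg ?_ fun D _ _ =>
          div_nonneg (hk D) (Nat.cast_nonneg D)) (by linarith)
        intro D hD
        obtain ⟨h1, h2, -⟩ := mem_sieveSet.1 hD
        exact Finset.mem_filter.2 ⟨Finset.mem_Icc.2 h1, h2⟩
    _ ≤ _ := mul_le_mul_of_nonneg_left ((sum_squarefree_primeProd_const_div_le K ⌊x⌋₊).trans
        (pow_le_pow_left₀ (by linarith) (by linarith) K)) (by linarith)

lemma exists_remainder_le {ϑ : ℝ} {h : ℕ} (hh : 0 < h) (hϑ : 0.7231 ≤ ϑ) (hD : HypD ϑ h) {c : ℝ}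
    (hc : 0 ≤ c) :
    ∃ K > 0, ∀ᶠ N : ℕ in atTop, ∀ R : ℝ, R = (N : ℝ) ^ (36153 / 100000 : ℝ) →
      ((1 + c) * (1 + Real.log R) ^ 6) ^ 2 * (2 + Real.log (3 * N)) *
        (∑ D ∈ sieveSet h (R ^ 2), primeProd (fun _ => ((72 : ℕ) : ℝ)) D *
          (1 + dyadicError h (h * D) N)) ≤ K * N := by
  obtain ⟨C, hC, H⟩ := exists_sum_primeProd_mul_levelError_le hh hD
    (θ' := 72308 / 100000) (by norm_num at hϑ ⊢; linarith) (by norm_num) 72 13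
  refine ⟨(1 + c) ^ 2 * 2 * (1 + 4 * (C * 3 * 2 ^ 13)), by positivity, ?_⟩
  have hcast := tendsto_natCast_atTop_atTop (R := ℝ)
  have ev1 : ∀ᶠ N : ℕ in atTop, 4 ≤ Real.log N :=
    (Real.tendsto_log_atTop.comp hcast).eventually_ge_atTop 4
  have ev2 : ∀ᶠ N : ℕ in atTop, (h : ℝ) * 2 ≤ (N : ℝ) ^ (2 / 100000 : ℝ) :=
    ((tendsto_rpow_atTop (by norm_num)).comp hcast).eventually_ge_atTop _
  have ev3 : ∀ᶠ N : ℕ in atTop, Real.log N ^ 85 ≤ (N : ℝ) ^ (27694 / 100000 : ℝ) := by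
    have := hcast.eventually ((isLittleO_log_rpow_rpow_atTop (s := 27694 / 100000) (85 : ℕ)
      (by norm_num)).bound one_pos)
    filter_upwards [this, ev1] with N hN hL
    simp only [Real.rpow_natCast] at hN
    rw [one_mul, Real.norm_of_nonneg (pow_nonneg (by linarith) _),
      Real.norm_of_nonneg (by positivity)] at hN
    exact hN
  filter_upwards [ev1, ev2, ev3, eventually_ge_atTop h, eventually_ge_atTop 4]
    with N hL hhN hpoly hNh hN4 R hR
  have hN0 : (4 : ℝ) ≤ N := by exact_mod_cast hN4
  have hN0' : (0 : ℝ) < N := by linarith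
  set L := Real.log N with hLdef
  have hlogR : Real.log R = 36153 / 100000 * L := by rw [hR, Real.log_rpow hN0']
  have hRsq : R ^ 2 = (N : ℝ) ^ (72306 / 100000 : ℝ) := by
    rw [hR, ← Real.rpow_natCast, ← Real.rpow_mul hN0'.le]; norm_num
  have hRsq1 : 1 ≤ R ^ 2 := by
    rw [hRsq]; exact Real.one_le_rpow (by linarith) (by norm_num)
  have hlogRsq : Real.log (R ^ 2) = 72306 / 100000 * L := by rw [hRsq, Real.log_rpow hN0']
  have hlog3 : Real.log 3 ≤ 2 := by
    have := Real.log_le_sub_one_of_pos (show (0 : ℝ) < 3 by norm_num); linarith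
  have hlog2 : Real.log 2 ≤ 1 := by
    have := Real.log_le_sub_one_of_pos (show (0 : ℝ) < 2 by norm_num); linarith
  have hl : Real.log (3 * N) = Real.log 3 + L := Real.log_mul (by norm_num) hN0'.ne'
  have hl0 : 0 ≤ Real.log (3 * N) := Real.log_nonneg (by linarith)
  have pre : ((1 + c) * (1 + Real.log R) ^ 6) ^ 2 * (2 + Real.log (3 * N)) ≤
      (1 + c) ^ 2 * 2 * L ^ 13 := by
    have h1 : (1 + Real.log R) ^ 6 ≤ L ^ 6 :=
      pow_le_pow_left₀ (by rw [hlogR]; linarith) (by rw [hlogR]; linarith) 6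
    have h0 : 0 ≤ (1 + Real.log R) ^ 6 := pow_nonneg (by rw [hlogR]; linarith) 6
    calc _ ≤ ((1 + c) * L ^ 6) ^ 2 * (2 * L) := by
          refine mul_le_mul (pow_le_pow_left₀ (by positivity)
            (mul_le_mul_of_nonneg_left h1 (by linarith)) 2) (by linarith) (by linarith)
            (by positivity)
      _ = _ := by ring
  have hfloor : ((h * ⌊R ^ 2⌋₊ : ℕ) : ℝ) ≤ ((N : ℝ) / 2) ^ (72308 / 100000 : ℝ) := by
    have h1 : (⌊R ^ 2⌋₊ : ℝ) ≤ (N : ℝ) ^ (72306 / 100000 : ℝ) :=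
      (Nat.floor_le (by positivity)).trans_eq hRsq
    have h2 : (2 : ℝ) ^ (72308 / 100000 : ℝ) ≤ 2 :=
      Real.rpow_le_self_of_one_le one_le_two (by norm_num)
    have h3 : (0 : ℝ) < (2 : ℝ) ^ (72308 / 100000 : ℝ) := by positivity
    rw [Real.div_rpow hN0'.le (by norm_num), le_div_iff₀ h3]
    push_cast
    calc (h : ℝ) * ⌊R ^ 2⌋₊ * 2 ^ (72308 / 100000 : ℝ) ≤
          h * (N : ℝ) ^ (72306 / 100000 : ℝ) * 2 := by gcongr
      _ = (h * 2) * (N : ℝ) ^ (72306 / 100000 : ℝ) := by ring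
      _ ≤ (N : ℝ) ^ (2 / 100000 : ℝ) * (N : ℝ) ^ (72306 / 100000 : ℝ) := by gcongr
      _ = _ := by rw [← Real.rpow_add hN0']; norm_num
  have hlev : ∀ M : ℕ, N ≤ M + 1 → M ≤ 3 * N → ∑ D ∈ sieveSet h (R ^ 2),
      primeProd (fun _ => ((72 : ℕ) : ℝ)) D * levelError h (h * D) M ≤
        C * 3 * 2 ^ 13 * (N / L ^ 13) := fun M hM1 hM2 => by
    have hM1' : (N : ℝ) ≤ M + 1 := by exact_mod_cast hM1
    have hM2' : (M : ℝ) ≤ 3 * N := by exact_mod_cast hM2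
    have hMN : (N : ℝ) / 2 ≤ M := by linarith
    have hlogM : L / 2 ≤ Real.log M := by
      have := Real.log_le_log (by linarith) hMN
      rw [Real.log_div hN0'.ne' (by norm_num)] at this
      linarith
    have := H M (by linarith) ⌊R ^ 2⌋₊
      (hfloor.trans (Real.rpow_le_rpow (by linarith) hMN (by norm_num)))
    refine (Finset.sum_le_sum_of_subset_of_nonneg ?_ fun D _ _ => ?_).trans (this.trans ?_)
    · intro D hD
      obtain ⟨h1, h2, -⟩ := mem_sieveSet.1 hD
      exact Finset.mem_filter.2 ⟨Finset.mem_Icc.2 h1, h2⟩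
    · exact mul_nonneg (primeProd_nonneg fun _ _ _ => Nat.cast_nonneg _) (levelError_nonneg _ _ _)
    · calc C * M / Real.log M ^ 13 ≤ C * (3 * N) / (L / 2) ^ 13 := by gcongr
        _ = _ := by field_simp
  have hone : ∑ D ∈ sieveSet h (R ^ 2), primeProd (fun _ => ((72 : ℕ) : ℝ)) D ≤ N / L ^ 13 := by
    refine (sum_sieveSet_primeProd_const_le hRsq1 72).trans ?_
    rw [le_div_iff₀ (by positivity)]
    have : (1 + Real.log (R ^ 2)) ^ 72 ≤ L ^ 72 :=
      pow_le_pow_left₀ (by rw [hlogRsq]; linarith) (by rw [hlogRsq]; linarith) 72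
    calc R ^ 2 * (1 + Real.log (R ^ 2)) ^ 72 * L ^ 13 ≤ R ^ 2 * L ^ 72 * L ^ 13 := by gcongr
      _ = R ^ 2 * L ^ 85 := by ring
      _ ≤ R ^ 2 * (N : ℝ) ^ (27694 / 100000 : ℝ) := by gcongr
      _ = N := by rw [hRsq, ← Real.rpow_add hN0']; norm_num
  have hsum : ∑ D ∈ sieveSet h (R ^ 2), primeProd (fun _ => ((72 : ℕ) : ℝ)) D *
      (1 + dyadicError h (h * D) N) ≤ (1 + 4 * (C * 3 * 2 ^ 13)) * (N / L ^ 13) := by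
    have l1 := hlev (2 * N - 1) (by omega) (by omega)
    have l2 := hlev (N - 1) (by omega) (by omega)
    have l3 := hlev (2 * N + h - 1) (by omega) (by omega)
    have l4 := hlev (N + h - 1) (by omega) (by omega)
    simp only [dyadicError, mul_add, mul_one, Finset.sum_add_distrib]
    linarith
  calc _ ≤ (1 + c) ^ 2 * 2 * L ^ 13 * ((1 + 4 * (C * 3 * 2 ^ 13)) * (N / L ^ 13)) := by
        refine mul_le_mul pre hsum (Finset.sum_nonneg fun D _ => mul_nonneg
          (primeProd_nonneg fun _ _ _ => Nat.cast_nonneg _) ?_) (by positivity)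
        linarith [dyadicError_nonneg h (h * D) N]
    _ = _ := by field_simp

/-- Under `HypD`, twin primes with gap `h` have the expected order of magnitude. -/
lemma exists_twin_count_lower_bound {ϑ : ℝ} {h : ℕ} (h2 : 2 ∣ h) (hh : 0 < h)
    (hϑ : 0.7231 ≤ ϑ) (hD : HypD ϑ h) :
    ∃ c > 0, ∀ᶠ N : ℕ in atTop, c * (N / Real.log N ^ 2) ≤
      (((Finset.Ico N (2 * N)).filter fun n => n.Prime ∧ (n + h).Prime).card : ℝ) := by
  obtain ⟨δ, hδ, Hδ⟩ := exists_main_term_lower_bound h2 hh.ne'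
  obtain ⟨C, hC, HC⟩ := exists_sieveWeight_one_sq_le h2 hh.ne' (32 / 25)
  obtain ⟨K, hK, HK⟩ := exists_remainder_le hh hϑ hD (c := 32 / 25) (by norm_num)
  have hcast := tendsto_natCast_atTop_atTop (R := ℝ)
  have hpow : Tendsto (fun N : ℕ => (N : ℝ) ^ (36153 / 100000 : ℝ)) atTop atTop :=
    (tendsto_rpow_atTop (by norm_num)).comp hcast
  have hlog : Tendsto (fun N : ℕ => Real.log N) atTop atTop := Real.tendsto_log_atTop.comp hcast
  set κ : ℝ := 36153 / 100000 with hκ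
  have hκ0 : 0 < κ := by norm_num [hκ]
  have hcube : Tendsto (fun N : ℕ => δ * κ ^ 3 / 2 * Real.log N ^ 3) atTop atTop :=
    ((tendsto_pow_atTop three_ne_zero).comp hlog).const_mul_atTop (by positivity)
  refine ⟨δ / (4 * C * κ), by positivity, ?_⟩
  filter_upwards [hpow.eventually Hδ, hpow.eventually HC, HK, hpow.eventually_gt_atTop 1,
    hcube.eventually_ge_atTop K, hlog.eventually_ge_atTop 2, eventually_ge_atTop h,
    eventually_gt_atTop 1] with N a1 a2 a3 hR hKN hL hhN hN1
  have hN0 : (0 : ℝ) < N := by exact_mod_cast (by omega : 0 < N)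
  have hN1' : (1 : ℝ) < N := by exact_mod_cast hN1
  have a4 := a3 _ rfl
  set R : ℝ := (N : ℝ) ^ κ with hRdef
  set L := Real.log N with hLdef
  have hlogR : Real.log R = κ * L := Real.log_rpow hN0 _
  have hlog3N : Real.log (3 * N) = Real.log R / κ + Real.log 3 := by
    rw [Real.log_mul (by norm_num) hN0.ne', hlogR, mul_div_cancel_left₀ _ hκ0.ne', add_comm]
  have hlog3 : Real.log 3 ≤ 2 := by
    have := Real.log_le_sub_one_of_pos (x := 3) (by norm_num)
    linarith
  have hRN : R ^ 2 < N := by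
    rw [hRdef, ← Real.rpow_natCast, ← Real.rpow_mul hN0.le]
    calc (N : ℝ) ^ (κ * (2 : ℕ)) < (N : ℝ) ^ (1 : ℝ) :=
          Real.rpow_lt_rpow_of_exponent_lt hN1' (by norm_num [hκ])
      _ = N := Real.rpow_one _
  have hRlt : R < N := by nlinarith
  have l1 := le_sieveSum (h := h) (N := N) h2 hh (c := 32 / 25) (by norm_num) hR hRN
  have l2 := sieveSum_le (h := h) (N := N) (by omega) hhN (S := sieveSet h R)
    (mem_sieveSet.2 ⟨⟨le_rfl, Nat.le_floor (by simpa using hR.le)⟩, squarefree_one,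
      Nat.coprime_one_left h⟩)
    (fun d hd => by
      obtain ⟨⟨b1, b2⟩, -⟩ := mem_sieveSet.1 hd
      exact ⟨b1, by exact_mod_cast
        ((Nat.le_floor_iff (by positivity)).1 b2).trans_lt hRlt⟩)
    (sieveWeight h (32 / 25) R)
  set π : ℝ := (((Finset.Ico N (2 * N)).filter fun n => n.Prime ∧ (n + h).Prime).card : ℝ)
  have hπ : 0 ≤ π := Nat.cast_nonneg _
  have hmain := mul_le_mul_of_nonneg_left a1 hN0.le
  rw [← hlog3N] at hmain
  have hup : π * Real.log (3 * N) * sieveWeight h (32 / 25) R 1 ^ 2 ≤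
      π * (2 * L) * (C * Real.log R ^ 4) := by
    refine mul_le_mul (mul_le_mul_of_nonneg_left ?_ hπ) a2 (sq_nonneg _) (by positivity)
    rw [hlog3N, hlogR, mul_div_cancel_left₀ _ hκ0.ne']
    linarith
  have hfin : N * (δ * Real.log R ^ 3) - K * N ≤ π * (2 * L) * (C * Real.log R ^ 4) :=
    (sub_le_sub hmain a4).trans (l1.trans (l2.trans hup))
  rw [hlogR] at hfin
  have hKN' := mul_le_mul_of_nonneg_right hKN hN0.le
  have hL0 : 0 < L := by linarith
  have hfin2 : N * (δ * κ ^ 3 / 2 * L ^ 3) ≤ π * (2 * C * κ ^ 4 * L ^ 5) := by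
    calc N * (δ * κ ^ 3 / 2 * L ^ 3) =
          N * (δ * (κ * L) ^ 3) - δ * κ ^ 3 / 2 * L ^ 3 * N := by ring
      _ ≤ N * (δ * (κ * L) ^ 3) - K * N := sub_le_sub_left hKN' _
      _ ≤ π * (2 * L) * (C * (κ * L) ^ 4) := hfin
      _ = _ := by ring
  rw [div_mul_div_comm, div_le_iff₀ (by positivity)]
  have h3 : 0 < κ ^ 3 * L ^ 3 / 2 := by positivity
  refine le_of_mul_le_mul_right ?_ h3
  linarith

lemma LambdaR_pair_eq {h n : ℕ} {R : ℝ} (hh : h ≠ 0) (hR : 1 ≤ R) (hRn : R < n)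
    (hn : n.Prime) (hnh : (n + h).Prime) (l : ℕ) :
    LambdaR R n {0, h} l = Real.log R ^ (2 + l) / (2 + l).factorial := by
  have hcard : ({0, h} : Finset ℕ).card = 2 := Finset.card_pair hh.symm
  rw [LambdaR, hcard, Finset.sum_eq_single_of_mem 1
    (Finset.mem_Icc.2 ⟨le_rfl, Nat.le_floor (by simpa using hR)⟩)]
  · simp [div_eq_inv_mul]
  · intro d hd hd1
    obtain ⟨b1, b2⟩ := Finset.mem_Icc.1 hd
    have hdn : d < n := by
      exact_mod_cast ((Nat.le_floor_iff (by linarith)).1 b2).trans_lt hRn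
    rw [if_neg]
    rw [Finset.prod_pair hh.symm, add_zero]
    exact fun hdvd => hd1 (eq_one_of_dvd_prime_mul_prime b1 hdn (by omega) hn hnh hdvd)

/-- Equation (3.7): with `H = {0, h}`, `u₀ = (√34 - 2)/9` and
`a'ₙ = (Λ_R(n; H, 0) + (3u₀/log R) Λ_R(n; H, 1))²`, if `ϑ ≥ 0.7231` and
Hypothesis D(ϑ, h) holds, then there are `c₁ > 0` and `ε > 0` such that with
`R = N^{(ϑ-ε)/2}`, for all large `N`,
`(1/N) ∑_{n ~ N, n, n+h prime} a'ₙ log(3N) ≥ c₁ 𝔖₀(h) (log R)³`. -/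
theorem weighted_twin_count_lower_bound (h : ℕ) (hpos : 0 < h) (heven : Even h)
    (ϑ : ℝ) (hϑ : 0.7231 ≤ ϑ) (hD : HypD ϑ h) :
    ∃ c₁ ε : ℝ, 0 < c₁ ∧ 0 < ε ∧ ∃ N₀ : ℕ, ∀ N : ℕ, N₀ ≤ N →
      c₁ * singSeries0 h * Real.log ((N : ℝ) ^ ((ϑ - ε) / 2)) ^ 3 ≤
        (N : ℝ)⁻¹ *
          (∑ n ∈ (Finset.Ico N (2 * N)).filter (fun n => n.Prime ∧ (n + h).Prime),
            (LambdaR ((N : ℝ) ^ ((ϑ - ε) / 2)) n {0, h} 0 +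
              3 * ((Real.sqrt 34 - 2) / 9) / Real.log ((N : ℝ) ^ ((ϑ - ε) / 2)) *
                LambdaR ((N : ℝ) ^ ((ϑ - ε) / 2)) n {0, h} 1) ^ 2) *
          Real.log (3 * N) := by
  obtain ⟨c, hc, H⟩ := exists_twin_count_lower_bound heven.two_dvd hpos hϑ hD
  refine ⟨c / (16 * (|singSeries0 h| + 1)), ϑ - 1 / 2, by positivity, by norm_num at hϑ; linarith,
    ?_⟩
  rw [show (ϑ - (ϑ - 1 / 2)) / 2 = 1 / 4 by ring]
  obtain ⟨N₀, hN₀⟩ := eventually_atTop.1 (H.and (eventually_gt_atTop 1))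
  refine ⟨N₀, fun N hN => ?_⟩
  obtain ⟨hcount, hN1⟩ := hN₀ N hN
  have hN1' : (1 : ℝ) < N := by exact_mod_cast hN1
  have hN0 : (0 : ℝ) < N := by linarith
  set L := Real.log N with hLdef
  have hL : 0 < L := Real.log_pos hN1'
  set R : ℝ := (N : ℝ) ^ (1 / 4 : ℝ) with hR
  have hlogR : Real.log R = L / 4 := by rw [hR, Real.log_rpow hN0]; ring
  have hR1 : 1 ≤ R := Real.one_le_rpow hN1'.le (by norm_num)
  have hRN : R < N := by
    have := Real.rpow_lt_rpow_of_exponent_lt hN1' (show (1 / 4 : ℝ) < 1 by norm_num)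
    rwa [Real.rpow_one] at this
  have hsqrt : 2 ≤ Real.sqrt 34 := Real.le_sqrt_of_sq_le (by norm_num)
  have hlog3N : L ≤ Real.log (3 * N) := Real.log_le_log hN0 (by linarith)
  have hterm : ∀ n ∈ (Finset.Ico N (2 * N)).filter (fun n => n.Prime ∧ (n + h).Prime),
      (Real.log R ^ 2 / 2) ^ 2 ≤ (LambdaR R n {0, h} 0 +
        3 * ((Real.sqrt 34 - 2) / 9) / Real.log R * LambdaR R n {0, h} 1) ^ 2 := by
    intro n hn
    obtain ⟨hn, hp, hp'⟩ := Finset.mem_filter.1 hn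
    have hNn : (N : ℝ) ≤ n := by exact_mod_cast (Finset.mem_Ico.1 hn).1
    rw [LambdaR_pair_eq hpos.ne' hR1 (by linarith) hp hp',
      LambdaR_pair_eq hpos.ne' hR1 (by linarith) hp hp']
    refine pow_le_pow_left₀ (by positivity) ?_ 2
    have : 0 ≤ 3 * ((Real.sqrt 34 - 2) / 9) / Real.log R *
        (Real.log R ^ (2 + 1) / (2 + 1).factorial) := by
      have : 0 < Real.log R := by rw [hlogR]; positivity
      have : 0 ≤ Real.sqrt 34 - 2 := by linarith
      positivity
    simpa using this
  have hsum := Finset.card_nsmul_le_sum _ _ _ hterm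
  rw [nsmul_eq_mul] at hsum
  calc c / (16 * (|singSeries0 h| + 1)) * singSeries0 h * Real.log R ^ 3 ≤
        c / 16 * Real.log R ^ 3 := by
        gcongr
        · rw [hlogR]; positivity
        · rw [div_mul_eq_mul_div, div_le_div_iff₀ (by positivity) (by norm_num)]
          nlinarith [le_abs_self (singSeries0 h)]
    _ = (N : ℝ)⁻¹ * (c * (N / L ^ 2) * (Real.log R ^ 2 / 2) ^ 2) * L := by
        rw [hlogR]
        field_simp
        norm_num
    _ ≤ _ := by gcongr; exact (mul_le_mul_of_nonneg_right hcount (by positivity)).trans hsum
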